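/- For every Δ ∈ ℕ and every α > 0 there exist n₀, C ∈ ℕ such that the following holds for all n ≥ n₀: if G is an n-vertex graph with minimum degree δ(G) ≥ (1+α)·n/2 and T is an n-vertex tree with maximum degree Δ(T) ≤ Δ, then there exists a (C/n)-spread probability distribution on embeddings of T into G. -/

import Mathlib

open scoped ENNReal Finset

noncomputable section

section

open scoped Classical

/-- The maps that agree with `y` on the finite set `J`. -/
def agreeSet {V W : Type*} (J : Finset V) (y : V → W) : Set (V → W) := {f | ∀ x ∈ J, f x = y x}

/-- A random map is `q`-spread on `S` if prescribing its values on `J ⊆ S` has probability at most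
`q ^ #J`. -/
def SpreadOn {V W : Type*} (q : ℝ≥0∞) (S : Finset V) (μ : PMF (V → W)) : Prop :=
  ∀ J ⊆ S, ∀ y : V → W, μ.toOuterMeasure (agreeSet J y) ≤ q ^ #J

theorem pmf_toOuterMeasure_le_one {Ω : Type*} (μ : PMF Ω) (s : Set Ω) : μ.toOuterMeasure s ≤ 1 := by
  rw [PMF.toOuterMeasure_apply, ← μ.tsum_coe]
  exact ENNReal.tsum_le_tsum fun x => Set.indicator_le_self _ _ _

theorem pmf_tsum_mul_le {Ω : Type*} (μ : PMF Ω) (g : Ω → ℝ≥0∞) (c : ℝ≥0∞)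
    (h : ∀ ω ∈ μ.support, g ω ≤ c) : ∑' ω, μ ω * g ω ≤ c := by
  calc ∑' ω, μ ω * g ω ≤ ∑' ω, μ ω * c := by
        refine ENNReal.tsum_le_tsum fun ω => ?_
        by_cases hω : μ ω = 0
        · simp [hω]
        · gcongr
          exact h ω ((PMF.mem_support_iff _ _).2 hω)
    _ = c := by rw [ENNReal.tsum_mul_right, μ.tsum_coe, one_mul]

theorem pmf_toOuterMeasure_mono_support {Ω : Type*} (μ : PMF Ω) {s t : Set Ω}
    (h : ∀ ω ∈ μ.support, ω ∈ s → ω ∈ t) : μ.toOuterMeasure s ≤ μ.toOuterMeasure t := by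
  rw [PMF.toOuterMeasure_apply, PMF.toOuterMeasure_apply]
  refine ENNReal.tsum_le_tsum fun ω => ?_
  by_cases hω : μ ω = 0
  · simp [Set.indicator_apply, hω]
  · by_cases hs : ω ∈ s
    · rw [Set.indicator_of_mem hs, Set.indicator_of_mem (h ω ((PMF.mem_support_iff _ _).2 hω) hs)]
    · rw [Set.indicator_of_notMem hs]; exact zero_le

theorem pmf_tsum_mul_indicator {Ω : Type*} (μ : PMF Ω) (s : Set Ω) (c : ℝ≥0∞) :
    ∑' ω, μ ω * s.indicator (fun _ => c) ω = μ.toOuterMeasure s * c := by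
  rw [PMF.toOuterMeasure_apply, ← ENNReal.tsum_mul_right]
  refine tsum_congr fun ω => ?_
  by_cases hs : ω ∈ s <;> simp [hs]

theorem pmf_tsum_bind_mul {Ω Ω' : Type*} (μ : PMF Ω) (κ : Ω → PMF Ω') (g : Ω' → ℝ≥0∞) :
    ∑' ω', (μ.bind κ) ω' * g ω' = ∑' ω, μ ω * ∑' ω', κ ω ω' * g ω' := by
  simp_rw [PMF.bind_apply, ← ENNReal.tsum_mul_right, ← ENNReal.tsum_mul_left, mul_assoc]
  exact ENNReal.tsum_comm

section SpreadMaps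

variable {V W : Type*}

/-- Random sequential assignment of values, uniformly from sets of at least `m` admissible values,
yields an `m⁻¹`-spread random map; a potential that does not increase on average along the process
is controlled in expectation at the end. -/
theorem exists_spread_process [DecidableEq V] (m : ℕ) (hm : 0 < m) (E : Finset V)
    (Inv : Finset V → (V → W) → Prop) (Φ : Finset V → (V → W) → ℝ≥0∞)
    (step : ∀ D ⊆ E, D ≠ E → ∀ f, Inv D f → ∃ x ∈ E, x ∉ D ∧ ∃ A : Finset W, m ≤ #A ∧
      (∀ c ∈ A, Inv (insert x D) (Function.update f x c)) ∧
      ∑ c ∈ A, Φ (insert x D) (Function.update f x c) ≤ #A * Φ D f)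
    (D : Finset V) (hD : D ⊆ E) (f : V → W) (hf : Inv D f) :
    ∃ μ : PMF (V → W), (∀ g ∈ μ.support, Inv E g ∧ ∀ v, v ∉ E \ D → g v = f v) ∧
      SpreadOn (m : ℝ≥0∞)⁻¹ (E \ D) μ ∧ ∑' g, μ g * Φ E g ≤ Φ D f := by
  induction hk : #(E \ D) generalizing D f with
  | zero =>
    have hDE : D = E := by
      refine Finset.Subset.antisymm hD ?_
      rw [Finset.card_eq_zero, Finset.sdiff_eq_empty_iff_subset] at hk
      exact hk
    subst hDE
    refine ⟨PMF.pure f, ?_, ?_, ?_⟩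
    · intro g hg
      rw [PMF.support_pure, Set.mem_singleton_iff] at hg
      subst hg
      exact ⟨hf, fun _ _ => rfl⟩
    · intro J hJ y
      have : J = ∅ := by simpa using hJ
      subst this
      rw [Finset.card_empty, pow_zero]
      exact pmf_toOuterMeasure_le_one _ _
    · refine pmf_tsum_mul_le _ _ _ fun g hg => ?_
      rw [PMF.support_pure, Set.mem_singleton_iff] at hg
      rw [hg]
  | succ k ih =>
    have hne : D ≠ E := by
      rintro rfl
      simp at hk
    obtain ⟨x, hxE, hxD, A, hmA, hInv, hΦ⟩ := step D hD hne f hf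
    have hA : A.Nonempty := Finset.card_pos.1 (by omega)
    have hsub : insert x D ⊆ E := Finset.insert_subset hxE hD
    have hcard : #(E \ insert x D) = k := by
      rw [Finset.sdiff_insert, Finset.card_erase_of_mem (by simp [hxE, hxD]), hk]; rfl
    have hex : ∀ c : W, ∃ μ : PMF (V → W), c ∈ A →
        ((∀ g ∈ μ.support, Inv E g ∧ ∀ v, v ∉ E \ insert x D → g v = Function.update f x c v) ∧
        SpreadOn (m : ℝ≥0∞)⁻¹ (E \ insert x D) μ ∧
        ∑' g, μ g * Φ E g ≤ Φ (insert x D) (Function.update f x c)) := by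
      intro c
      by_cases hc : c ∈ A
      · obtain ⟨μ, hμ⟩ := ih (insert x D) hsub (Function.update f x c) (hInv c hc) hcard
        exact ⟨μ, fun _ => hμ⟩
      · exact ⟨PMF.pure f, fun h => absurd h hc⟩
    choose κ hκ using hex
    have hsum : ∀ F : W → ℝ≥0∞, ∑' c, (PMF.uniformOfFinset A hA) c * F c
        = (#A : ℝ≥0∞)⁻¹ * ∑ c ∈ A, F c := by
      intro F
      rw [tsum_eq_sum (s := A), Finset.mul_sum]
      · refine Finset.sum_congr rfl fun c hc => ?_
        rw [PMF.uniformOfFinset_apply, if_pos hc]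
      · intro c hc
        rw [PMF.uniformOfFinset_apply, if_neg hc, zero_mul]
    have hA0 : (#A : ℝ≥0∞) ≠ 0 := by simpa using hA.ne_empty
    have hAt : (#A : ℝ≥0∞) ≠ ∞ := ENNReal.natCast_ne_top _
    refine ⟨(PMF.uniformOfFinset A hA).bind κ, ?_, ?_, ?_⟩
    · intro g hg
      rw [PMF.mem_support_bind_iff] at hg
      obtain ⟨c, hc, hg⟩ := hg
      rw [PMF.mem_support_uniformOfFinset_iff] at hc
      obtain ⟨h1, h2⟩ := (hκ c hc).1 g hg
      refine ⟨h1, fun v hv => ?_⟩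
      have hvx : v ≠ x := by
        rintro rfl
        exact hv (by simp [hxE, hxD])
      rw [h2 v (by simp only [Finset.mem_sdiff, Finset.mem_insert, not_and, not_not] at hv ⊢; tauto),
        Function.update_of_ne hvx]
    · intro J hJ y
      rw [PMF.toOuterMeasure_bind_apply]
      by_cases hxJ : x ∈ J
      · have key : ∀ c ∈ A, (κ c).toOuterMeasure (agreeSet J y) ≤
            if c = y x then ((m : ℝ≥0∞)⁻¹) ^ #(J.erase x) else 0 := by
          intro c hc
          have hval : ∀ g ∈ (κ c).support, g x = c := by
            intro g hg
            rw [((hκ c hc).1 g hg).2 x (by simp), Function.update_self]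
          split_ifs with hcy
          · refine (pmf_toOuterMeasure_mono_support _ ?_).trans
              ((hκ c hc).2.1 (J.erase x) ?_ y)
            · intro g _ hg z hz
              exact hg z (Finset.mem_of_mem_erase hz)
            · intro z hz
              have := hJ (Finset.mem_of_mem_erase hz)
              have hzx := Finset.ne_of_mem_erase hz
              simp only [Finset.mem_sdiff, Finset.mem_insert] at this ⊢
              tauto
          · rw [nonpos_iff_eq_zero]
            have : (κ c).toOuterMeasure (agreeSet J y) ≤ (κ c).toOuterMeasure ∅ := by
              refine pmf_toOuterMeasure_mono_support _ fun g hg hgJ => ?_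
              exact hcy ((hval g hg).symm.trans (hgJ x hxJ))
            simpa using this
        rw [hsum]
        calc (#A : ℝ≥0∞)⁻¹ * ∑ c ∈ A, (κ c).toOuterMeasure (agreeSet J y)
            ≤ (#A : ℝ≥0∞)⁻¹ * ∑ c ∈ A, if c = y x then ((m : ℝ≥0∞)⁻¹) ^ #(J.erase x) else 0 := by
              gcongr with c hc
              exact key c hc
          _ ≤ (m : ℝ≥0∞)⁻¹ * ((m : ℝ≥0∞)⁻¹) ^ #(J.erase x) := by
              gcongr
              rw [Finset.sum_ite_eq']
              split_ifs
              · exact le_rfl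
              · exact zero_le
          _ = ((m : ℝ≥0∞)⁻¹) ^ #J := by
              rw [← pow_succ', Finset.card_erase_add_one hxJ]
      · refine pmf_tsum_mul_le _ _ _ fun c hc => ?_
        rw [PMF.mem_support_uniformOfFinset_iff] at hc
        refine (hκ c hc).2.1 J ?_ y
        intro z hz
        have := hJ hz
        have hzx : z ≠ x := by rintro rfl; exact hxJ hz
        simp only [Finset.mem_sdiff, Finset.mem_insert] at this ⊢
        tauto
    · rw [pmf_tsum_bind_mul, hsum]
      calc (#A : ℝ≥0∞)⁻¹ * ∑ c ∈ A, ∑' g, κ c g * Φ E g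
          ≤ (#A : ℝ≥0∞)⁻¹ * ∑ c ∈ A, Φ (insert x D) (Function.update f x c) := by
            gcongr with c hc
            exact (hκ c hc).2.2
        _ ≤ (#A : ℝ≥0∞)⁻¹ * (#A * Φ D f) := by gcongr
        _ = Φ D f := by rw [← mul_assoc, ENNReal.inv_mul_cancel hA0 hAt, one_mul]

/-- Composition of spread random maps. -/
theorem SpreadOn.bind [DecidableEq V] {q : ℝ≥0∞} {D E : Finset V} {μ : PMF (V → W)}
    (hμ : SpreadOn q D μ) (κ : (V → W) → PMF (V → W))
    (hκ : ∀ f ∈ μ.support, (∀ g ∈ (κ f).support, ∀ v ∈ D, g v = f v) ∧ SpreadOn q (E \ D) (κ f)) :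
    SpreadOn q E (μ.bind κ) := by
  intro J hJ y
  rw [PMF.toOuterMeasure_bind_apply]
  calc ∑' f, μ f * (κ f).toOuterMeasure (agreeSet J y)
      ≤ ∑' f, μ f * (agreeSet (J ∩ D) y).indicator (fun _ => q ^ #(J \ D)) f := by
        refine ENNReal.tsum_le_tsum fun f => ?_
        by_cases hf : μ f = 0
        · simp [hf]
        gcongr
        have hf' : f ∈ μ.support := (PMF.mem_support_iff _ _).2 hf
        obtain ⟨h1, h2⟩ := hκ f hf'
        by_cases hfm : f ∈ agreeSet (J ∩ D) y
        · rw [Set.indicator_of_mem hfm]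
          refine (pmf_toOuterMeasure_mono_support _ ?_).trans
            (h2 (J \ D) (Finset.sdiff_subset_sdiff hJ le_rfl) y)
          intro g _ hg z hz
          exact hg z (Finset.mem_sdiff.1 hz).1
        · rw [Set.indicator_of_notMem hfm]
          have : (κ f).toOuterMeasure (agreeSet J y) ≤ (κ f).toOuterMeasure ∅ := by
            refine pmf_toOuterMeasure_mono_support _ fun g hg hgJ => ?_
            refine hfm fun z hz => ?_
            rw [Finset.mem_inter] at hz
            rw [← h1 g hg z hz.2]
            exact hgJ z hz.1
          simpa using this
    _ = μ.toOuterMeasure (agreeSet (J ∩ D) y) * q ^ #(J \ D) := pmf_tsum_mul_indicator _ _ _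
    _ ≤ q ^ #(J ∩ D) * q ^ #(J \ D) := by
        gcongr
        exact hμ _ Finset.inter_subset_right y
    _ = q ^ #J := by rw [← pow_add, Finset.card_inter_add_card_sdiff]

/-- Conditioning on an event of probability at least one half costs a factor two. -/
theorem SpreadOn.filter {q : ℝ≥0∞} {E : Finset V} {μ : PMF (V → W)} (hμ : SpreadOn q E μ)
    (s : Set (V → W)) (hs : 1 ≤ 2 * μ.toOuterMeasure s) :
    ∃ ν : PMF (V → W), (∀ f ∈ ν.support, f ∈ s ∧ f ∈ μ.support) ∧ SpreadOn (2 * q) E ν := by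
  have hpos : μ.toOuterMeasure s ≠ 0 := by
    intro h
    simp [h] at hs
  have hex : ∃ a ∈ s, a ∈ μ.support := by
    by_contra hcon
    push Not at hcon
    refine hpos ((PMF.toOuterMeasure_apply_eq_zero_iff _ _).2 ?_)
    rw [Set.disjoint_left]
    exact fun a ha hs => hcon a hs ha
  refine ⟨μ.filter s hex, fun f hf => (PMF.mem_support_filter_iff hex).1 hf, ?_⟩
  intro J hJ y
  rcases J.eq_empty_or_nonempty with rfl | hJne
  · simpa using pmf_toOuterMeasure_le_one _ _
  have hinv : (∑' a', s.indicator (⇑μ) a')⁻¹ ≤ 2 := by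
    rw [← PMF.toOuterMeasure_apply, ENNReal.inv_le_iff_inv_le]
    rw [ENNReal.inv_le_iff_le_mul (by simp) (by simp)]
    exact hs
  rw [PMF.toOuterMeasure_apply]
  calc ∑' f, (agreeSet J y).indicator (⇑(μ.filter s hex)) f
      ≤ ∑' f, 2 * (agreeSet J y).indicator (⇑μ) f := by
        refine ENNReal.tsum_le_tsum fun f => ?_
        by_cases hf : f ∈ agreeSet J y
        · rw [Set.indicator_of_mem hf, Set.indicator_of_mem hf, PMF.filter_apply, mul_comm]
          gcongr
          exact Set.indicator_le_self _ _ _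
        · simp [hf]
    _ = 2 * μ.toOuterMeasure (agreeSet J y) := by
        rw [ENNReal.tsum_mul_left, PMF.toOuterMeasure_apply]
    _ ≤ 2 ^ #J * q ^ #J := by
        gcongr
        · exact le_self_pow₀ (by norm_num) (Finset.card_pos.2 hJne).ne'
        · exact hμ J hJ y
    _ = (2 * q) ^ #J := (mul_pow _ _ _).symm

theorem SpreadOn.mono {q q' : ℝ≥0∞} (h : q ≤ q') {E : Finset V} {μ : PMF (V → W)}
    (hμ : SpreadOn q E μ) : SpreadOn q' E μ :=
  fun J hJ y => (hμ J hJ y).trans (by gcongr)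

end SpreadMaps

theorem pow_self_le_three_pow_mul_factorial (r : ℕ) : r ^ r ≤ 3 ^ r * r.factorial := by
  have h1 : (r : ℝ) ^ r / r.factorial ≤ Real.exp r :=
    Real.pow_div_factorial_le_exp (r : ℝ) (by positivity) r
  have h2 : Real.exp r ≤ 3 ^ r := by
    rw [← mul_one (r : ℝ), Real.exp_nat_mul]
    gcongr
    exact Real.exp_one_lt_three.le
  have h3 : (r : ℝ) ^ r ≤ 3 ^ r * r.factorial := by
    rw [div_le_iff₀ (by positivity)] at h1
    exact h1.trans (by gcongr)
  exact_mod_cast h3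

theorem pow_mul_factorial_sub_le (r a : ℕ) (ha : a ≤ r) :
    r ^ a * (r - a).factorial ≤ 9 ^ a * r.factorial := by
  rcases le_or_gt (2 * a) r with h | h
  · have h1 : (r + 1 - a) ^ a * (r - a).factorial ≤ r.factorial := by
      rw [← Nat.factorial_mul_descFactorial ha, mul_comm]
      gcongr
      exact Nat.pow_sub_le_descFactorial r a
    calc r ^ a * (r - a).factorial ≤ (9 * (r + 1 - a)) ^ a * (r - a).factorial := by
          gcongr; omega
      _ = 9 ^ a * ((r + 1 - a) ^ a * (r - a).factorial) := by rw [mul_pow, mul_assoc]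
      _ ≤ 9 ^ a * r.factorial := by gcongr
  · calc r ^ a * (r - a).factorial ≤ r ^ a * r ^ (r - a) := by
          gcongr
          exact (Nat.factorial_le_pow (r - a)).trans (by gcongr; omega)
      _ = r ^ r := by rw [← pow_add]; congr 1; omega
      _ ≤ 3 ^ r * r.factorial := pow_self_le_three_pow_mul_factorial r
      _ ≤ 3 ^ (2 * a) * r.factorial := by
          gcongr
          · norm_num
      _ = 9 ^ a * r.factorial := by rw [pow_mul]; norm_num

theorem card_perm_agree_le {α : Type*} [Fintype α] (J : Finset α) (ρ₀ : Equiv.Perm α) :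
    #{ρ : Equiv.Perm α | ∀ x ∈ J, ρ x = ρ₀ x} ≤ (Fintype.card α - #J).factorial := by
  have hcard : Fintype.card {f : Equiv.Perm α // ∀ a, ¬ (a ∉ J) → f a = a}
      = (Fintype.card α - #J).factorial := by
    rw [← Fintype.card_congr (Equiv.Perm.subtypeEquivSubtypePerm (fun a => a ∉ J)),
      Fintype.card_perm, Fintype.card_subtype_compl, Fintype.card_coe]
  rw [← hcard, Fintype.card_subtype]
  refine Finset.card_le_card_of_injOn (fun ρ => ρ₀⁻¹ * ρ) ?_ ?_
  · intro ρ hρ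
    simp only [Finset.coe_filter, Finset.mem_univ, true_and, Set.mem_ofPred_eq, not_not] at hρ ⊢
    intro a ha
    simp [hρ a ha]
  · intro ρ _ ρ' _ h
    exact mul_left_cancel h

/-- A uniformly random bijection between finite sets of size `r` is `9 / r`-spread. -/
theorem exists_spread_bijection {V W : Type*} (g : V → W) (Λ : Finset V) (L : Finset W)
    (h : #Λ = #L) :
    ∃ μ : PMF (V → W), (∀ f ∈ μ.support, (∀ v, v ∉ Λ → f v = g v) ∧ Set.InjOn f Λ ∧
      ∀ v ∈ Λ, f v ∈ L) ∧ SpreadOn (9 * (#Λ : ℝ≥0∞)⁻¹) Λ μ := by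
  let e : Λ ≃ L := Finset.equivOfCardEq h
  let F : Equiv.Perm Λ → V → W := fun ρ v => if hv : v ∈ Λ then (e (ρ ⟨v, hv⟩) : W) else g v
  refine ⟨(PMF.uniformOfFintype (Equiv.Perm Λ)).map F, ?_, ?_⟩
  · intro f hf
    rw [PMF.mem_support_map_iff] at hf
    obtain ⟨ρ, -, rfl⟩ := hf
    refine ⟨fun v hv => by simp [F, hv], ?_, fun v hv => by simp [F, hv]⟩
    intro v hv w hw hvw
    rw [Finset.mem_coe] at hv hw
    simp only [F, hv, hw, dite_true] at hvw
    have := ρ.injective (e.injective (Subtype.ext hvw))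
    simpa using this
  · intro J hJ y
    rw [PMF.toOuterMeasure_map_apply, PMF.toOuterMeasure_uniformOfFintype_apply]
    set r := #Λ with hr
    have hcount : Fintype.card (F ⁻¹' agreeSet J y) ≤ (r - #J).factorial := by
      rcases (F ⁻¹' agreeSet J y).eq_empty_or_nonempty with hem | ⟨ρ₀, hρ₀⟩
      · simp [hem]
      · have hsub := card_perm_agree_le (J.subtype (· ∈ Λ)) ρ₀
        rw [Fintype.card_coe, Finset.card_subtype, Finset.filter_true_of_mem (fun x hx => hJ hx)]
          at hsub
        refine le_trans ?_ hsub
        rw [Fintype.card_subtype]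
        refine Finset.card_le_card fun ρ hρ => ?_
        simp only [Finset.mem_filter, Finset.mem_univ, true_and, Finset.mem_subtype] at hρ ⊢
        rintro ⟨x, hx⟩ hxJ
        have h1 := hρ x hxJ
        have h2 := hρ₀ x hxJ
        have h3 := h1.trans h2.symm
        simp only [F, hx, dite_true] at h3
        exact e.injective (Subtype.ext h3)
    have ha : #J ≤ r := Finset.card_le_card hJ
    rw [Fintype.card_perm, Fintype.card_coe, ← hr]
    rcases Nat.eq_zero_or_pos r with h0 | hpos
    · have : #J = 0 := by omega
      rw [this, pow_zero, h0]
      have : Fintype.card (F ⁻¹' agreeSet J y) ≤ 1 := hcount.trans (by simp [h0])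
      simpa using this
    have hmain := pow_mul_factorial_sub_le r #J ha
    have hr0 : (r : ℝ≥0∞) ^ #J ≠ 0 := pow_ne_zero _ (by exact_mod_cast hpos.ne')
    have hrt : (r : ℝ≥0∞) ^ #J ≠ ∞ := ENNReal.pow_ne_top (ENNReal.natCast_ne_top _)
    refine ENNReal.div_le_of_le_mul ?_
    rw [mul_pow, ← ENNReal.inv_pow]
    calc ((Fintype.card (F ⁻¹' agreeSet J y) : ℕ) : ℝ≥0∞) ≤ ((r - #J).factorial : ℕ) := by
          exact_mod_cast hcount
      _ = ((r : ℝ≥0∞) ^ #J)⁻¹ * (((r ^ #J * (r - #J).factorial : ℕ)) : ℝ≥0∞) := by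
          push_cast
          rw [← mul_assoc, ENNReal.inv_mul_cancel hr0 hrt, one_mul]
      _ ≤ ((r : ℝ≥0∞) ^ #J)⁻¹ * ((9 ^ #J * r.factorial : ℕ) : ℝ≥0∞) := by
          gcongr
      _ = _ := by push_cast; ring

/-- The neighbours of a vertex of a finite graph, as a finite set. -/
def nbr {V : Type*} [Fintype V] (T : SimpleGraph V) (v : V) : Finset V :=
  Finset.univ.filter fun w => T.Adj v w

@[simp] theorem mem_nbr {V : Type*} [Fintype V] {T : SimpleGraph V} {v w : V} :
    w ∈ nbr T v ↔ T.Adj v w := by simp [nbr]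

/-- `par` and `dep` are the parent and depth functions of the tree `T` rooted at `ρ`. -/
structure IsRooting {V : Type*} (T : SimpleGraph V) (ρ : V) (par : V → V) (dep : V → ℕ) :
    Prop where
  dep_par : ∀ v, v ≠ ρ → dep v = dep (par v) + 1
  par_root : par ρ = ρ
  adj_iff : ∀ a b, T.Adj a b ↔ (a ≠ ρ ∧ par a = b) ∨ (b ≠ ρ ∧ par b = a)

theorem SimpleGraph.IsTree.exists_isRooting {V : Type*} {T : SimpleGraph V}
    (hT : T.IsTree) (ρ : V) : ∃ par dep, IsRooting T ρ par dep := by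
  have hex : ∀ v, v ≠ ρ → ∃ w, T.Adj v w ∧ T.dist ρ v = T.dist ρ w + 1 := by
    intro v hv
    obtain ⟨p, hp⟩ := (hT.connected v ρ).exists_walk_length_eq_dist
    cases p with
    | nil => exact absurd rfl hv
    | @cons _ w _ h q =>
      refine ⟨w, h, ?_⟩
      have h1 : T.dist w ρ ≤ q.length := SimpleGraph.dist_le q
      rw [SimpleGraph.Walk.length_cons] at hp
      rw [SimpleGraph.dist_comm, SimpleGraph.dist_comm (u := ρ) (v := w)]
      have h2 := hT.dist_eq_dist_add_one_of_adj ρ h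
      rw [SimpleGraph.dist_comm, SimpleGraph.dist_comm (u := ρ) (v := w)] at h2
      omega
  have huniq : ∀ v w w', T.Adj v w → T.dist ρ v = T.dist ρ w + 1 →
      T.Adj v w' → T.dist ρ v = T.dist ρ w' + 1 → w = w' := by
    have key : ∀ v w, T.Adj v w → T.dist ρ v = T.dist ρ w + 1 →
        ∃ p : T.Walk v ρ, p.IsPath ∧ p.snd = w := by
      intro v w h hd
      obtain ⟨q, hq, hq'⟩ := (hT.connected w ρ).exists_path_of_dist
      refine ⟨.cons h q, hq.cons ?_, by simp⟩
      intro hv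
      have h1 := SimpleGraph.dist_le (q.dropUntil v hv)
      have h2 := q.length_dropUntil_le_length hv
      rw [SimpleGraph.dist_comm] at hq' h1
      omega
    intro v w w' h1 h2 h3 h4
    obtain ⟨p, hp, rfl⟩ := key v w h1 h2
    obtain ⟨p', hp', rfl⟩ := key v w' h3 h4
    rw [(hT.existsUnique_path v ρ).unique hp hp']
  choose! par hpar using hex
  refine ⟨fun v => if v = ρ then ρ else par v, T.dist ρ, fun v hv => ?_, by simp, fun a b => ?_⟩
  · simp only [if_neg hv]; exact (hpar v hv).2
  · constructor
    · intro h
      rcases hT.dist_eq_dist_add_one_of_adj ρ h with h1 | h1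
      · have ha : a ≠ ρ := by rintro rfl; simp at h1
        exact Or.inl ⟨ha, by simpa only [if_neg ha] using huniq a _ _ (hpar a ha).1 (hpar a ha).2 h h1⟩
      · have hb : b ≠ ρ := by rintro rfl; simp at h1
        exact Or.inr ⟨hb, by
          simpa only [if_neg hb] using huniq b _ _ (hpar b hb).1 (hpar b hb).2 h.symm h1⟩
    · rintro (⟨h1, h2⟩ | ⟨h1, h2⟩)
      · simp only [if_neg h1] at h2; exact h2 ▸ (hpar a h1).1
      · simp only [if_neg h1] at h2; exact h2 ▸ (hpar b h1).1.symm

/-- `PieceChain par P M j D` says that `D` is obtained from `P` by attaching `j` successive subtrees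
with at most `M` vertices each, every one hanging from a vertex already present. -/
inductive PieceChain {V : Type*} (par : V → V) (P : Finset V) (M : ℕ) : ℕ → Finset V → Prop
  | base : PieceChain par P M 0 P
  | step {j : ℕ} {D : Finset V} (S : Finset V) (z : V) : PieceChain par P M j D → Disjoint D S →
      z ∈ S → par z ∈ D → (∀ x ∈ S, x ≠ z → par x ∈ S) → #S ≤ M →
      PieceChain par P M (j + 1) (D ∪ S)

theorem PieceChain.subset {V : Type*} {par : V → V} {P D : Finset V} {M j : ℕ}
    (h : PieceChain par P M j D) : P ⊆ D := by
  induction h with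
  | base => exact Finset.Subset.refl _
  | step S z _ _ _ _ _ _ ih => exact ih.trans Finset.subset_union_left

theorem PieceChain.par_mem {V : Type*} {par : V → V} {P D : Finset V} {M j : ℕ}
    (h : PieceChain par P M j D) (hP : ∀ v ∈ P, par v ∈ P) : ∀ v ∈ D, par v ∈ D := by
  induction h with
  | base => exact hP
  | step S z _ _ hz hpz hS _ ih =>
    intro v hv
    rcases Finset.mem_union.1 hv with hv | hv
    · exact Finset.mem_union_left _ (ih v hv)
    · by_cases hvz : v = z
      · exact Finset.mem_union_left _ (hvz ▸ hpz)
      · exact Finset.mem_union_right _ (hS v hv hvz)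

theorem PieceChain.exists_card_between {V : Type*} {par : V → V} {P D : Finset V} {M J t : ℕ}
    (h : PieceChain par P M J D) (h1 : #P ≤ t) (h2 : t ≤ #D) :
    ∃ j ≤ J, ∃ D', PieceChain par P M j D' ∧ t ≤ #D' ∧ #D' ≤ t + M := by
  induction h with
  | base => exact ⟨0, le_rfl, P, .base, h2, h1.trans (Nat.le_add_right _ _)⟩
  | @step j D S z hc hdis hz hpz hS hM ih =>
    by_cases hle : t ≤ #D
    · obtain ⟨i, hi, D', h3⟩ := ih hle
      exact ⟨i, by omega, D', h3⟩
    · refine ⟨j + 1, le_rfl, D ∪ S, .step S z hc hdis hz hpz hS hM, h2, ?_⟩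
      have := Finset.card_union_le D S
      omega

section Rooted

variable {V : Type*} [Fintype V] {T : SimpleGraph V} {ρ : V} {par : V → V} {dep : V → ℕ}

/-- The descendants of `v` (including `v`) with respect to a parent function. -/
def desc (par : V → V) (v : V) : Finset V := Finset.univ.filter fun w => ∃ i : ℕ, par^[i] w = v

theorem mem_desc {v w : V} : w ∈ desc par v ↔ ∃ i : ℕ, par^[i] w = v := by simp [desc]

theorem self_mem_desc (v : V) : v ∈ desc par v := mem_desc.2 ⟨0, rfl⟩

theorem mem_desc_of_par {v w : V} (h : par w ∈ desc par v) : w ∈ desc par v := by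
  obtain ⟨i, hi⟩ := mem_desc.1 h
  exact mem_desc.2 ⟨i + 1, hi⟩

theorem par_mem_desc {v w : V} (h : w ∈ desc par v) (hne : w ≠ v) : par w ∈ desc par v := by
  obtain ⟨i, hi⟩ := mem_desc.1 h
  cases i with
  | zero => exact absurd hi hne
  | succ i => exact mem_desc.2 ⟨i, hi⟩

theorem mem_of_mem_desc {D : Finset V} (hD : ∀ v ∈ D, par v ∈ D) {v w : V} (h : w ∈ desc par v)
    (hw : w ∈ D) : v ∈ D := by
  obtain ⟨i, rfl⟩ := mem_desc.1 h
  clear h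
  induction i generalizing w with
  | zero => exact hw
  | succ i ih => exact ih (hD w hw)

theorem IsRooting.par_notMem_desc (h : IsRooting T ρ par dep) {v : V} (hv : v ≠ ρ) :
    par v ∉ desc par v := by
  intro hmem
  have key : ∀ i w, dep (par^[i] w) ≤ dep w := by
    intro i
    induction i with
    | zero => simp
    | succ i ih =>
      intro w
      refine (ih (par w)).trans ?_
      by_cases hw : w = ρ
      · rw [hw, h.par_root]
      · have := h.dep_par w hw; omega
  obtain ⟨i, hi⟩ := mem_desc.1 hmem
  have h3 := key i (par v)
  have h4 := h.dep_par v hv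
  rw [hi] at h3
  omega

/-- In a set closed under parents, a subtree with at least `K` vertices, chosen as deep as
possible, has at most `1 + Δ * K` vertices. -/
theorem IsRooting.exists_peel (h : IsRooting T ρ par dep) {Δ K : ℕ}
    (hΔ : ∀ v, #(nbr T v) ≤ Δ) {P D : Finset V} (hP : ∀ v ∈ P, par v ∈ P)
    (hv : ∃ v, v ∉ P ∧ K ≤ #(D ∩ desc par v)) :
    ∃ v, v ∉ P ∧ K ≤ #(D ∩ desc par v) ∧ #(D ∩ desc par v) ≤ 1 + Δ * K := by
  obtain ⟨v, hv, hmax⟩ := Finset.exists_max_image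
    (Finset.univ.filter fun v => v ∉ P ∧ K ≤ #(D ∩ desc par v)) dep
    (by obtain ⟨v, hv⟩ := hv; exact ⟨v, by simpa using hv⟩)
  simp only [Finset.mem_filter, Finset.mem_univ, true_and] at hv hmax
  refine ⟨v, hv.1, hv.2, ?_⟩
  have hsub : D ∩ desc par v ⊆
      insert v (((nbr T v).filter fun c => c ≠ ρ ∧ par c = v).biUnion fun c => D ∩ desc par c) := by
    intro w hw
    obtain ⟨hwD, hw⟩ := Finset.mem_inter.1 hw
    obtain ⟨i, hi⟩ := mem_desc.1 hw
    clear hw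
    rw [Finset.mem_insert]
    by_cases hwv : w = v
    · exact Or.inl hwv
    right
    obtain ⟨i, hi, hi'⟩ : ∃ i, par^[i + 1] w = v ∧ par^[i] w ≠ v := by
      induction i with
      | zero => exact absurd hi hwv
      | succ i ih =>
        by_cases h' : par^[i] w = v
        · exact ih h'
        · exact ⟨i, hi, h'⟩
    rw [Function.iterate_succ_apply'] at hi
    have hne : par^[i] w ≠ ρ := by
      intro h1
      rw [h1, h.par_root] at hi
      exact hi' (h1.trans hi)
    simp only [Finset.mem_biUnion, Finset.mem_filter, mem_nbr, Finset.mem_inter]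
    exact ⟨par^[i] w, ⟨(h.adj_iff _ _).2 (Or.inr ⟨hne, hi⟩), hne, hi⟩, hwD, mem_desc.2 ⟨i, rfl⟩⟩
  refine (Finset.card_le_card hsub).trans ((Finset.card_insert_le _ _).trans ?_)
  rw [add_comm]
  refine Nat.add_le_add_left (Finset.card_biUnion_le.trans ?_) _
  refine (Finset.sum_le_card_nsmul _ _ K fun c hc => ?_).trans ?_
  · simp only [Finset.mem_filter, mem_nbr] at hc
    by_contra! hlt
    have hcP : c ∉ P := fun hcP => hv.1 (hc.2.2 ▸ hP c hcP)
    have h1 := hmax c ⟨hcP, hlt.le⟩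
    have h2 := h.dep_par c hc.2.1
    rw [hc.2.2] at h2
    omega
  · rw [smul_eq_mul]
    exact Nat.mul_le_mul_right _ ((Finset.card_le_card (Finset.filter_subset _ _)).trans (hΔ v))

/-- A tree of bounded degree contains a subtree of prescribed approximate size attached to the rest
of the tree by a single edge. -/
theorem SimpleGraph.IsTree.exists_pendant_subtree (hT : T.IsTree) {Δ k : ℕ}
    (hΔ : ∀ v, #(nbr T v) ≤ Δ) (hcard : 1 + Δ * k < Fintype.card V) (hkn : k ≤ Fintype.card V) :
    ∃ (P : Finset V) (r q : V), r ∈ P ∧ q ∉ P ∧ T.Adj r q ∧ k ≤ #P ∧ #P ≤ 1 + Δ * k ∧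
      ∀ a ∈ P, ∀ b ∉ P, T.Adj a b → a = r ∧ b = q := by
  obtain ⟨ρ⟩ := hT.connected.nonempty
  obtain ⟨par, dep, h⟩ := hT.exists_isRooting ρ
  have hall : desc par ρ = Finset.univ := by
    refine Finset.eq_univ_of_forall fun v => ?_
    induction hn : dep v generalizing v with
    | zero =>
      by_cases hv : v = ρ
      · exact hv ▸ self_mem_desc _
      · have := h.dep_par v hv; omega
    | succ n ih =>
      by_cases hv : v = ρ
      · exact hv ▸ self_mem_desc _
      · have := h.dep_par v hv
        exact mem_desc_of_par (ih (par v) (by omega))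
  obtain ⟨v, -, h1, h2⟩ := h.exists_peel (P := ∅) (D := Finset.univ) hΔ (by simp)
    ⟨ρ, by simp, by simpa [hall] using hkn⟩
  rw [Finset.univ_inter] at h1 h2
  have hvρ : v ≠ ρ := by
    rintro rfl
    rw [hall, Finset.card_univ] at h2
    omega
  have hpar := h.par_notMem_desc hvρ
  refine ⟨desc par v, v, par v, self_mem_desc v, hpar, (h.adj_iff _ _).2 (Or.inl ⟨hvρ, rfl⟩), h1, h2,
    fun a ha b hb hab => ?_⟩
  rcases (h.adj_iff _ _).1 hab with ⟨h3, h4⟩ | ⟨h3, h4⟩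
  · have : a = v := by
      by_contra hne
      exact hb (h4 ▸ par_mem_desc ha hne)
    exact ⟨this, by rw [← h4, this]⟩
  · exact absurd (mem_desc_of_par (h4 ▸ ha)) hb

/-- Every set of vertices of a graph of bounded degree has a large subset whose closed neighbourhoods
are pairwise disjoint. -/
theorem exists_disjoint_closed_nbr (T : SimpleGraph V) {Δ : ℕ} (hΔ : ∀ v, #(nbr T v) ≤ Δ)
    (Q : Finset V) : ∃ B ⊆ Q, #Q ≤ #B * (Δ + 1) ^ 2 ∧
      ∀ b ∈ B, ∀ c ∈ B, ∀ x ∈ insert b (nbr T b), x ∈ insert c (nbr T c) → b = c := by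
  obtain ⟨B, hB, hmax⟩ := Finset.exists_max_image (Q.powerset.filter fun B =>
    ∀ b ∈ B, ∀ c ∈ B, ∀ x ∈ insert b (nbr T b), x ∈ insert c (nbr T c) → b = c) Finset.card
    ⟨∅, by simp⟩
  simp only [Finset.mem_filter, Finset.mem_powerset] at hB hmax
  refine ⟨B, hB.1, ?_, hB.2⟩
  have hsub : Q ⊆ B.biUnion fun b => (insert b (nbr T b)).biUnion fun x => insert x (nbr T x) := by
    intro p hp
    by_contra hnot
    simp only [Finset.mem_biUnion, not_exists, not_and] at hnot
    have hpB : p ∉ B := fun h => hnot p h p (Finset.mem_insert_self _ _) (Finset.mem_insert_self _ _)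
    have hswap : ∀ x z, x ∈ insert z (nbr T z) → z ∈ insert x (nbr T x) := by
      intro x z hx
      rcases Finset.mem_insert.1 hx with rfl | hx
      · exact Finset.mem_insert_self _ _
      · exact Finset.mem_insert_of_mem (mem_nbr.2 (mem_nbr.1 hx).symm)
    have := hmax (insert p B) ⟨Finset.insert_subset hp hB.1, fun b hb c hc x hxb hxc => by
      rcases Finset.mem_insert.1 hb with rfl | hb <;> rcases Finset.mem_insert.1 hc with rfl | hc
      · rfl
      · exact absurd (hswap _ _ hxb) (hnot c ‹_› x hxc)
      · exact absurd (hswap _ _ hxc) (hnot b ‹_› x hxb)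
      · exact hB.2 b hb c hc x hxb hxc⟩
    rw [Finset.card_insert_of_notMem hpB] at this
    omega
  have hcl : ∀ v, #(insert v (nbr T v)) ≤ Δ + 1 := fun v =>
    (Finset.card_insert_le _ _).trans (Nat.add_le_add_right (hΔ v) 1)
  refine (Finset.card_le_card hsub).trans (Finset.card_biUnion_le.trans ?_)
  refine (Finset.sum_le_card_nsmul _ _ ((Δ + 1) ^ 2) fun b _ => ?_)
  refine Finset.card_biUnion_le.trans ((Finset.sum_le_card_nsmul _ _ (Δ + 1) fun x _ => hcl x).trans ?_)
  rw [smul_eq_mul, sq]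
  exact Nat.mul_le_mul_right _ (hcl b)

theorem IsRooting.exists_pieceChain (h : IsRooting T ρ par dep) {Δ K : ℕ} (hK : 0 < K) (hΔ1 : 1 ≤ Δ)
    (hΔ : ∀ v, #(nbr T v) ≤ Δ) {P : Finset V} {q : V} (hρ : ρ ∈ P) (hP : ∀ v ∈ P, par v ∈ P)
    (hqP : par q ∈ P) (hq : ∀ v, v ∉ P → v ≠ q → par v ∉ P) :
    ∃ J, PieceChain par P (1 + Δ * K) J Finset.univ ∧ J * K ≤ Fintype.card V + K := by
  have hdesc : ∀ v, v ∉ P → v ∈ desc par q := by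
    intro v hv
    induction hn : dep v generalizing v with
    | zero =>
      by_cases hvρ : v = ρ
      · exact absurd (hvρ ▸ hρ) hv
      · have := h.dep_par v hvρ; omega
    | succ n ih =>
      have hvρ : v ≠ ρ := fun hvρ => hv (hvρ ▸ hρ)
      have := h.dep_par v hvρ
      by_cases hvq : v = q
      · exact hvq ▸ self_mem_desc _
      · exact mem_desc_of_par (ih (par v) (hq v hv hvq) (by omega))
  have main : ∀ n, ∀ D : Finset V, #(D \ P) = n → P ⊆ D → (∀ v ∈ D, par v ∈ D) →
      ∃ J, PieceChain par P (1 + Δ * K) J D ∧ J * K ≤ #(D \ P) + K := by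
    intro n
    induction n using Nat.strong_induction_on with
    | _ n ih =>
    intro D hn hPD hD
    by_cases hemp : D = P
    · exact ⟨0, hemp ▸ .base, by simp⟩
    have hne : (D \ P).Nonempty := by
      rw [Finset.sdiff_nonempty]
      exact fun hs => hemp (hs.antisymm hPD)
    obtain ⟨w, hw⟩ := hne
    obtain ⟨hwD, hwP⟩ := Finset.mem_sdiff.1 hw
    have hqD : q ∈ D := mem_of_mem_desc hD (hdesc w hwP) hwD
    have hqnP : q ∉ P := fun hqP' => by
      have hi := mem_desc.1 (hdesc w hwP)
      obtain ⟨i, hi⟩ := hi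
      have key : ∀ i v, v ∉ P → par^[i] v = q → False := by
        intro i
        induction i with
        | zero => intro v hv hvq; exact hv ((show v = q from hvq) ▸ hqP')
        | succ i ih =>
          intro v hv hvq
          by_cases h1 : v = q
          · exact hv (h1 ▸ hqP')
          · exact ih (par v) (hq v hv h1) hvq
      exact key i w hwP hi
    by_cases hsmall : #(D \ P) < K
    · refine ⟨1, ?_, by omega⟩
      have hst := PieceChain.step (par := par) (P := P) (M := 1 + Δ * K) (D \ P) q .base
        Finset.disjoint_sdiff (Finset.mem_sdiff.2 ⟨hqD, hqnP⟩) hqP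
        (fun x hx hxq => by
          rw [Finset.mem_sdiff] at hx ⊢
          exact ⟨hD x hx.1, hq x hx.2 hxq⟩) (by nlinarith)
      rwa [Finset.union_sdiff_of_subset hPD] at hst
    · have hsub : D \ P ⊆ D ∩ desc par q := fun v hv => by
        rw [Finset.mem_sdiff] at hv
        exact Finset.mem_inter.2 ⟨hv.1, hdesc v hv.2⟩
      obtain ⟨v, hvP, hv1, hv2⟩ := h.exists_peel hΔ hP
        ⟨q, hqnP, (not_lt.1 hsmall).trans (Finset.card_le_card hsub)⟩
      set S := D ∩ desc par v with hS
      have hSP : Disjoint S P := by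
        rw [Finset.disjoint_left]
        intro x hx hxP
        exact hvP (mem_of_mem_desc hP (Finset.mem_inter.1 hx).2 hxP)
      have hSD : S ⊆ D \ P := fun x hx => Finset.mem_sdiff.2
        ⟨(Finset.mem_inter.1 hx).1, Finset.disjoint_left.1 hSP hx⟩
      have hvD : v ∈ D := by
        obtain ⟨x, hx⟩ := Finset.card_pos.1 (hK.trans_le hv1)
        exact mem_of_mem_desc hD (Finset.mem_inter.1 hx).2 (Finset.mem_inter.1 hx).1
      have hcardeq : #((D \ S) \ P) + #S = #(D \ P) := by
        rw [sdiff_right_comm, Finset.card_sdiff_add_card_eq_card hSD]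
      obtain ⟨J, hJ, hJK⟩ := ih #((D \ S) \ P) (by omega) (D \ S) rfl
        (fun x hx => Finset.mem_sdiff.2 ⟨hPD hx, Finset.disjoint_right.1 hSP hx⟩)
        (fun x hx => by
          rw [Finset.mem_sdiff] at hx ⊢
          refine ⟨hD x hx.1, fun hx' => hx.2 (Finset.mem_inter.2 ⟨hx.1, ?_⟩)⟩
          exact mem_desc_of_par (Finset.mem_inter.1 hx').2)
      refine ⟨J + 1, ?_, by rw [add_mul]; omega⟩
      have hvρ : v ≠ ρ := fun h1 => hvP (h1 ▸ hρ)
      have hparv := h.par_notMem_desc hvρ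
      have hst := PieceChain.step S v hJ Finset.sdiff_disjoint
        (Finset.mem_inter.2 ⟨hvD, self_mem_desc v⟩)
        (Finset.mem_sdiff.2 ⟨hD v hvD, fun hx => hparv (Finset.mem_inter.1 hx).2⟩)
        (fun x hx hxv => Finset.mem_inter.2
          ⟨hD x (Finset.mem_inter.1 hx).1, par_mem_desc (Finset.mem_inter.1 hx).2 hxv⟩) hv2
      rwa [Finset.sdiff_union_of_subset Finset.inter_subset_left] at hst
  obtain ⟨J, hJ, hJK⟩ := main _ Finset.univ rfl (Finset.subset_univ _) (by simp)
  refine ⟨J, hJ, hJK.trans (Nat.add_le_add_right ?_ _)⟩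
  rw [← Finset.card_univ]
  exact Finset.card_le_card Finset.sdiff_subset

end Rooted

/-- A polynomial times an exponentially small quantity is at most `2 ^ (-c * n)`. -/
theorem exists_sq_mul_pow_lt (A θ β : ℝ) (hA : 0 ≤ A) (hθ0 : 0 < θ) (hθ1 : θ < 1) (hβ : 0 < β) :
    ∃ c : ℝ, 0 < c ∧ ∃ N : ℕ, ∀ n : ℕ, N ≤ n → ∀ b t : ℕ, β * n ≤ b → (t : ℝ) ≤ c * n →
      A * (n : ℝ) ^ 2 * θ ^ b < (1 / 2) ^ t := by
  set l : ℝ := -(β * Real.log θ) with hl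
  have hlog : Real.log θ < 0 := Real.log_neg hθ0 hθ1
  have hl0 : 0 < l := by rw [hl]; nlinarith
  have hlog2 : 0 < Real.log 2 := Real.log_pos (by norm_num)
  refine ⟨l / (2 * Real.log 2), by positivity, ?_⟩
  have htend : Filter.Tendsto (fun x : ℝ => A * (x ^ 2 * Real.exp (-(l / 2) * x)))
      Filter.atTop (nhds (A * 0)) := by
    refine Filter.Tendsto.const_mul _ ?_
    have h := Real.tendsto_pow_mul_exp_neg_atTop_nhds_zero 2
    have h2 : Filter.Tendsto (fun x : ℝ => (l / 2) * x) Filter.atTop Filter.atTop :=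
      Filter.tendsto_id.const_mul_atTop (by positivity)
    have h3 := (h.comp h2).const_mul ((l / 2) ^ 2)⁻¹
    rw [mul_zero] at h3
    refine h3.congr fun x => ?_
    simp only [Function.comp]
    have : (l / 2) ≠ 0 := by positivity
    rw [show -(l / 2) * x = -(l / 2 * x) by ring]
    field_simp
  rw [mul_zero] at htend
  obtain ⟨N, hN⟩ := Filter.eventually_atTop.1
    ((htend.comp tendsto_natCast_atTop_atTop).eventually (gt_mem_nhds (zero_lt_one)))
  refine ⟨N, fun n hn b t hb ht => ?_⟩
  have h1 := hN n hn
  simp only [Function.comp] at h1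
  have hb' : θ ^ b ≤ Real.exp (-l * n) := by
    rw [← Real.exp_log hθ0, ← Real.exp_nat_mul]
    rw [Real.exp_le_exp, hl]
    nlinarith
  have ht' : Real.exp (-(l / 2) * n) ≤ (1 / 2 : ℝ) ^ t := by
    rw [← Real.exp_log (show (0 : ℝ) < 1 / 2 by norm_num), ← Real.exp_nat_mul,
      Real.exp_le_exp, one_div, Real.log_inv]
    have : (t : ℝ) * Real.log 2 ≤ l / (2 * Real.log 2) * n * Real.log 2 := by gcongr
    have h5 : l / (2 * Real.log 2) * n * Real.log 2 = l / 2 * n := by field_simp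
    linarith
  calc A * (n : ℝ) ^ 2 * θ ^ b ≤ A * (n : ℝ) ^ 2 * Real.exp (-l * n) := by gcongr
    _ = (A * ((n : ℝ) ^ 2 * Real.exp (-(l / 2) * n))) * Real.exp (-(l / 2) * n) := by
        rw [show -l * (n : ℝ) = -(l / 2) * n + -(l / 2) * n by ring, Real.exp_add]; ring
    _ < 1 * Real.exp (-(l / 2) * n) := by
        exact mul_lt_mul_of_pos_right h1 (Real.exp_pos _)
    _ ≤ _ := by rw [one_mul]; exact ht'

theorem sum_half_pow_card_color {W : Type*} [Fintype W] (q : ℕ) (M : Finset W) (c : Fin q) :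
    ∑ g : W → Fin q, (1 / 2 : ℝ) ^ #(M.filter fun x => g x = c) =
      ((q : ℝ) - 1 / 2) ^ #M * (q : ℝ) ^ (Fintype.card W - #M) := by
  have h1 : ∀ g : W → Fin q, (1 / 2 : ℝ) ^ #(M.filter fun x => g x = c) =
      ∏ x, (if x ∈ M ∧ g x = c then (1 / 2 : ℝ) else 1) := by
    intro g
    rw [Finset.prod_ite, Finset.prod_const, Finset.prod_const_one, mul_one]
    congr 2
    ext x; simp
  simp_rw [h1]
  rw [← Fintype.prod_sum fun x c' => if x ∈ M ∧ c' = c then (1 / 2 : ℝ) else 1]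
  have h2 : ∀ x, ∑ c' : Fin q, (if x ∈ M ∧ c' = c then (1 / 2 : ℝ) else 1) =
      if x ∈ M then (q : ℝ) - 1 / 2 else q := by
    intro x
    by_cases hx : x ∈ M
    · simp only [hx, true_and, if_true]
      rw [← Finset.add_sum_erase _ _ (Finset.mem_univ c), if_pos rfl,
        Finset.sum_congr rfl fun c' hc' => if_neg (Finset.ne_of_mem_erase hc')]
      simp only [Finset.sum_const, Finset.card_erase_of_mem (Finset.mem_univ c), Finset.card_univ,
        Fintype.card_fin, nsmul_eq_mul, mul_one]
      rw [Nat.cast_sub (by have := c.2; omega)]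
      push_cast; ring
    · simp [hx]
  simp_rw [h2]
  rw [Finset.prod_ite, Finset.prod_const, Finset.prod_const]
  congr 3
  · simp
  · rw [← Finset.card_compl]; congr 1; ext x; simp

/-- A polynomially bounded family of large sets can be hit proportionally by a small set. -/
theorem exists_reserve (ζ γ : ℝ) (hζ : 0 < ζ) (hγ : 0 < γ) :
    ∃ c : ℝ, 0 < c ∧ ∃ N : ℕ, ∀ (W : Type) [Fintype W], N ≤ Fintype.card W →
      ∀ M : W → W → Finset W, (∀ u v, γ * Fintype.card W ≤ #(M u v)) →
        ∃ Z : Finset W, (#Z : ℝ) ≤ ζ * Fintype.card W ∧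
          ∀ u v, c * Fintype.card W ≤ #(Z ∩ M u v) := by
  obtain ⟨q, hq⟩ := exists_nat_gt (1 / ζ)
  have hq0 : 0 < (q : ℝ) := lt_trans (by positivity) hq
  have hq0' : 0 < q := by exact_mod_cast hq0
  have hq1 : (1 : ℝ) ≤ q := by exact_mod_cast hq0'
  obtain ⟨c, hc, N, hN⟩ := exists_sq_mul_pow_lt (q : ℝ) (1 - 1 / (2 * q)) γ hq0.le
    (by rw [sub_pos, div_lt_one (by positivity)]; linarith)
    (by rw [sub_lt_self_iff]; positivity) hγ
  refine ⟨c, hc, N, fun W _ hW M hM => ?_⟩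
  set n := Fintype.card W with hn
  set t := ⌊c * n⌋₊ with ht
  have htc : (t : ℝ) ≤ c * n := Nat.floor_le (by positivity)
  have hsum : ∑ g : W → Fin q, ∑ p : (W × W) × Fin q,
      (1 / 2 : ℝ) ^ #((M p.1.1 p.1.2).filter fun x => g x = p.2) <
      ∑ g : W → Fin q, (1 / 2 : ℝ) ^ t := by
    rw [Finset.sum_comm]
    simp_rw [sum_half_pow_card_color]
    rw [Finset.sum_const, Finset.card_univ, Fintype.card_fun, Fintype.card_fin, nsmul_eq_mul,
      Nat.cast_pow, ← hn]
    by_cases hn0 : n = 0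
    · have : IsEmpty W := Fintype.card_eq_zero_iff.1 (hn ▸ hn0)
      simp [hn0]
    have hstrict : ∀ p : (W × W) × Fin q, ((q : ℝ) - 1 / 2) ^ #(M p.1.1 p.1.2) *
        (q : ℝ) ^ (n - #(M p.1.1 p.1.2)) <
        (q : ℝ) ^ n * ((1 / 2) ^ t / (q * (n : ℝ) ^ 2)) := by
      intro p
      have hle : #(M p.1.1 p.1.2) ≤ n := Finset.card_le_univ _
      have h1 := hN n hW #(M p.1.1 p.1.2) t (hM _ _) htc
      have h2 : ((q : ℝ) - 1 / 2) = q * (1 - 1 / (2 * q)) := by field_simp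
      rw [h2, mul_pow, mul_right_comm, ← pow_add, Nat.add_sub_cancel' hle]
      gcongr
      rw [lt_div_iff₀ (by positivity)]
      nlinarith
    have hne : (Finset.univ : Finset ((W × W) × Fin q)).Nonempty := by
      have : Nonempty W := Fintype.card_pos_iff.1 (by omega)
      have : Nonempty (Fin q) := ⟨⟨0, hq0'⟩⟩
      exact Finset.univ_nonempty
    refine (Finset.sum_lt_sum_of_nonempty hne fun p _ => hstrict p).trans_eq ?_
    rw [Finset.sum_const, Finset.card_univ, Fintype.card_prod, Fintype.card_prod, Fintype.card_fin,
      ← hn, nsmul_eq_mul]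
    push_cast
    field_simp
  obtain ⟨g, -, hg⟩ := Finset.exists_lt_of_sum_lt hsum
  have hcol : ∃ c₀ : Fin q, #(Finset.univ.filter fun x => g x = c₀) * q ≤ n := by
    by_contra! hcon
    have h1 := Finset.card_eq_sum_card_fiberwise (f := g) (s := Finset.univ) (t := Finset.univ)
      (fun _ _ => Finset.mem_coe.2 (Finset.mem_univ _))
    have h2 : ∑ c₀ : Fin q, n < ∑ c₀ : Fin q, #(Finset.univ.filter fun x => g x = c₀) * q :=
      Finset.sum_lt_sum_of_nonempty ⟨⟨0, hq0'⟩, Finset.mem_univ _⟩ fun c₀ _ => hcon c₀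
    rw [← Finset.sum_mul, ← h1, Finset.sum_const, Finset.card_univ, Finset.card_univ,
      Fintype.card_fin, smul_eq_mul, ← hn, mul_comm] at h2
    exact lt_irrefl _ h2
  obtain ⟨c₀, hc₀⟩ := hcol
  refine ⟨Finset.univ.filter fun x => g x = c₀, ?_, fun u v => ?_⟩
  · have h1 : (#(Finset.univ.filter fun x => g x = c₀) : ℝ) * q ≤ n := by exact_mod_cast hc₀
    have h2 : 1 < ζ * q := by rwa [div_lt_iff₀' hζ] at hq
    have h3 : (0 : ℝ) ≤ #(Finset.univ.filter fun x => g x = c₀) := by positivity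
    nlinarith
  · have h1 : (1 / 2 : ℝ) ^ #((M u v).filter fun x => g x = c₀) < (1 / 2) ^ t :=
      lt_of_le_of_lt (Finset.single_le_sum (f := fun p : (W × W) × Fin q =>
        (1 / 2 : ℝ) ^ #((M p.1.1 p.1.2).filter fun x => g x = p.2))
        (fun _ _ => by positivity) (Finset.mem_univ ((u, v), c₀))) hg
    rw [pow_lt_pow_iff_right_of_lt_one₀ (by norm_num) (by norm_num)] at h1
    have h2 : (Finset.univ.filter fun x => g x = c₀) ∩ M u v = (M u v).filter fun x => g x = c₀ := by
      ext x; simp [and_comm]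
    rw [h2]
    have h3 := Nat.lt_floor_add_one (c * n)
    have h4 : (t : ℝ) + 1 ≤ #((M u v).filter fun x => g x = c₀) := by exact_mod_cast h1
    linarith

theorem pmf_half_le_of_expectation {Ω : Type*} (μ : PMF Ω) (Φ : Ω → ℝ≥0∞) (c : ℝ≥0∞) (hc0 : c ≠ 0)
    (hc : c ≠ ⊤) (h : 2 * ∑' ω, μ ω * Φ ω ≤ c) : 1 ≤ 2 * μ.toOuterMeasure {ω | Φ ω < c} := by
  have h1 : 2 * μ.toOuterMeasure {ω | c ≤ Φ ω} ≤ 1 := by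
    have h2 : μ.toOuterMeasure {ω | c ≤ Φ ω} * c ≤ ∑' ω, μ ω * Φ ω := by
      rw [← pmf_tsum_mul_indicator]
      refine ENNReal.tsum_le_tsum fun ω => ?_
      by_cases hω : c ≤ Φ ω
      · rw [Set.indicator_of_mem (by exact hω)]
        gcongr
      · rw [Set.indicator_of_notMem (by exact hω)]
        simp
    have h3 : 2 * μ.toOuterMeasure {ω | c ≤ Φ ω} * c ≤ 1 * c := by
      rw [mul_assoc, one_mul]
      exact le_trans (by gcongr) h
    exact (ENNReal.mul_le_mul_iff_left hc0 hc).1 h3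
  have h4 : 1 ≤ μ.toOuterMeasure {ω | Φ ω < c} + μ.toOuterMeasure {ω | c ≤ Φ ω} := by
    have h5 : μ.toOuterMeasure Set.univ = 1 := (μ.toOuterMeasure_apply_eq_one_iff _).2 (Set.subset_univ _)
    rw [← h5]
    refine le_trans (MeasureTheory.measure_mono ?_) (MeasureTheory.measure_union_le _ _)
    intro ω _
    exact lt_or_ge (Φ ω) c
  have h6 : (1 : ℝ≥0∞) + 1 ≤ 2 * μ.toOuterMeasure {ω | Φ ω < c} + 1 := by
    calc (1 : ℝ≥0∞) + 1 = 2 * 1 := by norm_num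
      _ ≤ 2 * (μ.toOuterMeasure {ω | Φ ω < c} + μ.toOuterMeasure {ω | c ≤ Φ ω}) := by gcongr
      _ = 2 * μ.toOuterMeasure {ω | Φ ω < c} + 2 * μ.toOuterMeasure {ω | c ≤ Φ ω} := by rw [mul_add]
      _ ≤ _ := by gcongr
  exact (ENNReal.add_le_add_iff_right (by norm_num)).1 h6

section Potential

variable {V W : Type*}

/-- Lower bound for the conditional probability that all vertices of `C` hit their targets, given
the values of `f` on `D`. -/
def hitWeight (γ : ℝ) (C : Finset V) (tgt : V → W → Prop) (D : Finset V) (f : V → W) : ℝ :=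
  if ∀ x ∈ C, x ∈ D → tgt x (f x) then γ ^ #(C \ D) else 0

theorem hitWeight_nonneg {γ : ℝ} (hγ : 0 ≤ γ) (C : Finset V) (tgt : V → W → Prop) (D : Finset V)
    (f : V → W) : 0 ≤ hitWeight γ C tgt D f := by
  unfold hitWeight; split_ifs <;> positivity

theorem hitWeight_le_one {γ : ℝ} (hγ : 0 ≤ γ) (hγ1 : γ ≤ 1) (C : Finset V) (tgt : V → W → Prop)
    (D : Finset V) (f : V → W) : hitWeight γ C tgt D f ≤ 1 := by
  unfold hitWeight; split_ifs
  · exact pow_le_one₀ hγ hγ1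
  · exact zero_le_one

theorem hitWeight_insert_of_notMem (γ : ℝ) {C : Finset V} (tgt : V → W → Prop) (D : Finset V)
    (f : V → W) {x : V} (hx : x ∉ C) (c : W) :
    hitWeight γ C tgt (insert x D) (Function.update f x c) = hitWeight γ C tgt D f := by
  unfold hitWeight
  have h1 : C \ insert x D = C \ D := by
    ext y
    simp only [Finset.mem_sdiff, Finset.mem_insert, not_or]
    constructor
    · exact fun h => ⟨h.1, h.2.2⟩
    · exact fun h => ⟨h.1, fun hyx => hx (hyx ▸ h.1), h.2⟩
  have h2 : (∀ y ∈ C, y ∈ insert x D → tgt y (Function.update f x c y)) ↔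
      ∀ y ∈ C, y ∈ D → tgt y (f y) := by
    refine forall₂_congr fun y hy => ?_
    have hyx : y ≠ x := fun h => hx (h ▸ hy)
    simp [hyx]
  rw [h1]
  simp only [h2]

theorem hitWeight_step {γ : ℝ} (hγ : 0 ≤ γ) {C : Finset V} (tgt : V → W → Prop) {D : Finset V}
    (f : V → W) {x : V} (hx : x ∈ C) (hxD : x ∉ D) (A : Finset W)
    (hA : γ * #A ≤ #(A.filter (tgt x))) :
    #A * hitWeight γ C tgt D f ≤
      ∑ c ∈ A, hitWeight γ C tgt (insert x D) (Function.update f x c) := by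
  by_cases hcond : ∀ y ∈ C, y ∈ D → tgt y (f y)
  · have h1 : #(C \ D) = #(C \ insert x D) + 1 := by
      rw [← Finset.card_insert_of_notMem (a := x) (s := C \ insert x D) (by simp)]
      congr 1
      ext y
      by_cases hyx : y = x
      · subst hyx; simp [hx, hxD]
      · simp [hyx]
    have h2 : ∀ c ∈ A.filter (tgt x), hitWeight γ C tgt (insert x D) (Function.update f x c) =
        γ ^ #(C \ insert x D) := by
      intro c hc
      unfold hitWeight
      rw [if_pos]
      intro y hy hyD
      by_cases hyx : y = x
      · subst hyx; simpa using (Finset.mem_filter.1 hc).2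
      · rw [Function.update_of_ne hyx]
        exact hcond y hy ((Finset.mem_insert.1 hyD).resolve_left hyx)
    calc #A * hitWeight γ C tgt D f = (γ * #A) * γ ^ #(C \ insert x D) := by
          unfold hitWeight
          rw [if_pos hcond, h1, pow_succ]; ring
      _ ≤ #(A.filter (tgt x)) * γ ^ #(C \ insert x D) := by gcongr
      _ = ∑ c ∈ A.filter (tgt x), hitWeight γ C tgt (insert x D) (Function.update f x c) := by
          rw [Finset.sum_congr rfl h2, Finset.sum_const, nsmul_eq_mul]
      _ ≤ _ := Finset.sum_le_sum_of_subset_of_nonneg (Finset.filter_subset _ _)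
          fun _ _ _ => hitWeight_nonneg hγ _ _ _ _
  · unfold hitWeight
    rw [if_neg hcond, mul_zero]
    exact Finset.sum_nonneg fun _ _ => hitWeight_nonneg hγ _ _ _ _

theorem sum_prod_one_sub_half_le {β : Type*} (B : Finset β) (A : Finset W) (p : β → ℝ)
    (p' : W → β → ℝ) (Q : β → Prop) (hp : ∀ b, 0 ≤ p b ∧ p b ≤ 1)
    (hout : ∀ b ∈ B, ¬ Q b → ∀ c, p' c b = p b)
    (hin : ∀ b ∈ B, Q b → #A * p b ≤ ∑ c ∈ A, p' c b)
    (huniq : ∀ b ∈ B, ∀ b' ∈ B, Q b → Q b' → b = b') :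
    ∑ c ∈ A, ∏ b ∈ B, (1 - p' c b / 2) ≤ #A * ∏ b ∈ B, (1 - p b / 2) := by
  by_cases hQ : ∃ b ∈ B, Q b
  · obtain ⟨b, hb, hQb⟩ := hQ
    have h1 : ∀ c, ∏ b' ∈ B.erase b, (1 - p' c b' / 2) = ∏ b' ∈ B.erase b, (1 - p b' / 2) := by
      intro c
      refine Finset.prod_congr rfl fun b' hb' => ?_
      rw [hout b' (Finset.mem_of_mem_erase hb')]
      exact fun hq => Finset.ne_of_mem_erase hb' (huniq _ (Finset.mem_of_mem_erase hb') _ hb hq hQb)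
    simp_rw [← Finset.mul_prod_erase B _ hb, h1]
    rw [← Finset.sum_mul, ← mul_assoc]
    refine mul_le_mul_of_nonneg_right ?_ (Finset.prod_nonneg fun b' _ => by linarith [(hp b').2])
    rw [Finset.sum_sub_distrib, ← Finset.sum_div, Finset.sum_const, nsmul_eq_mul, mul_one]
    linarith [hin b hb hQb]
  · push Not at hQ
    have h1 : ∀ c, ∏ b ∈ B, (1 - p' c b / 2) = ∏ b ∈ B, (1 - p b / 2) := fun c =>
      Finset.prod_congr rfl fun b hb => by rw [hout b hb (hQ b hb)]
    simp_rw [h1]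
    rw [Finset.sum_const, nsmul_eq_mul]

end Potential

set_option maxHeartbeats 1000000 in
/-- A spread random embedding of a small subtree `P` in which every pair of vertices `u, v` of the
host graph sees many `b ∈ B` whose image is adjacent to `u` and whose neighbours have images adjacent
to `v`. -/
theorem exists_spread_robust_embedding {V W : Type*} [Fintype V] [Fintype W]
    {T : SimpleGraph V} {r : V} {par : V → V} {dep : V → ℕ} (h : IsRooting T r par dep)
    {Δ : ℕ} (hΔ : ∀ v, #(nbr T v) ≤ Δ) (G : SimpleGraph W) {P B : Finset V}
    (hP : ∀ v ∈ P, par v ∈ P) (hB : ∀ b ∈ B, insert b (nbr T b) ⊆ P)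
    (hdisj : ∀ b ∈ B, ∀ c ∈ B, ∀ x ∈ insert b (nbr T b), x ∈ insert c (nbr T c) → b = c)
    (Z : Finset W) {γ : ℝ} (hγ0 : 0 < γ) (hγ1 : γ ≤ 1) {m t : ℕ} (hm0 : 0 < m)
    (hm : (m : ℝ) ≤ γ * Fintype.card W)
    (hcod : ∀ u v, γ * Fintype.card W + #P ≤ #((nbr G u ∩ nbr G v) \ Z))
    (ht : 2 * (Fintype.card W : ℝ) ^ 2 * (1 - γ ^ (Δ + 1) / 2) ^ #B < (1 / 2) ^ t) :
    ∃ μ : PMF (V → W), (∀ f ∈ μ.support, Set.InjOn f P ∧ (∀ x ∈ P, f x ∉ Z) ∧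
        (∀ x ∈ P, x ≠ r → G.Adj (f (par x)) (f x)) ∧
        ∀ u v, t ≤ #(B.filter fun b => G.Adj u (f b) ∧ ∀ s ∈ nbr T b, G.Adj v (f s))) ∧
      SpreadOn (2 * (m : ℝ≥0∞)⁻¹) P μ := by
  have hWne : Nonempty W := by
    rw [← Fintype.card_pos_iff]
    by_contra hcon
    have h0 : Fintype.card W = 0 := by omega
    rw [h0] at hm
    have : (0 : ℝ) < m := by exact_mod_cast hm0
    simp at hm
    omega
  obtain ⟨w₀⟩ := hWne
  set tgt : W → W → V → V → W → Prop := fun u v b x c => if x = b then G.Adj u c else G.Adj v c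
    with htgt
  set wt : W → W → Finset V → (V → W) → V → ℝ := fun u v D f b =>
    hitWeight γ (insert b (nbr T b)) (tgt u v b) D f with hwt
  set Ψ : Finset V → (V → W) → ℝ := fun D f => ∑ u : W, ∑ v : W, ∏ b ∈ B, (1 - wt u v D f b / 2)
    with hΨ
  have hprod0 : ∀ u v D f, 0 ≤ ∏ b ∈ B, (1 - wt u v D f b / 2) := fun u v D f =>
    Finset.prod_nonneg fun b _ => by
      linarith [hitWeight_le_one hγ0.le hγ1 (insert b (nbr T b)) (tgt u v b) D f]
  have hΨ0 : ∀ D f, 0 ≤ Ψ D f := fun D f =>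
    Finset.sum_nonneg fun u _ => Finset.sum_nonneg fun v _ => hprod0 u v D f
  have hstep : ∀ D ⊆ P, D ≠ P → ∀ f : V → W, (Set.InjOn f D ∧ (∀ x ∈ D, f x ∉ Z) ∧
      ∀ x ∈ D, x ≠ r → par x ∈ D ∧ G.Adj (f (par x)) (f x)) →
      ∃ x ∈ P, x ∉ D ∧ ∃ A : Finset W, m ≤ #A ∧
        (∀ c ∈ A, Set.InjOn (Function.update f x c) (insert x D : Finset V) ∧
          (∀ y ∈ insert x D, Function.update f x c y ∉ Z) ∧
          ∀ y ∈ insert x D, y ≠ r → par y ∈ insert x D ∧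
            G.Adj (Function.update f x c (par y)) (Function.update f x c y)) ∧
        ∑ c ∈ A, ENNReal.ofReal (Ψ (insert x D) (Function.update f x c)) ≤
          #A * ENNReal.ofReal (Ψ D f) := by
    rintro D hDP hne f ⟨hinj, hZ, hadj⟩
    obtain ⟨x, hx, hmin⟩ := Finset.exists_min_image (P \ D) dep
      (by rw [Finset.sdiff_nonempty]; exact fun hs => hne (hDP.antisymm hs))
    obtain ⟨hxP, hxD⟩ := Finset.mem_sdiff.1 hx
    have hpar : x ≠ r → par x ∈ D := by
      intro hxr
      by_contra hcon
      have h1 := hmin (par x) (Finset.mem_sdiff.2 ⟨hP x hxP, hcon⟩)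
      have h2 := h.dep_par x hxr
      omega
    set N : Finset W := if x = r then Finset.univ else nbr G (f (par x)) with hN
    have hNcod : ∀ w, ∃ u, nbr G u ∩ nbr G w ⊆ N ∩ nbr G w := by
      intro w
      by_cases hxr : x = r
      · exact ⟨w, by rw [hN, if_pos hxr]; intro y; simp⟩
      · exact ⟨f (par x), by rw [hN, if_neg hxr]⟩
    set A : Finset W := (N \ Z) \ D.image f with hA
    have hAw : ∀ w, γ * Fintype.card W ≤ #(A.filter fun c => G.Adj w c) := by
      intro w
      obtain ⟨u, hu⟩ := hNcod w
      have h1 : ((nbr G u ∩ nbr G w) \ Z) \ D.image f ⊆ A.filter fun c => G.Adj w c := by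
        intro y hy
        simp only [Finset.mem_sdiff] at hy
        have hy2 := Finset.mem_inter.1 (hu hy.1.1)
        rw [Finset.mem_filter, hA, Finset.mem_sdiff, Finset.mem_sdiff]
        exact ⟨⟨⟨hy2.1, hy.1.2⟩, hy.2⟩, mem_nbr.1 hy2.2⟩
      have h2 := Finset.card_le_card h1
      have h3 := Finset.le_card_sdiff (D.image f) ((nbr G u ∩ nbr G w) \ Z)
      have h4 : #(D.image f) ≤ #P := Finset.card_image_le.trans (Finset.card_le_card hDP)
      have h5 := hcod u w
      have h6 : #((nbr G u ∩ nbr G w) \ Z) ≤ #(A.filter fun c => G.Adj w c) + #P := by omega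
      have h7 : (#((nbr G u ∩ nbr G w) \ Z) : ℝ) ≤ #(A.filter fun c => G.Adj w c) + #P := by
        exact_mod_cast h6
      linarith
    refine ⟨x, hxP, hxD, A, ?_, fun c hc => ?_, ?_⟩
    · have h1 := hAw w₀
      have h2 : #(A.filter fun c => G.Adj w₀ c) ≤ #A := Finset.card_le_card (Finset.filter_subset _ _)
      have h3 : (#(A.filter fun c => G.Adj w₀ c) : ℝ) ≤ #A := by exact_mod_cast h2
      exact_mod_cast hm.trans (h1.trans h3)
    · simp only [hA, Finset.mem_sdiff, Finset.mem_image, not_exists, not_and] at hc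
      have hold : ∀ y ∈ D, Function.update f x c y = f y := fun y hy =>
        Function.update_of_ne (ne_of_mem_of_not_mem hy hxD) _ _
      refine ⟨?_, ?_, ?_⟩
      · rw [Finset.coe_insert, Set.injOn_insert (by exact_mod_cast hxD)]
        refine ⟨fun y hy z hz hyz => ?_, ?_⟩
        · rw [hold y hy, hold z hz] at hyz
          exact hinj hy hz hyz
        · rintro ⟨y, hy, hyc⟩
          rw [hold y hy, Function.update_self] at hyc
          exact hc.2 y hy hyc
      · intro y hy
        rcases Finset.mem_insert.1 hy with rfl | hy
        · rw [Function.update_self]; exact hc.1.2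
        · rw [hold y hy]; exact hZ y hy
      · intro y hy hyr
        rcases Finset.mem_insert.1 hy with rfl | hy
        · refine ⟨Finset.mem_insert_of_mem (hpar hyr), ?_⟩
          rw [hold _ (hpar hyr), Function.update_self]
          have := hc.1.1
          rw [hN, if_neg hyr] at this
          exact mem_nbr.1 this
        · obtain ⟨h1, h2⟩ := hadj y hy hyr
          exact ⟨Finset.mem_insert_of_mem h1, by rw [hold _ h1, hold y hy]; exact h2⟩
    · have key : ∑ c ∈ A, Ψ (insert x D) (Function.update f x c) ≤ #A * Ψ D f := by
        simp only [hΨ]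
        rw [Finset.sum_comm, Finset.mul_sum]
        refine Finset.sum_le_sum fun u _ => ?_
        rw [Finset.sum_comm, Finset.mul_sum]
        refine Finset.sum_le_sum fun v _ => ?_
        refine sum_prod_one_sub_half_le B A _ _ (fun b => x ∈ insert b (nbr T b)) (fun b => ?_) ?_ ?_ ?_
        · exact ⟨hitWeight_nonneg hγ0.le _ _ _ _, hitWeight_le_one hγ0.le hγ1 _ _ _ _⟩
        · intro b _ hxb c
          exact hitWeight_insert_of_notMem γ _ D f hxb c
        · intro b _ hxb
          refine hitWeight_step hγ0.le _ f hxb hxD A ?_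
          have hAn : (#A : ℝ) ≤ Fintype.card W := by exact_mod_cast Finset.card_le_univ A
          have h1 : γ * #A ≤ γ * Fintype.card W := by gcongr
          refine h1.trans ?_
          by_cases hxb' : x = b
          · have e : tgt u v b x = fun c => G.Adj u c := funext fun c => if_pos hxb'
            rw [e]
            exact hAw u
          · have e : tgt u v b x = fun c => G.Adj v c := funext fun c => if_neg hxb'
            rw [e]
            exact hAw v
        · intro b hb b' hb' h1 h2
          exact hdisj b hb b' hb' x h1 h2
      rw [← ENNReal.ofReal_sum_of_nonneg fun c _ => hΨ0 _ _, ← ENNReal.ofReal_natCast,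
        ← ENNReal.ofReal_mul (Nat.cast_nonneg #A)]
      exact ENNReal.ofReal_le_ofReal key
  obtain ⟨μ, hμ1, hμ2, hμ3⟩ := exists_spread_process m hm0 P
    (fun D f => Set.InjOn f D ∧ (∀ x ∈ D, f x ∉ Z) ∧
      ∀ x ∈ D, x ≠ r → par x ∈ D ∧ G.Adj (f (par x)) (f x))
    (fun D f => ENNReal.ofReal (Ψ D f)) hstep ∅ (Finset.empty_subset _) (fun _ => w₀) (by simp)
  rw [Finset.sdiff_empty] at hμ2
  have hinit : 2 * Ψ ∅ (fun _ => w₀) ≤ (1 / 2) ^ t := by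
    refine le_trans ?_ ht.le
    rw [mul_assoc]
    gcongr
    have h1 : ∀ u v, ∏ b ∈ B, (1 - wt u v ∅ (fun _ => w₀) b / 2) ≤
        (1 - γ ^ (Δ + 1) / 2) ^ #B := by
      intro u v
      rw [← Finset.prod_const]
      refine Finset.prod_le_prod (fun b _ => ?_) fun b _ => ?_
      · linarith [hitWeight_le_one hγ0.le hγ1 (insert b (nbr T b)) (tgt u v b) ∅ (fun _ => w₀)]
      · have h2 : γ ^ (Δ + 1) ≤ wt u v ∅ (fun _ => w₀) b := by
          simp only [hwt, hitWeight]
          rw [if_pos (by simp), Finset.sdiff_empty]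
          refine pow_le_pow_of_le_one hγ0.le hγ1 ?_
          exact (Finset.card_insert_le _ _).trans (Nat.add_le_add_right (hΔ b) 1)
        linarith
    refine (Finset.sum_le_sum fun u _ => Finset.sum_le_sum fun v _ => h1 u v).trans_eq ?_
    simp only [Finset.sum_const, Finset.card_univ, nsmul_eq_mul]
    ring
  have hgood := pmf_half_le_of_expectation μ (fun f => ENNReal.ofReal (Ψ P f))
    (ENNReal.ofReal ((1 / 2) ^ t)) (by simp) ENNReal.ofReal_ne_top (by
      refine (mul_le_mul_right hμ3 2).trans ?_
      rw [show (2 : ℝ≥0∞) = ENNReal.ofReal 2 by simp, ← ENNReal.ofReal_mul (by norm_num)]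
      exact ENNReal.ofReal_le_ofReal hinit)
  obtain ⟨ν, hν1, hν2⟩ := hμ2.filter _ hgood
  refine ⟨ν, fun f hf => ?_, hν2⟩
  obtain ⟨hfΨ, hfμ⟩ := hν1 f hf
  obtain ⟨⟨hinj, hZ, hadj⟩, -⟩ := hμ1 f hfμ
  refine ⟨hinj, hZ, fun x hx hxr => (hadj x hx hxr).2, fun u v => ?_⟩
  have h1 : Ψ P f < (1 / 2) ^ t := by
    have := hfΨ
    simp only [Set.mem_ofPred_eq] at this
    exact (ENNReal.ofReal_lt_ofReal_iff (by positivity)).1 this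
  have h2 : ∏ b ∈ B, (1 - wt u v P f b / 2) ≤ Ψ P f := by
    refine le_trans ?_ (Finset.single_le_sum
      (f := fun u => ∑ v : W, ∏ b ∈ B, (1 - wt u v P f b / 2))
      (fun u _ => Finset.sum_nonneg fun v _ => hprod0 u v P f) (Finset.mem_univ u))
    exact Finset.single_le_sum (f := fun v => ∏ b ∈ B, (1 - wt u v P f b / 2))
      (fun v _ => hprod0 u v P f) (Finset.mem_univ v)
  have h3 : ∏ b ∈ B, (1 - wt u v P f b / 2) =
      (1 / 2) ^ #(B.filter fun b => G.Adj u (f b) ∧ ∀ s ∈ nbr T b, G.Adj v (f s)) := by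
    rw [← Finset.prod_const, Finset.prod_filter]
    refine Finset.prod_congr rfl fun b hb => ?_
    have h4 : (∀ x ∈ insert b (nbr T b), x ∈ P → tgt u v b x (f x)) ↔
        (G.Adj u (f b) ∧ ∀ s ∈ nbr T b, G.Adj v (f s)) := by
      constructor
      · intro h5
        refine ⟨?_, fun s hs => ?_⟩
        · have := h5 b (Finset.mem_insert_self _ _) (hB b hb (Finset.mem_insert_self _ _))
          simpa [htgt] using this
        · have := h5 s (Finset.mem_insert_of_mem hs) (hB b hb (Finset.mem_insert_of_mem hs))
          have hsb : s ≠ b := (mem_nbr.1 hs).ne'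
          simpa [htgt, hsb] using this
      · rintro ⟨h5, h6⟩ x hx -
        rcases Finset.mem_insert.1 hx with rfl | hx
        · simpa [htgt] using h5
        · have hsb : x ≠ b := (mem_nbr.1 hx).ne'
          simpa [htgt, hsb] using h6 x hx
    simp only [hwt, hitWeight, h4, Finset.sdiff_eq_empty_iff_subset.2 (hB b hb), Finset.card_empty,
      pow_zero]
    split_ifs <;> norm_num
  rw [h3] at h2
  exact ((pow_lt_pow_iff_right_of_lt_one₀ (by norm_num) (by norm_num)).1 (h2.trans_lt h1)).le

section Regularity

variable {W : Type*} [Fintype W] {G : SimpleGraph W}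

theorem card_interedges_eq_sum_nbr (G : SimpleGraph W) (s t : Finset W) :
    #(G.interedges s t) = ∑ a ∈ s, #(nbr G a ∩ t) := by
  rw [SimpleGraph.interedges_def, Finset.card_filter, Finset.sum_product]
  refine Finset.sum_congr rfl fun a _ => ?_
  rw [← Finset.card_filter]
  congr 1
  ext b
  simp [and_comm]

theorem card_filter_few_nbr_lt {e d : ℝ} {X Y : Finset W} (hu : G.IsUniform e X Y)
    (hd : 2 * d ≤ (G.edgeDensity X Y : ℝ)) (hed : e ≤ d) {X' B : Finset W} (hX : X' ⊆ X)
    (hB : B ⊆ Y) (hB0 : 0 < #B) (hBe : (#Y : ℝ) * e ≤ #B) (hX0 : X.Nonempty) :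
    (#(X'.filter fun a => (#(nbr G a ∩ B) : ℝ) < d * #B) : ℝ) < #X * e := by
  by_contra! hcon
  set A := X'.filter fun a => (#(nbr G a ∩ B) : ℝ) < d * #B with hA
  have he : 0 < e := hu.pos
  have h1 := hu ((Finset.filter_subset _ _).trans hX) hB hcon hBe
  rw [abs_lt] at h1
  have hA0 : (0 : ℝ) < #A := lt_of_lt_of_le (by have := hX0.card_pos; positivity) hcon
  have h2 : (#(G.interedges A B) : ℝ) ≤ #A * (d * #B) := by
    rw [card_interedges_eq_sum_nbr]
    push_cast
    refine (Finset.sum_le_card_nsmul _ _ (d * #B) fun a ha => (Finset.mem_filter.1 ha).2.le).trans ?_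
    rw [nsmul_eq_mul]
  have hB0' : (0 : ℝ) < #B := by exact_mod_cast hB0
  have h3 : (G.edgeDensity A B : ℝ) ≤ d := by
    rw [SimpleGraph.edgeDensity_def]
    push_cast
    rw [div_le_iff₀ (by positivity)]
    linarith
  linarith [h1.1]

/-- Hall's theorem for a symmetric relation in which every element has more than half of all
elements as neighbours. -/
theorem exists_injective_of_half_degree {κ : Type*} (S : Finset κ) (t : κ → Finset κ) (p : ℕ)
    (hp : #S ≤ p) (ht : ∀ x ∈ S, t x ⊆ S) (hcard : ∀ x ∈ S, p ≤ 2 * #(t x))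
    (hsymm : ∀ x ∈ S, ∀ y ∈ S, y ∈ t x → x ∈ t y) :
    ∃ π : {x // x ∈ S} → κ, Function.Injective π ∧ ∀ x : {x // x ∈ S}, π x ∈ t x := by
  refine (Finset.all_card_le_biUnion_card_iff_exists_injective
    (fun x : {x // x ∈ S} => t x)).1 fun R => ?_
  by_cases hR : R = ∅
  · simp [hR]
  obtain ⟨x, hx⟩ := Finset.nonempty_iff_ne_empty.2 hR
  by_cases hle : 2 * #R ≤ p
  · have h1 := hcard x x.2
    have h2 := Finset.card_le_card (Finset.subset_biUnion_of_mem (fun x : {x // x ∈ S} => t x) hx)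
    omega
  · have hsub : S ⊆ R.biUnion fun x => t x := by
      intro y hy
      have h1 := hcard y hy
      have h2 : #(R.image Subtype.val) = #R := Finset.card_image_of_injective _ Subtype.val_injective
      have h3 : (t y ∩ R.image Subtype.val).Nonempty := by
        rw [← Finset.card_pos]
        have h4 := Finset.card_union_add_card_inter (t y) (R.image Subtype.val)
        have h5 : #(t y ∪ R.image Subtype.val) ≤ #S := by
          refine Finset.card_le_card (Finset.union_subset (ht y hy) fun z hz => ?_)
          obtain ⟨z, _, rfl⟩ := Finset.mem_image.1 hz
          exact z.2
        omega
      obtain ⟨z, hz⟩ := h3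
      obtain ⟨hz1, hz2⟩ := Finset.mem_inter.1 hz
      obtain ⟨z, hzR, rfl⟩ := Finset.mem_image.1 hz2
      exact Finset.mem_biUnion.2 ⟨z, hzR, hsymm y hy z z.2 hz1⟩
    calc #R = #(R.image Subtype.val) := (Finset.card_image_of_injective _ Subtype.val_injective).symm
      _ ≤ #S := Finset.card_le_card fun z hz => by
        obtain ⟨z, _, rfl⟩ := Finset.mem_image.1 hz
        exact z.2
      _ ≤ _ := Finset.card_le_card hsub

/-- `k` disjoint pairs of sets of size `h`, such that in every pair most vertices of one side have
many neighbours in any prescribed large subset of the other side. -/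
structure IsRegularPairing (G : SimpleGraph W) (ε d : ℝ) {k : ℕ} (h : ℕ)
    (A B : Fin k → Finset W) : Prop where
  card_left : ∀ i, #(A i) = h
  card_right : ∀ i, #(B i) = h
  disjoint_left : ∀ i j, i ≠ j → Disjoint (A i) (A j)
  disjoint_right : ∀ i j, i ≠ j → Disjoint (B i) (B j)
  disjoint : ∀ i j, Disjoint (A i) (B j)
  regular_left : ∀ i, ∀ B' ⊆ B i, ε * h ≤ #B' →
    (#((A i).filter fun a => (#(nbr G a ∩ B') : ℝ) < d * #B') : ℝ) ≤ ε * h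
  regular_right : ∀ i, ∀ A' ⊆ A i, ε * h ≤ #A' →
    (#((B i).filter fun b => (#(nbr G b ∩ A') : ℝ) < d * #A') : ℝ) ≤ ε * h

theorem regular_degree_arith {β s p x b u N : ℝ} (hβ : 0 < β) (hβ1 : β ≤ 1) (hsβ : 8 < β * s)
    (hpβ : 8 < β * p) (hs : 0 ≤ s) (hp : 0 < p) (hb : b ≤ β / 16 * p) (hu : u ≤ β / 16 * p)
    (hN : s * p ≤ N) (hx : 2 * x < p) :
    ((x * (s + 1) + b * (s + 1)) + (u * (s + 1) + (s + 1))) + 2 * (β / 8) * N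
      < (1 / 2 + β) * N := by
  have hs1 : 0 < s + 1 := by linarith
  have h1 : (x + b + u + 1) * (s + 1) ≤ (p / 2 + β / 4 * p) * (s + 1) :=
    mul_le_mul_of_nonneg_right (by linarith) hs1.le
  have h2 : (1 / 2 + β - 2 * (β / 8)) * (s * p) ≤ (1 / 2 + β - 2 * (β / 8)) * N :=
    mul_le_mul_of_nonneg_left hN (by linarith)
  have h3 : p * 8 < p * (β * s) := mul_lt_mul_of_pos_left hsβ hp
  have h4 : β * p ≤ 1 * p := mul_le_mul_of_nonneg_right hβ1 hp.le
  nlinarith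

set_option maxHeartbeats 1000000 in
theorem exists_isRegularPairing_univ (β ε : ℝ) (hβ : 0 < β) (hβ1 : β ≤ 1) (hε : 0 < ε)
    (hε1 : ε ≤ 1) :
    ∃ k₀ N₀ : ℕ, ∀ (W : Type) [Fintype W] (G : SimpleGraph W), N₀ ≤ Fintype.card W →
      (∀ v, (1 / 2 + β) * Fintype.card W ≤ (#(nbr G v) : ℝ)) →
      ∃ (k h : ℕ) (A B : Fin k → Finset W), k ≤ k₀ ∧ IsRegularPairing G ε (β / 8) h A B ∧
        (1 - ε) * Fintype.card W ≤ (2 * k * h : ℝ) := by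
  set e : ℝ := min (ε / 4) (β / 16) with he
  have he0 : 0 < e := lt_min (by positivity) (by positivity)
  have heε : e ≤ ε / 4 := min_le_left _ _
  have heβ : e ≤ β / 16 := min_le_right _ _
  have hee : e ^ 2 ≤ e := by nlinarith
  obtain ⟨l, hl⟩ := exists_nat_gt (8 / β)
  have hlpos : 0 < l := by
    have : (0 : ℝ) < l := lt_trans (by positivity) hl
    exact_mod_cast this
  set k₀ := SzemerediRegularity.bound (e ^ 2) l with hk₀
  obtain ⟨s₁, hs₁⟩ := exists_nat_gt (max (8 / ε) (max (8 / β) 4))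
  refine ⟨k₀, max l (k₀ * (s₁ + 1)), fun W _ G hW hdeg => ?_⟩
  obtain ⟨P, hPeq, hPl, hPk, hPu⟩ := szemeredi_regularity G (ε := e ^ 2) (l := l) (by positivity)
    ((le_max_left _ _).trans hW)
  set N := Fintype.card W with hN
  set p := #P.parts with hp
  have hp0 : 0 < p := hlpos.trans_le hPl
  set s := N / p with hs
  have hcardU : #(Finset.univ : Finset W) = N := Finset.card_univ
  have hslo : ∀ X ∈ P.parts, s ≤ #X := fun X hX => by
    have := hPeq.average_le_card_part hX
    rwa [hcardU] at this
  have hshi : ∀ X ∈ P.parts, #X ≤ s + 1 := fun X hX => by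
    have := hPeq.card_part_le_average_add_one hX
    rwa [hcardU] at this
  have hs1 : s₁ ≤ s := by
    rw [hs, Nat.le_div_iff_mul_le hp0]
    calc s₁ * p ≤ (s₁ + 1) * k₀ := Nat.mul_le_mul (Nat.le_succ _) hPk
      _ ≤ N := by rw [mul_comm]; exact (le_max_right _ _).trans hW
  have hsR : max (8 / ε) (max (8 / β) 4) < (s : ℝ) := hs₁.trans_le (by exact_mod_cast hs1)
  have hsε : 8 < ε * s := by
    have := (le_max_left _ _).trans_lt hsR
    rwa [div_lt_iff₀' hε] at this
  have hsβ : 8 < β * s := by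
    have := ((le_max_left _ _).trans (le_max_right _ _)).trans_lt hsR
    rwa [div_lt_iff₀' hβ] at this
  have hs4 : (4 : ℝ) < s := ((le_max_right _ _).trans (le_max_right _ _)).trans_lt hsR
  have hs4' : 4 < s := by exact_mod_cast hs4
  have hspN : (s : ℝ) * p ≤ N := by exact_mod_cast Nat.div_mul_le_self N p
  have hNsp : (N : ℝ) ≤ (s + 1) * p := by
    have := (Nat.lt_div_mul_add hp0 (a := N)).le
    rw [← hs] at this
    have h2 : (N : ℝ) ≤ s * p + p := by exact_mod_cast this
    linarith
  have hpβ : 8 < β * p := by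
    have h1 : (l : ℝ) ≤ p := by exact_mod_cast hPl
    rw [div_lt_iff₀' hβ] at hl
    exact hl.trans_le (mul_le_mul_of_nonneg_left h1 hβ.le)
  have hpR : (0 : ℝ) < p := by exact_mod_cast hp0
  set nu : Finset W → Finset (Finset W) := fun X =>
    P.parts.filter fun Y => X ≠ Y ∧ ¬ G.IsUniform (e ^ 2) X Y with hnu
  set good := P.parts.filter fun X => (#(nu X) : ℝ) ≤ e * p with hgood
  set bad := P.parts.filter fun X => ¬ (#(nu X) : ℝ) ≤ e * p with hbad
  have hgb : #good + #bad = p := Finset.card_filter_add_card_filter_not _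
  have hgP : ∀ X ∈ good, X ∈ P.parts := fun X hX => (Finset.mem_filter.1 hX).1
  have hbadcard : (#bad : ℝ) ≤ e * p := by
    have h1 : (#(P.nonUniforms G (e ^ 2)) : ℝ) ≤ (p * p) * e ^ 2 := by
      refine hPu.trans ?_
      gcongr
      have : p * (p - 1) ≤ p * p := Nat.mul_le_mul_left _ (Nat.sub_le _ _)
      exact_mod_cast this
    have h2 : (#bad : ℝ) * (e * p) ≤ #(P.nonUniforms G (e ^ 2)) := by
      rw [Finset.card_eq_sum_card_fiberwise (f := Prod.fst) (t := P.parts)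
        (fun a ha => by
          obtain ⟨X, Y⟩ := a
          exact ((P.mk_mem_nonUniforms G).1 ha).1)]
      push_cast
      calc (#bad : ℝ) * (e * p) = ∑ X ∈ bad, e * p := by rw [Finset.sum_const, nsmul_eq_mul]
        _ ≤ ∑ X ∈ bad, (#((P.nonUniforms G (e ^ 2)).filter fun a => a.1 = X) : ℝ) := by
            refine Finset.sum_le_sum fun X hX => ?_
            obtain ⟨hXP, hX⟩ := Finset.mem_filter.1 hX
            refine (not_le.1 hX).le.trans ?_
            norm_cast
            refine Finset.card_le_card_of_injOn (fun Y => (X, Y)) (fun Y hY => ?_)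
              (fun Y _ Y' _ h => (Prod.ext_iff.1 h).2)
            obtain ⟨hYP, hY⟩ := Finset.mem_filter.1 (Finset.mem_coe.1 hY)
            refine Finset.mem_coe.2 (Finset.mem_filter.2 ⟨?_, rfl⟩)
            exact (P.mk_mem_nonUniforms G).2 ⟨hXP, hYP, hY.1, hY.2⟩
        _ ≤ _ := Finset.sum_le_sum_of_subset_of_nonneg (Finset.filter_subset _ _)
            fun _ _ _ => by positivity
    have h3 : (#bad : ℝ) * (e * p) ≤ (e * p) * (e * p) := by linarith
    exact le_of_mul_le_mul_right h3 (by positivity)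
  set t : Finset W → Finset (Finset W) := fun X => good.filter fun Y =>
    X ≠ Y ∧ G.IsUniform (e ^ 2) X Y ∧ 2 * (β / 8) ≤ (G.edgeDensity X Y : ℝ) with ht
  have htcard : ∀ X ∈ good, p ≤ 2 * #(t X) := by
    intro X hX
    obtain ⟨hXP, hXnu⟩ := Finset.mem_filter.1 hX
    have hX0 : (0 : ℝ) < #X := by
      have := hslo X hXP
      exact_mod_cast (by omega : 0 < #X)
    have h1 : (#X : ℝ) * ((1 / 2 + β) * N) ≤ ∑ Y ∈ P.parts, (#(G.interedges X Y) : ℝ) := by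
      have h2 : #(G.interedges X Finset.univ) = ∑ Y ∈ P.parts, #(G.interedges X Y) :=
        Rel.card_interedges_finpartition_right _ X P
      have h3 : (#(G.interedges X Finset.univ) : ℝ) = ∑ Y ∈ P.parts, (#(G.interedges X Y) : ℝ) := by
        exact_mod_cast h2
      rw [← h3, card_interedges_eq_sum_nbr]
      push_cast
      rw [← nsmul_eq_mul, ← Finset.sum_const]
      refine Finset.sum_le_sum fun x _ => ?_
      rw [Finset.inter_univ]
      exact hdeg x
    have h4 : ∀ Y ∈ P.parts, (#(G.interedges X Y) : ℝ) ≤ #X * ((((if Y ∈ t X then ((s : ℝ) + 1) else 0) +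
        (if Y ∈ bad then ((s : ℝ) + 1) else 0)) + ((if Y ∈ nu X then ((s : ℝ) + 1) else 0) +
        (if Y = X then ((s : ℝ) + 1) else 0))) + 2 * (β / 8) * #Y) := by
      intro Y hY
      have h5 : (#(G.interedges X Y) : ℝ) ≤ #X * #Y := by
        exact_mod_cast G.card_interedges_le_mul X Y
      have h6 : (#Y : ℝ) ≤ s + 1 := by exact_mod_cast hshi Y hY
      have hs0 : (0 : ℝ) ≤ s + 1 := by positivity
      have i1 : (0 : ℝ) ≤ if Y ∈ t X then ((s : ℝ) + 1) else 0 := by split_ifs <;> simp [hs0]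
      have i2 : (0 : ℝ) ≤ if Y ∈ bad then ((s : ℝ) + 1) else 0 := by split_ifs <;> simp [hs0]
      have i3 : (0 : ℝ) ≤ if Y ∈ nu X then ((s : ℝ) + 1) else 0 := by split_ifs <;> simp [hs0]
      have i4 : (0 : ℝ) ≤ if Y = X then ((s : ℝ) + 1) else 0 := by split_ifs <;> simp [hs0]
      have i5 : (0 : ℝ) ≤ 2 * (β / 8) * #Y := by positivity
      by_cases c1 : Y ∈ t X
      · refine h5.trans (mul_le_mul_of_nonneg_left ?_ hX0.le)
        rw [if_pos c1]; linarith
      by_cases c2 : Y ∈ bad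
      · refine h5.trans (mul_le_mul_of_nonneg_left ?_ hX0.le)
        rw [if_pos c2]; linarith
      by_cases c3 : Y ∈ nu X
      · refine h5.trans (mul_le_mul_of_nonneg_left ?_ hX0.le)
        rw [if_pos c3]; linarith
      by_cases c4 : Y = X
      · refine h5.trans (mul_le_mul_of_nonneg_left ?_ hX0.le)
        rw [if_pos c4]; linarith
      have hYgood : Y ∈ good := by
        by_contra hcon
        refine c2 (Finset.mem_filter.2 ⟨hY, fun hle => hcon (Finset.mem_filter.2 ⟨hY, hle⟩)⟩)
      have hunif : G.IsUniform (e ^ 2) X Y := by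
        by_contra hcon
        exact c3 (Finset.mem_filter.2 ⟨hY, fun h => c4 h.symm, hcon⟩)
      have hdens : (G.edgeDensity X Y : ℝ) < 2 * (β / 8) := by
        by_contra! hcon
        exact c1 (Finset.mem_filter.2 ⟨hYgood, fun h => c4 h.symm, hunif, hcon⟩)
      have hY0 : (0 : ℝ) < #Y := by
        have := hslo Y hY
        exact_mod_cast (by omega : 0 < #Y)
      rw [SimpleGraph.edgeDensity_def] at hdens
      push_cast at hdens
      rw [div_lt_iff₀ (by positivity)] at hdens
      refine hdens.le.trans ?_
      have : (#X : ℝ) * (2 * (β / 8) * #Y) ≤ #X * ((((if Y ∈ t X then ((s : ℝ) + 1) else 0) +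
        (if Y ∈ bad then ((s : ℝ) + 1) else 0)) + ((if Y ∈ nu X then ((s : ℝ) + 1) else 0) +
        (if Y = X then ((s : ℝ) + 1) else 0))) + 2 * (β / 8) * #Y) :=
        mul_le_mul_of_nonneg_left (by linarith) hX0.le
      linarith
    have hite : ∀ Q ⊆ P.parts, ∑ Y ∈ P.parts, (if Y ∈ Q then ((s : ℝ) + 1) else 0) = #Q * (s + 1) := by
      intro Q hQ
      rw [Finset.sum_ite_mem, Finset.inter_eq_right.2 hQ, Finset.sum_const, nsmul_eq_mul]
    have h7 : (#X : ℝ) * ((1 / 2 + β) * N) ≤ #X * ((((#(t X) : ℝ) * (s + 1) + #bad * (s + 1)) +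
        (#(nu X) * (s + 1) + (s + 1))) + 2 * (β / 8) * N) := by
      refine h1.trans ((Finset.sum_le_sum h4).trans_eq ?_)
      rw [← Finset.mul_sum, Finset.sum_add_distrib, Finset.sum_add_distrib, Finset.sum_add_distrib,
        Finset.sum_add_distrib, hite _ ((Finset.filter_subset _ _).trans (Finset.filter_subset _ _)),
        hite _ (Finset.filter_subset _ _), hite _ (Finset.filter_subset _ _), Finset.sum_ite_eq' P.parts X,
        if_pos hXP, ← Finset.mul_sum]
      congr 3
      have := P.sum_card_parts
      rw [hcardU] at this
      exact_mod_cast this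
    have h8 := le_of_mul_le_mul_left h7 hX0
    have h9 : (p : ℝ) ≤ 2 * #(t X) := by
      by_contra! hcon
      exact absurd h8 (not_le.2 (regular_degree_arith hβ hβ1 hsβ hpβ (Nat.cast_nonneg _) hpR
        (hbadcard.trans (mul_le_mul_of_nonneg_right heβ hpR.le))
        (hXnu.trans (mul_le_mul_of_nonneg_right heβ hpR.le)) hspN hcon))
    exact_mod_cast h9
  obtain ⟨π, hπinj, hπ⟩ := exists_injective_of_half_degree good t p (by omega)
    (fun X _ => Finset.filter_subset _ _) htcard (fun X hX Y hY hXY => by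
      obtain ⟨-, h1, h2, h3⟩ := Finset.mem_filter.1 hXY
      exact Finset.mem_filter.2 ⟨hX, h1.symm, h2.symm, by rwa [SimpleGraph.edgeDensity_comm]⟩)
  have hπgood : ∀ X, π X ∈ good := fun X => (Finset.mem_filter.1 (hπ X)).1
  set h := s / 2 with hh
  have hhalf : ∀ X : Finset W, X ∈ P.parts → ∃ Q : Finset W × Finset W, Q.1 ⊆ X ∧ Q.2 ⊆ X ∧
      Disjoint Q.1 Q.2 ∧ #Q.1 = h ∧ #Q.2 = h := by
    intro X hX
    have hXs := hslo X hX
    obtain ⟨Q, hQ, hQh⟩ := Finset.exists_subset_card_eq (s := X) (n := h) (by omega)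
    obtain ⟨R, hR, hRh⟩ := Finset.exists_subset_card_eq (s := X \ Q) (n := h) (by
      rw [Finset.card_sdiff_of_subset hQ]; omega)
    refine ⟨(Q, R), hQ, hR.trans Finset.sdiff_subset, ?_, hQh, hRh⟩
    exact Finset.disjoint_of_subset_right hR Finset.disjoint_sdiff
  choose! H hH1 hH2 hH3 hH4 hH5 using hhalf
  have h4h : s + 1 ≤ 4 * h := by omega
  have h4hR : (s : ℝ) + 1 ≤ 4 * h := by exact_mod_cast h4h
  have hhpos : 0 < h := by omega
  have hhR : (0 : ℝ) < h := by exact_mod_cast hhpos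
  have hpartdisj : ∀ X ∈ P.parts, ∀ Y ∈ P.parts, X ≠ Y → Disjoint X Y := fun X hX Y hY hXY =>
    P.disjoint hX hY hXY
  have hXe : ∀ X ∈ P.parts, (#X : ℝ) * e ^ 2 ≤ ε * h := by
    intro X hX
    have h1 : (#X : ℝ) ≤ s + 1 := by exact_mod_cast hshi X hX
    have h2 : (#X : ℝ) * e ^ 2 ≤ (4 * h) * (ε / 4) := by
      gcongr
      · linarith
      · linarith
    linarith
  set E := good.equivFin with hE
  have hEg : ∀ i, ((E.symm i : {x // x ∈ good}) : Finset W) ∈ P.parts := fun i => hgP _ (E.symm i).2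
  have hπg : ∀ i, π (E.symm i) ∈ P.parts := fun i => hgP _ (hπgood _)
  refine ⟨#good, h, fun i => (H (E.symm i)).1, fun i => (H (π (E.symm i))).2, ?_, ?_, ?_⟩
  · exact le_trans (by omega) hPk
  · refine ⟨fun i => hH4 _ (hEg i), fun i => hH5 _ (hπg i), fun i j hij => ?_, fun i j hij => ?_,
      fun i j => ?_, fun i B' hB' hcard => ?_, fun i A' hA' hcard => ?_⟩
    · refine Finset.disjoint_of_subset_left (hH1 _ (hEg i)) (Finset.disjoint_of_subset_right
        (hH1 _ (hEg j)) (hpartdisj _ (hEg i) _ (hEg j) fun heq => hij ?_))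
      exact E.symm.injective (Subtype.ext heq)
    · refine Finset.disjoint_of_subset_left (hH2 _ (hπg i)) (Finset.disjoint_of_subset_right
        (hH2 _ (hπg j)) (hpartdisj _ (hπg i) _ (hπg j) fun heq => hij ?_))
      exact E.symm.injective (hπinj heq)
    · by_cases heq : ((E.symm i : {x // x ∈ good}) : Finset W) = π (E.symm j)
      · have := hH3 _ (hπg j)
        rwa [← heq] at this ⊢
      · exact Finset.disjoint_of_subset_left (hH1 _ (hEg i)) (Finset.disjoint_of_subset_right
          (hH2 _ (hπg j)) (hpartdisj _ (hEg i) _ (hπg j) heq))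
    · obtain ⟨-, -, hu, hd⟩ := Finset.mem_filter.1 (hπ (E.symm i))
      refine ((card_filter_few_nbr_lt hu hd (by linarith) (hH1 _ (hEg i))
        (hB'.trans (hH2 _ (hπg i))) ?_ ((hXe _ (hπg i)).trans hcard) ?_).le).trans (hXe _ (hEg i))
      · have : (0 : ℝ) < #B' := lt_of_lt_of_le (by positivity) hcard
        exact_mod_cast this
      · exact P.nonempty_of_mem_parts (hEg i)
    · obtain ⟨-, -, hu, hd⟩ := Finset.mem_filter.1 (hπ (E.symm i))
      rw [SimpleGraph.edgeDensity_comm] at hd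
      refine ((card_filter_few_nbr_lt hu.symm hd (by linarith) (hH2 _ (hπg i))
        (hA'.trans (hH1 _ (hEg i))) ?_ ((hXe _ (hEg i)).trans hcard) ?_).le).trans (hXe _ (hπg i))
      · have : (0 : ℝ) < #A' := lt_of_lt_of_le (by positivity) hcard
        exact_mod_cast this
      · exact P.nonempty_of_mem_parts (hπg i)
  · have hk : (1 - e) * p ≤ (#good : ℝ) := by
      have : (#good : ℝ) + #bad = p := by exact_mod_cast hgb
      linarith
    have h2h : (s : ℝ) - 1 ≤ 2 * h := by
      have : s ≤ 2 * h + 1 := by omega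
      have : (s : ℝ) ≤ 2 * h + 1 := by exact_mod_cast this
      linarith
    have h1e : 0 ≤ 1 - e := by linarith
    calc (1 - ε) * N ≤ (1 - ε) * ((s + 1) * p) := by gcongr
      _ ≤ ((1 - e) * p) * (s - 1) := by
        have h5 : e * s ≤ ε / 4 * s := mul_le_mul_of_nonneg_right heε (by linarith)
        have : (1 - ε) * (s + 1) ≤ (1 - e) * (s - 1) := by linarith
        calc (1 - ε) * ((s + 1) * p) = ((1 - ε) * (s + 1)) * p := by ring
          _ ≤ ((1 - e) * (s - 1)) * p := mul_le_mul_of_nonneg_right this hpR.le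
          _ = _ := by ring
      _ ≤ #good * (2 * h) := by gcongr; linarith
      _ = _ := by ring

theorem IsRegularPairing.map_subtype {U : Finset W} {ε d : ℝ} {k h : ℕ}
    {A B : Fin k → Finset {x // x ∈ U}}
    (hAB : IsRegularPairing (G.comap (Subtype.val : {x // x ∈ U} → W)) ε d h A B) :
    IsRegularPairing G ε d h (fun i => (A i).map (Function.Embedding.subtype _))
      (fun i => (B i).map (Function.Embedding.subtype _)) := by
  set ι : {x // x ∈ U} ↪ W := Function.Embedding.subtype _ with hι
  have hcount : ∀ (a : {x // x ∈ U}) (S : Finset {x // x ∈ U}),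
      #(nbr G a ∩ S.map ι) = #(nbr (G.comap (Subtype.val : {x // x ∈ U} → W)) a ∩ S) := by
    intro a S
    rw [← Finset.card_map ι]
    congr 1
    ext w
    simp only [Finset.mem_inter, mem_nbr, Finset.mem_map]
    constructor
    · rintro ⟨h1, x, hx, rfl⟩
      exact ⟨x, ⟨h1, hx⟩, rfl⟩
    · rintro ⟨x, ⟨h1, hx⟩, rfl⟩
      exact ⟨h1, x, hx, rfl⟩
  have hreg : ∀ S R : Finset {x // x ∈ U}, (∀ R' ⊆ R, ε * h ≤ #R' →
      (#(S.filter fun a => (#(nbr (G.comap (Subtype.val : {x // x ∈ U} → W)) a ∩ R') : ℝ)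
        < d * #R') : ℝ) ≤ ε * h) →
      ∀ R' ⊆ R.map ι, ε * h ≤ #R' →
      (#((S.map ι).filter fun a => (#(nbr G a ∩ R') : ℝ) < d * #R') : ℝ) ≤ ε * h := by
    intro S R hS R' hR' hcard
    obtain ⟨R₀, hR₀, rfl⟩ := Finset.subset_map_iff.1 hR'
    rw [Finset.card_map] at hcard
    refine le_trans ?_ (hS R₀ hR₀ hcard)
    rw [Finset.filter_map, Finset.card_map, Finset.card_map]
    refine le_of_eq ?_
    congr 2
    refine Finset.filter_congr fun a _ => ?_
    simp only [Function.comp]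
    rw [← hcount a R₀]
    rfl
  refine ⟨fun i => ?_, fun i => ?_, fun i j hij => ?_, fun i j hij => ?_, fun i j => ?_,
    fun i => hreg _ _ fun R' h1 h2 => ?_, fun i => hreg _ _ fun R' h1 h2 => ?_⟩
  · rw [Finset.card_map, hAB.card_left]
  · rw [Finset.card_map, hAB.card_right]
  · exact (Finset.disjoint_map ι).2 (hAB.disjoint_left i j hij)
  · exact (Finset.disjoint_map ι).2 (hAB.disjoint_right i j hij)
  · exact (Finset.disjoint_map ι).2 (hAB.disjoint i j)
  · convert hAB.regular_left i R' h1 h2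
  · convert hAB.regular_right i R' h1 h2

theorem exists_isRegularPairing (β ε : ℝ) (hβ : 0 < β) (hβ1 : β ≤ 1) (hε : 0 < ε) (hε1 : ε ≤ 1) :
    ∃ k₀ N₀ : ℕ, ∀ (W : Type) [Fintype W] (G : SimpleGraph W) (U : Finset W), N₀ ≤ #U →
      (∀ v ∈ U, (1 / 2 + β) * #U ≤ (#(nbr G v ∩ U) : ℝ)) →
      ∃ (k h : ℕ) (A B : Fin k → Finset W), k ≤ k₀ ∧ IsRegularPairing G ε (β / 8) h A B ∧
        (∀ i, A i ⊆ U ∧ B i ⊆ U) ∧ (1 - ε) * #U ≤ (2 * k * h : ℝ) := by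
  obtain ⟨k₀, N₀, H⟩ := exists_isRegularPairing_univ β ε hβ hβ1 hε hε1
  refine ⟨k₀, N₀, fun W _ G U hU hdeg => ?_⟩
  have hcard : Fintype.card {x // x ∈ U} = #U := Fintype.card_coe U
  obtain ⟨k, h, A, B, hk, hAB, hkh⟩ := H {x // x ∈ U} (G.comap Subtype.val) (by rwa [hcard])
    (fun v => by
      rw [hcard]
      refine (hdeg v v.2).trans ?_
      norm_cast
      rw [← Finset.card_map (Function.Embedding.subtype _)]
      refine Finset.card_le_card fun w hw => ?_
      obtain ⟨h1, h2⟩ := Finset.mem_inter.1 hw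
      have h3 : G.Adj v w := mem_nbr.1 h1
      exact Finset.mem_map.2 ⟨⟨w, h2⟩, mem_nbr.2 h3, rfl⟩)
  rw [hcard] at hkh
  refine ⟨k, h, _, _, hk, hAB.map_subtype, fun i => ⟨fun x hx => ?_, fun x hx => ?_⟩, hkh⟩
  · obtain ⟨y, -, rfl⟩ := Finset.mem_map.1 hx
    exact y.2
  · obtain ⟨y, -, rfl⟩ := Finset.mem_map.1 hx
    exact y.2

end Regularity

section Piece

variable {V W : Type*} [Fintype W] {T : SimpleGraph V} {ρ : V} {par : V → V}
  {dep : V → ℕ}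

/-- The part of the host into which a vertex `x` of a piece with root `z` goes: the root goes to
`Z`, other vertices to `X` or `Y` according to the parity of their distance to the root. -/
def pieceTarget (dep : V → ℕ) (z : V) (Z X Y : Finset W) (x : V) : Finset W :=
  if x = z then Z else if (dep x + dep z) % 2 = 1 then X else Y

theorem exists_spread_piece (h : IsRooting T ρ par dep) (G : SimpleGraph W) {D S : Finset V}
    (hDS : Disjoint D S) {z : V} (hpz : par z ∈ D) (hS : ∀ x ∈ S, x ≠ z → par x ∈ S)
    (hρ : ρ ∉ S) (f : V → W) {Z X Y : Finset W} {m M : ℕ} (hm : 0 < m) (hSM : #S ≤ M)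
    (hZ : m + M ≤ #Z) (hZX : ∀ w ∈ Z, G.Adj (f (par z)) w ∧ m + M ≤ #(nbr G w ∩ X))
    (hXY : ∀ x ∈ X, m + M ≤ #(nbr G x ∩ Y)) (hYX : ∀ y ∈ Y, m + M ≤ #(nbr G y ∩ X)) :
    ∃ μ : PMF (V → W), (∀ g ∈ μ.support, (∀ v, v ∉ S → g v = f v) ∧ Set.InjOn g S ∧
      (∀ x ∈ S, G.Adj (g (par x)) (g x)) ∧ ∀ x ∈ S, g x ∈ pieceTarget dep z Z X Y x) ∧
      SpreadOn ((m : ℝ≥0∞)⁻¹) S μ := by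
  set Inv : Finset V → (V → W) → Prop := fun D' g => (∀ v, v ∉ S → g v = f v) ∧
    Set.InjOn g D' ∧ (∀ x ∈ D', x ≠ z → par x ∈ D') ∧ (∀ x ∈ D', G.Adj (g (par x)) (g x)) ∧
    ∀ x ∈ D', g x ∈ pieceTarget dep z Z X Y x with hInv
  have step : ∀ D' ⊆ S, D' ≠ S → ∀ g, Inv D' g → ∃ x ∈ S, x ∉ D' ∧ ∃ A : Finset W, m ≤ #A ∧
      (∀ c ∈ A, Inv (insert x D') (Function.update g x c)) ∧
      ∑ c ∈ A, (0 : ℝ≥0∞) ≤ #A * 0 := by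
    rintro D' hD' hne g ⟨hgf, hinj, hcl, hadj, htar⟩
    have hex : (S \ D').Nonempty := by
      rw [Finset.nonempty_iff_ne_empty]
      intro h0
      exact hne (hD'.antisymm (Finset.sdiff_eq_empty_iff_subset.1 h0))
    obtain ⟨x, hx, hmin⟩ := Finset.exists_min_image _ dep hex
    obtain ⟨hxS, hxD⟩ := Finset.mem_sdiff.1 hx
    have hxρ : x ≠ ρ := ne_of_mem_of_not_mem hxS hρ
    have hdx := h.dep_par x hxρ
    have hpar : x ≠ z → par x ∈ D' := by
      intro hxz
      by_contra hcon
      have := hmin (par x) (Finset.mem_sdiff.2 ⟨hS x hxS hxz, hcon⟩)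
      omega
    have hparx : par x ≠ x := fun heq => by rw [heq] at hdx; omega
    set c : Finset W := nbr G (g (par x)) ∩ pieceTarget dep z Z X Y x with hc
    have hccard : m + M ≤ #c := by
      by_cases hxz : x = z
      · subst hxz
        refine hZ.trans (Finset.card_le_card fun w hw => ?_)
        have : g (par x) = f (par x) := hgf _ (Finset.disjoint_left.1 hDS hpz)
        refine Finset.mem_inter.2 ⟨mem_nbr.2 (this ▸ (hZX w hw).1), ?_⟩
        simpa [pieceTarget] using hw
      · have h1 := htar _ (hpar hxz)
        rw [hc]
        unfold pieceTarget at h1 ⊢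
        rw [if_neg hxz]
        by_cases hpz' : par x = z
        · rw [if_pos hpz'] at h1
          rw [hpz'] at hdx
          rw [if_pos (by omega)]
          exact (hZX _ h1).2
        · rw [if_neg hpz'] at h1
          by_cases hodd : (dep x + dep z) % 2 = 1
          · rw [if_neg (by omega)] at h1
            rw [if_pos hodd]
            exact hYX _ h1
          · rw [if_pos (by omega)] at h1
            rw [if_neg hodd]
            exact hXY _ h1
    refine ⟨x, hxS, hxD, c \ D'.image g, ?_, ?_, by simp⟩
    · have h1 := Finset.le_card_sdiff (D'.image g) c
      have h2 : #(D'.image g) ≤ #D' := Finset.card_image_le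
      have h3 := Finset.card_le_card hD'
      omega
    · intro w hw
      obtain ⟨hwc, hwD⟩ := Finset.mem_sdiff.1 hw
      obtain ⟨hw1, hw2⟩ := Finset.mem_inter.1 hwc
      have hupd : ∀ y ∈ D', Function.update g x w y = g y := fun y hy =>
        Function.update_of_ne (ne_of_mem_of_not_mem hy hxD) _ _
      refine ⟨fun v hv => ?_, ?_, ?_, ?_, ?_⟩
      · rw [Function.update_of_ne (ne_of_mem_of_not_mem hxS hv).symm]
        exact hgf v hv
      · intro a ha b hb hab
        rw [Finset.coe_insert] at ha hb
        rcases ha with rfl | ha <;> rcases hb with rfl | hb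
        · rfl
        · rw [Function.update_self, hupd b hb] at hab
          exact absurd (Finset.mem_image.2 ⟨b, hb, hab.symm⟩) hwD
        · rw [Function.update_self, hupd a ha] at hab
          exact absurd (Finset.mem_image.2 ⟨a, ha, hab⟩) hwD
        · rw [hupd a ha, hupd b hb] at hab
          exact hinj ha hb hab
      · intro y hy hyz
        rcases Finset.mem_insert.1 hy with rfl | hy
        · exact Finset.mem_insert_of_mem (hpar hyz)
        · exact Finset.mem_insert_of_mem (hcl y hy hyz)
      · intro y hy
        rcases Finset.mem_insert.1 hy with rfl | hy
        · rw [Function.update_self, Function.update_of_ne hparx]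
          exact mem_nbr.1 hw1
        · rw [hupd y hy]
          have : par y ≠ x := by
            intro heq
            by_cases hyz : y = z
            · subst hyz
              exact Finset.disjoint_left.1 hDS hpz (heq ▸ hxS)
            · exact hxD (heq ▸ hcl y hy hyz)
          rw [Function.update_of_ne this]
          exact hadj y hy
      · intro y hy
        rcases Finset.mem_insert.1 hy with rfl | hy
        · rw [Function.update_self]; exact hw2
        · rw [hupd y hy]; exact htar y hy
  obtain ⟨μ, hμ, hsp, -⟩ := exists_spread_process m hm S Inv (fun _ _ => 0) step ∅
    (Finset.empty_subset _) f ⟨fun _ _ => rfl, by simp, by simp, by simp, by simp⟩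
  refine ⟨μ, fun g hg => ?_, by simpa using hsp⟩
  obtain ⟨⟨h1, h2, -, h3, h4⟩, -⟩ := hμ g hg
  exact ⟨h1, h2, h3, h4⟩

theorem le_card_filter_of_codegree (G : SimpleGraph W) {Z X Q : Finset W} {u : W} {c q : ℝ}
    (hX : 0 < #X) (hc : ∀ x ∈ X, c ≤ #(Z ∩ (nbr G u ∩ nbr G x)))
    (hQ : (#(Q ∩ Z) : ℝ) ≤ c / 4) (hq0 : 0 ≤ q) (hq : 4 * q * Fintype.card W ≤ c * #X) :
    c / 2 ≤ (#((Z \ Q).filter fun w => G.Adj u w ∧ q ≤ (#(nbr G w ∩ X) : ℝ)) : ℝ) := by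
  set N := Z ∩ nbr G u with hN
  set F := (Z \ Q).filter fun w => G.Adj u w ∧ q ≤ (#(nbr G w ∩ X) : ℝ) with hF
  have hX0 : (0 : ℝ) < #X := by exact_mod_cast hX
  have h1 : ∑ w ∈ N, (#(nbr G w ∩ X) : ℝ) = ∑ x ∈ X, (#(Z ∩ (nbr G u ∩ nbr G x)) : ℝ) := by
    have := Finset.sum_card_bipartiteAbove_eq_sum_card_bipartiteBelow (s := N) (t := X) G.Adj
    have e1 : ∀ w, Finset.bipartiteAbove G.Adj X w = nbr G w ∩ X := by
      intro w; ext x; simp [Finset.bipartiteAbove, mem_nbr, and_comm]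
    have e2 : ∀ x, Finset.bipartiteBelow G.Adj N x = Z ∩ (nbr G u ∩ nbr G x) := by
      intro x; ext w; simp [Finset.bipartiteBelow, mem_nbr, hN, and_assoc, G.adj_comm x w]
    simp only [e1, e2] at this
    exact_mod_cast this
  have h2 : c * #X ≤ ∑ x ∈ X, (#(Z ∩ (nbr G u ∩ nbr G x)) : ℝ) := by
    rw [mul_comm, ← nsmul_eq_mul, ← Finset.sum_const]
    exact Finset.sum_le_sum hc
  have h3 : ∀ w ∈ N, (#(nbr G w ∩ X) : ℝ) ≤
      ((if w ∈ F then (#X : ℝ) else 0) + (if w ∈ Q ∩ Z then (#X : ℝ) else 0)) + q := by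
    intro w hw
    obtain ⟨hwZ, hwu⟩ := Finset.mem_inter.1 hw
    have hle : (#(nbr G w ∩ X) : ℝ) ≤ #X := by
      exact_mod_cast Finset.card_le_card Finset.inter_subset_right
    have i1 : (0 : ℝ) ≤ if w ∈ F then (#X : ℝ) else 0 := by split_ifs <;> simp
    have i2 : (0 : ℝ) ≤ if w ∈ Q ∩ Z then (#X : ℝ) else 0 := by split_ifs <;> simp
    by_cases c1 : w ∈ F
    · rw [if_pos c1]; linarith
    by_cases c2 : w ∈ Q ∩ Z
    · rw [if_pos c2]; linarith
    have : (#(nbr G w ∩ X) : ℝ) < q := by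
      by_contra! hcon
      refine c1 (Finset.mem_filter.2 ⟨Finset.mem_sdiff.2 ⟨hwZ, fun hwQ => c2 ?_⟩,
        mem_nbr.1 hwu, hcon⟩)
      exact Finset.mem_inter.2 ⟨hwQ, hwZ⟩
    linarith
  have h4 : ∀ R : Finset W, ∑ w ∈ N, (if w ∈ R then (#X : ℝ) else 0) ≤ #R * #X := by
    intro R
    rw [Finset.sum_ite_mem, Finset.sum_const, nsmul_eq_mul]
    refine mul_le_mul_of_nonneg_right ?_ hX0.le
    exact_mod_cast Finset.card_le_card Finset.inter_subset_right
  have h5 : (#N : ℝ) * q ≤ Fintype.card W * q := by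
    refine mul_le_mul_of_nonneg_right ?_ hq0
    exact_mod_cast Finset.card_le_univ N
  have h6 := Finset.sum_le_sum h3
  rw [Finset.sum_add_distrib, Finset.sum_add_distrib, Finset.sum_const, nsmul_eq_mul] at h6
  have h7 : (#(Q ∩ Z) : ℝ) * #X ≤ c / 4 * #X := mul_le_mul_of_nonneg_right hQ hX0.le
  have h8 : c / 2 * #X ≤ #F * #X := by linarith [h4 F, h4 (Q ∩ Z)]
  exact le_of_mul_le_mul_right h8 hX0

theorem exists_spread_piece_regular (h : IsRooting T ρ par dep) (G : SimpleGraph W)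
    {D S : Finset V} (hDS : Disjoint D S) {z : V} (hpz : par z ∈ D)
    (hS : ∀ x ∈ S, x ≠ z → par x ∈ S) (hρ : ρ ∉ S) (f : V → W) {Z X Y Q : Finset W} {m M : ℕ}
    (hm : 0 < m) (hSM : #S ≤ M) {c d e x₀ : ℝ}
    (hX : x₀ ≤ #X) (hY : x₀ ≤ #Y) (hd : 0 ≤ d)
    (hXe : (#(X.filter fun x => (#(nbr G x ∩ Y) : ℝ) < d * #Y) : ℝ) ≤ e)
    (hYe : (#(Y.filter fun y => (#(nbr G y ∩ X) : ℝ) < d * #X) : ℝ) ≤ e)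
    (hc : ∀ u v, c ≤ #(Z ∩ (nbr G u ∩ nbr G v))) (hQ : (#(Q ∩ Z) : ℝ) ≤ c / 4)
    (hmd : (m + M : ℝ) ≤ d * x₀ - e) (hmc : (m + M : ℝ) ≤ c / 2) (hx₀ : e < x₀)
    (hmN : 4 * (m + M : ℝ) * Fintype.card W ≤ c * (x₀ - e)) :
    ∃ μ : PMF (V → W), (∀ g ∈ μ.support, (∀ v, v ∉ S → g v = f v) ∧ Set.InjOn g S ∧
      (∀ x ∈ S, G.Adj (g (par x)) (g x)) ∧ ∀ x ∈ S, g x ∈ pieceTarget dep z (Z \ Q) X Y x) ∧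
      SpreadOn ((m : ℝ≥0∞)⁻¹) S μ := by
  set X' := X.filter fun x => ¬ (#(nbr G x ∩ Y) : ℝ) < d * #Y with hX'
  set Y' := Y.filter fun y => ¬ (#(nbr G y ∩ X) : ℝ) < d * #X with hY'
  have hcX : (#X : ℝ) ≤ #X' + e := by
    have h1 := Finset.card_filter_add_card_filter_not (s := X)
      fun x => (#(nbr G x ∩ Y) : ℝ) < d * #Y
    have h2 := congrArg (Nat.cast : ℕ → ℝ) h1
    rw [Nat.cast_add] at h2
    linarith
  have hcore : ∀ X Y : Finset W, x₀ ≤ #Y →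
      (#(Y.filter fun y => (#(nbr G y ∩ X) : ℝ) < d * #X) : ℝ) ≤ e →
      ∀ x ∈ X.filter fun x => ¬ (#(nbr G x ∩ Y) : ℝ) < d * #Y,
      m + M ≤ #(nbr G x ∩ Y.filter fun y => ¬ (#(nbr G y ∩ X) : ℝ) < d * #X) := by
    intro X Y hY hYe x hx
    have h1 := not_lt.1 (Finset.mem_filter.1 hx).2
    have h2 : nbr G x ∩ Y ⊆ (nbr G x ∩ Y.filter fun y => ¬ (#(nbr G y ∩ X) : ℝ) < d * #X) ∪
        Y.filter fun y => (#(nbr G y ∩ X) : ℝ) < d * #X := by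
      intro w hw
      obtain ⟨hw1, hw2⟩ := Finset.mem_inter.1 hw
      by_cases hw3 : (#(nbr G w ∩ X) : ℝ) < d * #X
      · exact Finset.mem_union_right _ (Finset.mem_filter.2 ⟨hw2, hw3⟩)
      · exact Finset.mem_union_left _ (Finset.mem_inter.2 ⟨hw1, Finset.mem_filter.2 ⟨hw2, hw3⟩⟩)
    have h3 := (Finset.card_le_card h2).trans (Finset.card_union_le _ _)
    have h4 : (#(nbr G x ∩ Y) : ℝ) ≤ #(nbr G x ∩ Y.filter fun y => ¬ (#(nbr G y ∩ X) : ℝ) < d * #X)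
        + #(Y.filter fun y => (#(nbr G y ∩ X) : ℝ) < d * #X) := by exact_mod_cast h3
    have h5 : d * x₀ ≤ d * #Y := mul_le_mul_of_nonneg_left hY hd
    have h6 : (m + M : ℝ) ≤ #(nbr G x ∩ Y.filter fun y => ¬ (#(nbr G y ∩ X) : ℝ) < d * #X) := by
      linarith
    exact_mod_cast h6
  set Z' := (Z \ Q).filter fun w => G.Adj (f (par z)) w ∧ (m + M : ℝ) ≤ (#(nbr G w ∩ X') : ℝ) with hZ'
  have hX'0 : (0 : ℝ) < #X' := by linarith
  have hmM : (0 : ℝ) ≤ m + M := by positivity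
  have hc0 : 0 ≤ c := by linarith
  have hZcard : c / 2 ≤ (#Z' : ℝ) := by
    refine le_card_filter_of_codegree G (by exact_mod_cast hX'0) (fun x _ => hc _ _) hQ hmM
      (hmN.trans (mul_le_mul_of_nonneg_left (by linarith) hc0))
  obtain ⟨μ, hμ, hsp⟩ := exists_spread_piece h G hDS hpz hS hρ f (Z := Z') (X := X') (Y := Y') hm hSM
    (by exact_mod_cast hmc.trans hZcard) (fun w hw => by
      obtain ⟨-, h1, h2⟩ := Finset.mem_filter.1 hw
      exact ⟨h1, by exact_mod_cast h2⟩) (hcore X Y hY hYe) (hcore Y X hX hXe)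
  refine ⟨μ, fun g hg => ?_, hsp⟩
  obtain ⟨h1, h2, h3, h4⟩ := hμ g hg
  refine ⟨h1, h2, h3, fun x hx => ?_⟩
  have := h4 x hx
  unfold pieceTarget at this ⊢
  split_ifs at this ⊢
  · exact (Finset.mem_filter.1 this).1
  · exact (Finset.mem_filter.1 this).1
  · exact (Finset.mem_filter.1 this).1

end Piece

section Balanced

variable {V W : Type*} {T : SimpleGraph V} {ρ : V} {par : V → V} {dep : V → ℕ}
  {G : SimpleGraph W} {k : ℕ}

/-- `g` embeds the part of the tree on `D`, extends `f₀` from `P`, uses at most `j` vertices of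
the reserve `Z`, and uses the two sides of each pair `A i`, `B i` equally up to `M`. -/
structure IsBalancedEmbedding (G : SimpleGraph W) (ρ : V) (par : V → V) (P : Finset V)
    (f₀ : V → W) (Z : Finset W) (A B : Fin k → Finset W) (M : ℕ) (D : Finset V) (j : ℕ)
    (g : V → W) : Prop where
  injOn : Set.InjOn g D
  adj : ∀ x ∈ D, x ≠ ρ → G.Adj (g (par x)) (g x)
  eq_on : ∀ x ∈ P, g x = f₀ x
  reserve : #(D.image g ∩ Z) ≤ j
  left_le : ∀ i, #(A i ∩ D.image g) ≤ #(B i ∩ D.image g) + M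
  right_le : ∀ i, #(B i ∩ D.image g) ≤ #(A i ∩ D.image g) + M

theorem card_inter_image_union {D S : Finset V} (hDS : Disjoint D S) {g g' : V → W}
    (hgg : ∀ v ∈ D, g' v = g v) (hinj : Set.InjOn g' (D ∪ S : Finset V)) (R : Finset W) :
    #(R ∩ (D ∪ S).image g') = #(R ∩ D.image g) + #(S.filter fun x => g' x ∈ R) := by
  have h1 : D.image g = D.image g' := Finset.image_congr fun v hv => (hgg v hv).symm
  have h2 : R ∩ (D ∪ S).image g' = (R ∩ D.image g) ∪ (S.filter fun x => g' x ∈ R).image g' := by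
    ext w
    simp only [h1, Finset.mem_inter, Finset.mem_image, Finset.mem_union, Finset.mem_filter]
    constructor
    · rintro ⟨hw, x, hx | hx, rfl⟩
      · exact Or.inl ⟨hw, x, hx, rfl⟩
      · exact Or.inr ⟨x, ⟨hx, hw⟩, rfl⟩
    · rintro (⟨hw, x, hx, rfl⟩ | ⟨x, ⟨hx, hw⟩, rfl⟩)
      · exact ⟨hw, x, Or.inl hx, rfl⟩
      · exact ⟨hw, x, Or.inr hx, rfl⟩
  rw [h2, Finset.card_union_of_disjoint, Finset.card_image_of_injOn]
  · intro a ha b hb hab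
    exact hinj (Finset.mem_coe.2 (Finset.mem_union_right _ (Finset.mem_filter.1 ha).1))
      (Finset.mem_coe.2 (Finset.mem_union_right _ (Finset.mem_filter.1 hb).1)) hab
  · rw [Finset.disjoint_left]
    intro w hw hw'
    rw [h1] at hw
    obtain ⟨x, hx, rfl⟩ := Finset.mem_image.1 (Finset.mem_inter.1 hw).2
    obtain ⟨y, hy, hxy⟩ := Finset.mem_image.1 hw'
    have hyS := (Finset.mem_filter.1 hy).1
    have := hinj (Finset.mem_coe.2 (Finset.mem_union_right _ hyS))
      (Finset.mem_coe.2 (Finset.mem_union_left _ hx)) hxy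
    exact Finset.disjoint_left.1 hDS hx (this ▸ hyS)

/-- Extending a balanced embedding by a piece embedded into one pair, with the sides of the pair
named `X` and `Y` in either order. -/
theorem IsBalancedEmbedding.extend {P D S : Finset V} {f₀ g g' : V → W} {Z : Finset W}
    {A B : Fin k → Finset W} {M j : ℕ} (hg : IsBalancedEmbedding G ρ par P f₀ Z A B M D j g)
    (hPD : P ⊆ D) (hDS : Disjoint D S) {z : V} (hparD : ∀ x ∈ D, par x ∈ D)
    {X Y : Finset W} (hXY : Disjoint X Y) (hZX : Disjoint Z X) (hZY : Disjoint Z Y)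
    (hpair : ∀ i, (A i = X ∧ B i = Y) ∨ (A i = Y ∧ B i = X) ∨
      ((Disjoint (A i) X ∧ Disjoint (A i) Y) ∧ Disjoint (B i) X ∧ Disjoint (B i) Y))
    (hZAB : ∀ i, Disjoint Z (A i) ∧ Disjoint Z (B i))
    (hbal₁ : #(X ∩ D.image g) + #(S.filter fun x => x ≠ z ∧ (dep x + dep z) % 2 = 1) ≤
      #(Y ∩ D.image g) + #(S.filter fun x => x ≠ z ∧ ¬ (dep x + dep z) % 2 = 1) + M)
    (hbal₂ : #(Y ∩ D.image g) + #(S.filter fun x => x ≠ z ∧ ¬ (dep x + dep z) % 2 = 1) ≤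
      #(X ∩ D.image g) + #(S.filter fun x => x ≠ z ∧ (dep x + dep z) % 2 = 1) + M)
    (hgg : ∀ v, v ∉ S → g' v = g v) (hinj : Set.InjOn g' S)
    (hadj : ∀ x ∈ S, G.Adj (g' (par x)) (g' x))
    (htar : ∀ x ∈ S, g' x ∈ pieceTarget dep z (Z \ D.image g) (X \ D.image g) (Y \ D.image g) x) :
    IsBalancedEmbedding G ρ par P f₀ Z A B M (D ∪ S) (j + 1) g' := by
  have hggD : ∀ v ∈ D, g' v = g v := fun v hv => hgg v (Finset.disjoint_left.1 hDS hv)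
  have htar' : ∀ x ∈ S, g' x ∉ D.image g ∧ ((x = z ∧ g' x ∈ Z) ∨
      ((x ≠ z ∧ (dep x + dep z) % 2 = 1) ∧ g' x ∈ X) ∨
      ((x ≠ z ∧ ¬ (dep x + dep z) % 2 = 1) ∧ g' x ∈ Y)) := by
    intro x hx
    have h1 := htar x hx
    unfold pieceTarget at h1
    split_ifs at h1 with h2 h3
    · exact ⟨(Finset.mem_sdiff.1 h1).2, Or.inl ⟨h2, (Finset.mem_sdiff.1 h1).1⟩⟩
    · exact ⟨(Finset.mem_sdiff.1 h1).2, Or.inr (Or.inl ⟨⟨h2, h3⟩, (Finset.mem_sdiff.1 h1).1⟩)⟩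
    · exact ⟨(Finset.mem_sdiff.1 h1).2, Or.inr (Or.inr ⟨⟨h2, h3⟩, (Finset.mem_sdiff.1 h1).1⟩)⟩
  have hinj' : Set.InjOn g' (D ∪ S : Finset V) := by
    intro a ha b hb hab
    rw [Finset.coe_union] at ha hb
    rcases ha with ha | ha <;> rcases hb with hb | hb
    · rw [hggD a ha, hggD b hb] at hab
      exact hg.injOn ha hb hab
    · rw [hggD a ha] at hab
      exact absurd (Finset.mem_image.2 ⟨a, ha, hab⟩) (htar' b hb).1
    · rw [hggD b hb] at hab
      exact absurd (Finset.mem_image.2 ⟨b, hb, hab.symm⟩) (htar' a ha).1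
    · exact hinj ha hb hab
  have hcard := card_inter_image_union hDS hggD hinj'
  have hXc : #(X ∩ (D ∪ S).image g') =
      #(X ∩ D.image g) + #(S.filter fun x => x ≠ z ∧ (dep x + dep z) % 2 = 1) := by
    rw [hcard X]
    congr 2
    refine Finset.filter_congr fun x hx => ⟨fun h => ?_, fun h => ?_⟩
    · rcases (htar' x hx).2 with ⟨-, h1⟩ | ⟨h1, -⟩ | ⟨-, h1⟩
      · exact absurd h (Finset.disjoint_left.1 hZX h1)
      · exact h1
      · exact absurd h1 (Finset.disjoint_left.1 hXY h)
    · rcases (htar' x hx).2 with ⟨h1, -⟩ | ⟨-, h1⟩ | ⟨h1, -⟩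
      · exact absurd h1 h.1
      · exact h1
      · exact absurd h.2 h1.2
  have hYc : #(Y ∩ (D ∪ S).image g') =
      #(Y ∩ D.image g) + #(S.filter fun x => x ≠ z ∧ ¬ (dep x + dep z) % 2 = 1) := by
    rw [hcard Y]
    congr 2
    refine Finset.filter_congr fun x hx => ⟨fun h => ?_, fun h => ?_⟩
    · rcases (htar' x hx).2 with ⟨-, h1⟩ | ⟨-, h1⟩ | ⟨h1, -⟩
      · exact absurd h (Finset.disjoint_left.1 hZY h1)
      · exact absurd h (Finset.disjoint_left.1 hXY h1)
      · exact h1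
    · rcases (htar' x hx).2 with ⟨h1, -⟩ | ⟨h1, -⟩ | ⟨-, h1⟩
      · exact absurd h1 h.1
      · exact absurd h1.2 h.2
      · exact h1
  have hother : ∀ R : Finset W, Disjoint Z R → Disjoint R X → Disjoint R Y →
      #(R ∩ (D ∪ S).image g') = #(R ∩ D.image g) := by
    intro R h1 h2 h3
    rw [hcard R, Nat.add_eq_left, Finset.card_eq_zero, Finset.filter_eq_empty_iff]
    intro x hx hR
    rcases (htar' x hx).2 with ⟨-, h4⟩ | ⟨-, h4⟩ | ⟨-, h4⟩
    · exact Finset.disjoint_left.1 h1 h4 hR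
    · exact Finset.disjoint_left.1 h2 hR h4
    · exact Finset.disjoint_left.1 h3 hR h4
  refine ⟨hinj', fun x hx hxρ => ?_, fun x hx => ?_, ?_, fun i => ?_, fun i => ?_⟩
  · rcases Finset.mem_union.1 hx with hx | hx
    · rw [hggD x hx, hggD _ (hparD x hx)]
      exact hg.adj x hx hxρ
    · exact hadj x hx
  · rw [hggD x (hPD hx)]
    exact hg.eq_on x hx
  · rw [Finset.inter_comm, hcard Z]
    have h1 := hg.reserve
    rw [Finset.inter_comm] at h1
    have h2 : #(S.filter fun x => g' x ∈ Z) ≤ #({z} : Finset V) := by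
      refine Finset.card_le_card fun x hx => ?_
      obtain ⟨hxS, hxZ⟩ := Finset.mem_filter.1 hx
      rcases (htar' x hxS).2 with ⟨h3, -⟩ | ⟨-, h3⟩ | ⟨-, h3⟩
      · exact Finset.mem_singleton.2 h3
      · exact absurd h3 (Finset.disjoint_left.1 hZX hxZ)
      · exact absurd h3 (Finset.disjoint_left.1 hZY hxZ)
    rw [Finset.card_singleton] at h2
    omega
  · rcases hpair i with ⟨h1, h2⟩ | ⟨h1, h2⟩ | ⟨⟨h1, h2⟩, h3, h4⟩
    · rw [h1, h2, hXc, hYc]; omega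
    · rw [h1, h2, hXc, hYc]; omega
    · rw [hother _ (hZAB i).1 h1 h2, hother _ (hZAB i).2 h3 h4]
      exact hg.left_le i
  · rcases hpair i with ⟨h1, h2⟩ | ⟨h1, h2⟩ | ⟨⟨h1, h2⟩, h3, h4⟩
    · rw [h1, h2, hXc, hYc]; omega
    · rw [h1, h2, hXc, hYc]; omega
    · rw [hother _ (hZAB i).1 h1 h2, hother _ (hZAB i).2 h3 h4]
      exact hg.right_le i

variable [Fintype W]

theorem IsBalancedEmbedding.exists_large_pair {P D : Finset V} {f₀ g : V → W} {Z : Finset W}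
    {A B : Fin k → Finset W} {M j : ℕ} (hg : IsBalancedEmbedding G ρ par P f₀ Z A B M D j g)
    {ε d : ℝ} {h : ℕ} (hAB : IsRegularPairing G ε d h A B)
    (hPAB : ∀ x ∈ P, ∀ i, f₀ x ∉ A i ∧ f₀ x ∉ B i) (hPD : P ⊆ D) (hk : 0 < k) {x₀ : ℝ}
    (hcount : (k : ℝ) * (2 * x₀ + M) + #D ≤ #P + 2 * k * h) :
    ∃ i, x₀ ≤ #(A i \ D.image g) ∧ x₀ ≤ #(B i \ D.image g) := by
  set Q := D.image g with hQ
  have hsub : (Finset.univ.biUnion fun i => A i ∩ Q) ∪ (Finset.univ.biUnion fun i => B i ∩ Q) ⊆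
      (D \ P).image g := by
    intro w hw
    have hw' : ∃ i, (w ∈ A i ∨ w ∈ B i) ∧ w ∈ Q := by
      rcases Finset.mem_union.1 hw with hw | hw
      · obtain ⟨i, -, hi⟩ := Finset.mem_biUnion.1 hw
        exact ⟨i, Or.inl (Finset.mem_inter.1 hi).1, (Finset.mem_inter.1 hi).2⟩
      · obtain ⟨i, -, hi⟩ := Finset.mem_biUnion.1 hw
        exact ⟨i, Or.inr (Finset.mem_inter.1 hi).1, (Finset.mem_inter.1 hi).2⟩
    obtain ⟨i, hi, hwQ⟩ := hw'
    obtain ⟨x, hx, rfl⟩ := Finset.mem_image.1 hwQ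
    refine Finset.mem_image_of_mem _ (Finset.mem_sdiff.2 ⟨hx, fun hxP => ?_⟩)
    rw [hg.eq_on x hxP] at hi
    rcases hi with hi | hi
    · exact (hPAB x hxP i).1 hi
    · exact (hPAB x hxP i).2 hi
  have h1 := (Finset.card_le_card hsub).trans Finset.card_image_le
  rw [Finset.card_union_of_disjoint, Finset.card_biUnion, Finset.card_biUnion,
    Finset.card_sdiff_of_subset hPD] at h1
  · have hcP := Finset.card_le_card hPD
    by_contra! hcon
    have hA : ∀ i, #(A i ∩ Q) + #(A i \ Q) = h := fun i => by
      rw [Finset.card_inter_add_card_sdiff, hAB.card_left]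
    have hB : ∀ i, #(B i ∩ Q) + #(B i \ Q) = h := fun i => by
      rw [Finset.card_inter_add_card_sdiff, hAB.card_right]
    have hlt : ∀ i, 2 * (h : ℝ) - (2 * x₀ + M) < (#(A i ∩ Q) : ℝ) + #(B i ∩ Q) := by
      intro i
      have a1 : (#(A i ∩ Q) : ℝ) + #(A i \ Q) = h := by exact_mod_cast hA i
      have a2 : (#(B i ∩ Q) : ℝ) + #(B i \ Q) = h := by exact_mod_cast hB i
      have a3 : (#(A i ∩ Q) : ℝ) ≤ #(B i ∩ Q) + M := by exact_mod_cast hg.left_le i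
      have a4 : (#(B i ∩ Q) : ℝ) ≤ #(A i ∩ Q) + M := by exact_mod_cast hg.right_le i
      by_cases hx : x₀ ≤ #(A i \ Q)
      · have := hcon i hx
        linarith
      · linarith
    have hne : (Finset.univ : Finset (Fin k)).Nonempty := ⟨⟨0, hk⟩, Finset.mem_univ _⟩
    have hsum := Finset.sum_lt_sum_of_nonempty hne fun i _ => hlt i
    rw [Finset.sum_const, Finset.card_univ, Fintype.card_fin, nsmul_eq_mul,
      Finset.sum_add_distrib] at hsum
    have h2 : (∑ i, #(A i ∩ Q)) + (∑ i, #(B i ∩ Q)) + #P ≤ #D := by omega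
    have h3 : (∑ i, (#(A i ∩ Q) : ℝ)) + (∑ i, (#(B i ∩ Q) : ℝ)) + #P ≤ #D := by exact_mod_cast h2
    linarith
  · intro i _ j _ hij
    exact Finset.disjoint_of_subset_left Finset.inter_subset_left
      (Finset.disjoint_of_subset_right Finset.inter_subset_left (hAB.disjoint_right i j hij))
  · intro i _ j _ hij
    exact Finset.disjoint_of_subset_left Finset.inter_subset_left
      (Finset.disjoint_of_subset_right Finset.inter_subset_left (hAB.disjoint_left i j hij))
  · rw [Finset.disjoint_biUnion_left]
    intro i _
    rw [Finset.disjoint_biUnion_right]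
    intro j _
    exact Finset.disjoint_of_subset_left Finset.inter_subset_left
      (Finset.disjoint_of_subset_right Finset.inter_subset_left (hAB.disjoint i j))

theorem IsBalancedEmbedding.exists_spread_extend (hr : IsRooting T ρ par dep)
    {P D S : Finset V} {f₀ g : V → W} {Z : Finset W} {A B : Fin k → Finset W} {m M j h : ℕ}
    (hg : IsBalancedEmbedding G ρ par P f₀ Z A B M D j g) {ε d c x₀ : ℝ}
    (hAB : IsRegularPairing G ε d h A B) (hZAB : ∀ i, Disjoint Z (A i) ∧ Disjoint Z (B i))
    (hPAB : ∀ x ∈ P, ∀ i, f₀ x ∉ A i ∧ f₀ x ∉ B i) (hPD : P ⊆ D) (hρP : ρ ∈ P)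
    (hparD : ∀ x ∈ D, par x ∈ D) (hDS : Disjoint D S) {z : V} (hpz : par z ∈ D)
    (hS : ∀ x ∈ S, x ≠ z → par x ∈ S) (hSM : #S ≤ M) (hm : 0 < m) (hk : 0 < k)
    (hcount : (k : ℝ) * (2 * x₀ + M) + #D ≤ #P + 2 * k * h) (hd : 0 ≤ d)
    (hc : ∀ u v, c ≤ #(Z ∩ (nbr G u ∩ nbr G v))) (hj : (j : ℝ) ≤ c / 4)
    (hmd : (m + M : ℝ) ≤ d * x₀ - ε * h) (hmc : (m + M : ℝ) ≤ c / 2) (hx₀ : ε * h < x₀)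
    (hmN : 4 * (m + M : ℝ) * Fintype.card W ≤ c * (x₀ - ε * h)) :
    ∃ μ : PMF (V → W), (∀ g' ∈ μ.support, (∀ v, v ∉ S → g' v = g v) ∧
      IsBalancedEmbedding G ρ par P f₀ Z A B M (D ∪ S) (j + 1) g') ∧
      SpreadOn ((m : ℝ≥0∞)⁻¹) S μ := by
  obtain ⟨i, hAi, hBi⟩ := hg.exists_large_pair hAB hPAB hPD hk hcount
  have hρS : ρ ∉ S := Finset.disjoint_left.1 hDS (hPD hρP)
  have hQ : (#(D.image g ∩ Z) : ℝ) ≤ c / 4 := le_trans (by exact_mod_cast hg.reserve) hj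
  have hAe : (#((A i \ D.image g).filter fun x => (#(nbr G x ∩ (B i \ D.image g)) : ℝ)
      < d * #(B i \ D.image g)) : ℝ) ≤ ε * h := by
    refine le_trans ?_ (hAB.regular_left i _ (Finset.sdiff_subset (t := D.image g)) (hx₀.le.trans hBi))
    exact_mod_cast Finset.card_le_card (Finset.filter_subset_filter _ Finset.sdiff_subset)
  have hBe : (#((B i \ D.image g).filter fun x => (#(nbr G x ∩ (A i \ D.image g)) : ℝ)
      < d * #(A i \ D.image g)) : ℝ) ≤ ε * h := by
    refine le_trans ?_ (hAB.regular_right i _ (Finset.sdiff_subset (t := D.image g)) (hx₀.le.trans hAi))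
    exact_mod_cast Finset.card_le_card (Finset.filter_subset_filter _ Finset.sdiff_subset)
  have hab : #(S.filter fun x => x ≠ z ∧ (dep x + dep z) % 2 = 1) +
      #(S.filter fun x => x ≠ z ∧ ¬ (dep x + dep z) % 2 = 1) ≤ M := by
    refine le_trans ?_ hSM
    rw [← Finset.card_union_of_disjoint]
    · exact Finset.card_le_card (Finset.union_subset (Finset.filter_subset _ _)
        (Finset.filter_subset _ _))
    · rw [Finset.disjoint_filter]
      exact fun x _ h1 h2 => h2.2 h1.2
  have hl := hg.left_le i
  have hr' := hg.right_le i
  have hor : ∃ X Y : Finset W, ((X = A i ∧ Y = B i) ∨ (X = B i ∧ Y = A i)) ∧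
      #(X ∩ D.image g) + #(S.filter fun x => x ≠ z ∧ (dep x + dep z) % 2 = 1) ≤
      #(Y ∩ D.image g) + #(S.filter fun x => x ≠ z ∧ ¬ (dep x + dep z) % 2 = 1) + M ∧
      #(Y ∩ D.image g) + #(S.filter fun x => x ≠ z ∧ ¬ (dep x + dep z) % 2 = 1) ≤
      #(X ∩ D.image g) + #(S.filter fun x => x ≠ z ∧ (dep x + dep z) % 2 = 1) + M := by
    by_cases hcase : #(A i ∩ D.image g) + #(S.filter fun x => x ≠ z ∧ (dep x + dep z) % 2 = 1) ≤
      #(B i ∩ D.image g) + #(S.filter fun x => x ≠ z ∧ ¬ (dep x + dep z) % 2 = 1) + M ∧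
      #(B i ∩ D.image g) + #(S.filter fun x => x ≠ z ∧ ¬ (dep x + dep z) % 2 = 1) ≤
      #(A i ∩ D.image g) + #(S.filter fun x => x ≠ z ∧ (dep x + dep z) % 2 = 1) + M
    · exact ⟨A i, B i, Or.inl ⟨rfl, rfl⟩, hcase⟩
    · refine ⟨B i, A i, Or.inr ⟨rfl, rfl⟩, ?_⟩
      omega
  obtain ⟨X, Y, hXY, hb1, hb2⟩ := hor
  have hdisj : Disjoint X Y ∧ Disjoint Z X ∧ Disjoint Z Y := by
    rcases hXY with ⟨rfl, rfl⟩ | ⟨rfl, rfl⟩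
    · exact ⟨hAB.disjoint i i, (hZAB i).1, (hZAB i).2⟩
    · exact ⟨(hAB.disjoint i i).symm, (hZAB i).2, (hZAB i).1⟩
  have hpair : ∀ i', (A i' = X ∧ B i' = Y) ∨ (A i' = Y ∧ B i' = X) ∨
      ((Disjoint (A i') X ∧ Disjoint (A i') Y) ∧ Disjoint (B i') X ∧ Disjoint (B i') Y) := by
    intro i'
    by_cases hii : i' = i
    · subst hii
      rcases hXY with ⟨rfl, rfl⟩ | ⟨rfl, rfl⟩
      · exact Or.inl ⟨rfl, rfl⟩
      · exact Or.inr (Or.inl ⟨rfl, rfl⟩)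
    · have h1 := hAB.disjoint_left i' i hii
      have h2 := hAB.disjoint_right i' i hii
      have h3 := hAB.disjoint i' i
      have h4 := (hAB.disjoint i i').symm
      rcases hXY with ⟨rfl, rfl⟩ | ⟨rfl, rfl⟩
      · exact Or.inr (Or.inr ⟨⟨h1, h3⟩, h4, h2⟩)
      · exact Or.inr (Or.inr ⟨⟨h3, h1⟩, h2, h4⟩)
  obtain ⟨μ, hμ, hsp⟩ : ∃ μ : PMF (V → W), (∀ g' ∈ μ.support, (∀ v, v ∉ S → g' v = g v) ∧
      Set.InjOn g' S ∧ (∀ x ∈ S, G.Adj (g' (par x)) (g' x)) ∧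
      ∀ x ∈ S, g' x ∈ pieceTarget dep z (Z \ D.image g) (X \ D.image g) (Y \ D.image g) x) ∧
      SpreadOn ((m : ℝ≥0∞)⁻¹) S μ := by
    rcases hXY with ⟨rfl, rfl⟩ | ⟨rfl, rfl⟩
    · exact exists_spread_piece_regular hr G hDS hpz hS hρS g hm hSM hAi hBi hd hAe hBe hc hQ hmd
        hmc hx₀ hmN
    · exact exists_spread_piece_regular hr G hDS hpz hS hρS g hm hSM hBi hAi hd hBe hAe hc hQ hmd
        hmc hx₀ hmN
  refine ⟨μ, fun g' hg' => ?_, hsp⟩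
  obtain ⟨h1, h2, h3, h4⟩ := hμ g' hg'
  exact ⟨h1, hg.extend hPD hDS hparD hdisj.1 hdisj.2.1 hdisj.2.2 hpair hZAB hb1 hb2 h1 h2 h3 h4⟩

theorem PieceChain.exists_spread_balanced (hr : IsRooting T ρ par dep) {P D : Finset V}
    {f₀ : V → W} {Z : Finset W} {A B : Fin k → Finset W} {m M j h : ℕ}
    (hch : PieceChain par P M j D) {ε d c x₀ : ℝ}
    (hAB : IsRegularPairing G ε d h A B) (hZAB : ∀ i, Disjoint Z (A i) ∧ Disjoint Z (B i))
    (hPAB : ∀ x ∈ P, ∀ i, f₀ x ∉ A i ∧ f₀ x ∉ B i) (hPZ : ∀ x ∈ P, f₀ x ∉ Z) (hρP : ρ ∈ P)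
    (hinj : Set.InjOn f₀ P) (hadj : ∀ x ∈ P, x ≠ ρ → G.Adj (f₀ (par x)) (f₀ x))
    (hparP : ∀ x ∈ P, par x ∈ P) (hm : 0 < m) (hk : 0 < k)
    (hcount : (k : ℝ) * (2 * x₀ + M) + #D ≤ #P + 2 * k * h) (hd : 0 ≤ d)
    (hc : ∀ u v, c ≤ #(Z ∩ (nbr G u ∩ nbr G v))) (hj : (j : ℝ) ≤ c / 4)
    (hmd : (m + M : ℝ) ≤ d * x₀ - ε * h) (hmc : (m + M : ℝ) ≤ c / 2) (hx₀ : ε * h < x₀)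
    (hmN : 4 * (m + M : ℝ) * Fintype.card W ≤ c * (x₀ - ε * h)) :
    ∃ μ : PMF (V → W), (∀ g ∈ μ.support, IsBalancedEmbedding G ρ par P f₀ Z A B M D j g) ∧
      SpreadOn ((m : ℝ≥0∞)⁻¹) (D \ P) μ := by
  induction hch with
  | base =>
    refine ⟨PMF.pure f₀, fun g hg => ?_, fun J hJ y => ?_⟩
    · rw [PMF.support_pure, Set.mem_singleton_iff] at hg
      subst hg
      have hemp : ∀ R : Finset W, (∀ x ∈ P, g x ∉ R) → #(R ∩ P.image g) = 0 := by
        intro R hR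
        rw [Finset.card_eq_zero, ← Finset.disjoint_iff_inter_eq_empty, Finset.disjoint_right]
        intro w hw
        obtain ⟨x, hx, rfl⟩ := Finset.mem_image.1 hw
        exact hR x hx
      refine ⟨hinj, hadj, fun _ _ => rfl, ?_, fun i => ?_, fun i => ?_⟩
      · rw [Finset.inter_comm, hemp Z hPZ]
      · rw [hemp (A i) fun x hx => (hPAB x hx i).1]; exact Nat.zero_le _
      · rw [hemp (B i) fun x hx => (hPAB x hx i).2]; exact Nat.zero_le _
    · rw [Finset.sdiff_self, Finset.subset_empty] at hJ
      subst hJ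
      rw [Finset.card_empty, pow_zero]
      exact pmf_toOuterMeasure_le_one _ _
  | @step j D S z hch hDS hz hpz hS hSM ih =>
    have hcardle : (#D : ℝ) ≤ #(D ∪ S) := by
      exact_mod_cast Finset.card_le_card Finset.subset_union_left
    have hj' : (j : ℝ) ≤ c / 4 := by
      push_cast at hj
      linarith
    obtain ⟨μ, hμ, hsp⟩ := ih (by linarith) hj'
    have hPD := hch.subset
    have hκ : ∀ g : V → W, ∃ κ : PMF (V → W), g ∈ μ.support →
        (∀ g' ∈ κ.support, (∀ v, v ∉ S → g' v = g v) ∧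
        IsBalancedEmbedding G ρ par P f₀ Z A B M (D ∪ S) (j + 1) g') ∧
        SpreadOn ((m : ℝ≥0∞)⁻¹) S κ := by
      intro g
      by_cases hg : g ∈ μ.support
      · obtain ⟨κ, h1, h2⟩ := (hμ g hg).exists_spread_extend hr hAB hZAB hPAB hPD hρP
          (hch.par_mem hparP) hDS hpz hS hSM hm hk (by linarith) hd hc hj' hmd hmc hx₀ hmN
        exact ⟨κ, fun _ => ⟨h1, h2⟩⟩
      · exact ⟨PMF.pure g, fun h => absurd h hg⟩
    choose κ hκ using hκ
    refine ⟨μ.bind κ, fun g' hg' => ?_, hsp.bind κ fun g hg => ⟨fun g' hg' v hv => ?_, ?_⟩⟩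
    · rw [PMF.mem_support_bind_iff] at hg'
      obtain ⟨g, hg, hg'⟩ := hg'
      exact ((hκ g hg).1 g' hg').2
    · exact ((hκ g hg).1 g' hg').1 v (Finset.disjoint_left.1 hDS (Finset.mem_sdiff.1 hv).1)
    · have : ((D ∪ S) \ P) \ (D \ P) = S := by
        ext v
        simp only [Finset.mem_sdiff, Finset.mem_union]
        have h1 : v ∈ P → v ∈ D := fun h => hPD h
        have h2 : v ∈ D → v ∉ S := fun h => Finset.disjoint_left.1 hDS h
        tauto
      rw [this]
      exact (hκ g hg).2

end Balanced

section Absorb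

variable {V W : Type*} {T : SimpleGraph V} {ρ : V} {par : V → V} {dep : V → ℕ}

/-- The map that sends `ℓ ∈ Λ` to `g (τ ℓ)`, each `τ ℓ` to `σ ℓ`, and any other vertex `v` to
`g v`. -/
def absorb (Λ : Finset V) (g σ : V → W) (τ : V → V) (v : V) : W :=
  if v ∈ Λ then g (τ v) else if hv : ∃ ℓ ∈ Λ, τ ℓ = v then σ hv.choose else g v

/-- The image of the parent of a vertex of `Λ` after absorption. -/
def parentImage (Λ : Finset V) (g : V → W) (τ : V → V) (p : V) : W :=
  if p ∈ Λ then g (τ p) else g p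

/-- `τ` assigns to each vertex of `Λ` its own switching vertex of `B`. -/
structure IsSwitching [Fintype V] (T : SimpleGraph V) (par : V → V) (G : SimpleGraph W)
    (B Λ : Finset V) (g σ : V → W) (τ : V → V) (D : Finset V) : Prop where
  injOn : Set.InjOn τ D
  par_mem : ∀ ℓ ∈ D, par ℓ ∈ Λ → par ℓ ∈ D
  mem : ∀ ℓ ∈ D, τ ℓ ∈ B
  adj_par : ∀ ℓ ∈ D, G.Adj (parentImage Λ g τ (par ℓ)) (g (τ ℓ))
  adj_nbr : ∀ ℓ ∈ D, ∀ s ∈ nbr T (τ ℓ), G.Adj (σ ℓ) (g s)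

theorem absorb_of_mem {Λ : Finset V} {g σ : V → W} {τ : V → V} {v : V} (hv : v ∈ Λ) :
    absorb Λ g σ τ v = g (τ v) := if_pos hv

theorem absorb_apply_switch {Λ : Finset V} {g σ : V → W} {τ : V → V} (hτ : Set.InjOn τ Λ) {ℓ : V}
    (hℓ : ℓ ∈ Λ) (hτℓ : τ ℓ ∉ Λ) : absorb Λ g σ τ (τ ℓ) = σ ℓ := by
  have hex : ∃ ℓ' ∈ Λ, τ ℓ' = τ ℓ := ⟨ℓ, hℓ, rfl⟩
  unfold absorb
  rw [if_neg hτℓ, dif_pos hex]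
  exact congrArg σ (hτ hex.choose_spec.1 hℓ hex.choose_spec.2)

theorem absorb_of_not_mem {Λ : Finset V} {g σ : V → W} {τ : V → V} {v : V} (hv : v ∉ Λ)
    (hv' : ∀ ℓ ∈ Λ, τ ℓ ≠ v) : absorb Λ g σ τ v = g v := by
  unfold absorb
  rw [if_neg hv, dif_neg]
  rintro ⟨ℓ, h1, h2⟩
  exact hv' ℓ h1 h2

variable [Fintype V]

theorem absorb_adj (hr : IsRooting T ρ par dep) {G : SimpleGraph W} {B Λ : Finset V}
    {g σ : V → W} {τ : V → V} (hadj : ∀ x, x ∉ Λ → x ≠ ρ → G.Adj (g (par x)) (g x))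
    (hpar : ∀ x, x ∉ Λ → par x ∉ Λ) (hBΛ : ∀ b ∈ B, ∀ x ∈ insert b (nbr T b), x ∉ Λ)
    (hdisj : ∀ b ∈ B, ∀ c ∈ B, ∀ x ∈ insert b (nbr T b), x ∈ insert c (nbr T c) → b = c)
    (hτ : IsSwitching T par G B Λ g σ τ Λ) {a b : V} (hab : T.Adj a b) :
    G.Adj (absorb Λ g σ τ a) (absorb Λ g σ τ b) := by
  have hτΛ : ∀ ℓ ∈ Λ, τ ℓ ∉ Λ := fun ℓ hℓ => hBΛ _ (hτ.mem ℓ hℓ) _ (Finset.mem_insert_self _ _)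
  have hnbr : ∀ {b x}, T.Adj b x → x ∈ insert b (nbr T b) := fun h =>
    Finset.mem_insert_of_mem (mem_nbr.2 h)
  have key : ∀ x, x ≠ ρ → G.Adj (absorb Λ g σ τ (par x)) (absorb Λ g σ τ x) := by
    intro x hxρ
    have hTadj : T.Adj x (par x) := (hr.adj_iff _ _).2 (Or.inl ⟨hxρ, rfl⟩)
    by_cases hx : x ∈ Λ
    · rw [absorb_of_mem hx]
      have h1 := hτ.adj_par x hx
      unfold parentImage at h1
      by_cases hp : par x ∈ Λ
      · rw [absorb_of_mem hp]
        rwa [if_pos hp] at h1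
      · rw [if_neg hp] at h1
        rw [absorb_of_not_mem hp]
        · exact h1
        · intro ℓ hℓ heq
          exact hBΛ _ (hτ.mem ℓ hℓ) x (hnbr (heq ▸ hTadj.symm)) hx
    · have hp := hpar x hx
      by_cases hx' : ∃ ℓ ∈ Λ, τ ℓ = x
      · obtain ⟨ℓ, hℓ, rfl⟩ := hx'
        rw [absorb_apply_switch hτ.injOn hℓ hx, absorb_of_not_mem hp]
        · exact (hτ.adj_nbr ℓ hℓ _ (mem_nbr.2 hTadj)).symm
        · intro ℓ' hℓ' heq
          have := hdisj _ (hτ.mem ℓ hℓ) _ (hτ.mem ℓ' hℓ') (par (τ ℓ)) (hnbr hTadj)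
            (heq ▸ Finset.mem_insert_self _ _)
          rw [← heq, this] at hTadj
          exact hTadj.ne rfl
      · push Not at hx'
        rw [absorb_of_not_mem hx hx']
        by_cases hp' : ∃ ℓ ∈ Λ, τ ℓ = par x
        · obtain ⟨ℓ, hℓ, heq⟩ := hp'
          rw [← heq, absorb_apply_switch hτ.injOn hℓ (hτΛ ℓ hℓ)]
          exact hτ.adj_nbr ℓ hℓ _ (mem_nbr.2 (heq ▸ hTadj.symm))
        · push Not at hp'
          rw [absorb_of_not_mem hp hp']
          exact hadj x hx hxρ
  rcases (hr.adj_iff _ _).1 hab with ⟨h1, rfl⟩ | ⟨h1, rfl⟩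
  · exact (key a h1).symm
  · exact key b h1

theorem exists_spread_switching (hr : IsRooting T ρ par dep) {G : SimpleGraph W} {B Λ : Finset V}
    {g : V → W} (σ : V → W) (hρ : ρ ∉ Λ) {m t : ℕ} (hm : 0 < m) (hmt : m + #Λ ≤ t)
    (hstar : ∀ u v, t ≤ #(B.filter fun b => G.Adj u (g b) ∧ ∀ s ∈ nbr T b, G.Adj v (g s))) :
    ∃ μ : PMF (V → V), (∀ τ ∈ μ.support, IsSwitching T par G B Λ g σ τ Λ) ∧
      SpreadOn ((m : ℝ≥0∞)⁻¹) Λ μ := by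
  have step : ∀ D ⊆ Λ, D ≠ Λ → ∀ τ, IsSwitching T par G B Λ g σ τ D → ∃ x ∈ Λ, x ∉ D ∧
      ∃ A : Finset V, m ≤ #A ∧
      (∀ c ∈ A, IsSwitching T par G B Λ g σ (Function.update τ x c) (insert x D)) ∧
      ∑ c ∈ A, (0 : ℝ≥0∞) ≤ #A * 0 := by
    intro D hD hne τ hτ
    have hex : (Λ \ D).Nonempty := by
      rw [Finset.nonempty_iff_ne_empty]
      intro h0
      exact hne (hD.antisymm (Finset.sdiff_eq_empty_iff_subset.1 h0))
    obtain ⟨x, hx, hmin⟩ := Finset.exists_min_image _ dep hex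
    obtain ⟨hxΛ, hxD⟩ := Finset.mem_sdiff.1 hx
    have hdx := hr.dep_par x (ne_of_mem_of_not_mem hxΛ hρ)
    have hpar : par x ∈ Λ → par x ∈ D := by
      intro hp
      by_contra hcon
      have := hmin (par x) (Finset.mem_sdiff.2 ⟨hp, hcon⟩)
      omega
    have hparx : par x ≠ x := fun heq => by rw [heq] at hdx; omega
    set A := B.filter fun b => G.Adj (parentImage Λ g τ (par x)) (g b) ∧
      ∀ s ∈ nbr T b, G.Adj (σ x) (g s) with hA
    refine ⟨x, hxΛ, hxD, A \ D.image τ, ?_, ?_, by simp⟩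
    · have h0 : t ≤ #A := by convert hstar (parentImage Λ g τ (par x)) (σ x)
      have h1 := Finset.le_card_sdiff (D.image τ) A
      have h2 : #(D.image τ) ≤ #D := Finset.card_image_le
      have h3 := Finset.card_le_card hD
      omega
    · intro c hc
      obtain ⟨hcA, hcD⟩ := Finset.mem_sdiff.1 hc
      obtain ⟨hcB, hc1, hc2⟩ := Finset.mem_filter.1 hcA
      have hupd : ∀ y ∈ D, Function.update τ x c y = τ y := fun y hy =>
        Function.update_of_ne (ne_of_mem_of_not_mem hy hxD) _ _
      have hpim : ∀ p, p ≠ x → parentImage Λ g (Function.update τ x c) p = parentImage Λ g τ p := by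
        intro p hp
        unfold parentImage
        rw [Function.update_of_ne hp]
      refine ⟨?_, ?_, ?_, ?_, ?_⟩
      · intro a ha b hb hab
        rw [Finset.coe_insert] at ha hb
        rcases ha with rfl | ha <;> rcases hb with rfl | hb
        · rfl
        · rw [Function.update_self, hupd b hb] at hab
          exact absurd (Finset.mem_image.2 ⟨b, hb, hab.symm⟩) hcD
        · rw [Function.update_self, hupd a ha] at hab
          exact absurd (Finset.mem_image.2 ⟨a, ha, hab⟩) hcD
        · rw [hupd a ha, hupd b hb] at hab
          exact hτ.injOn ha hb hab
      · intro y hy hyp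
        rcases Finset.mem_insert.1 hy with rfl | hy
        · exact Finset.mem_insert_of_mem (hpar hyp)
        · exact Finset.mem_insert_of_mem (hτ.par_mem y hy hyp)
      · intro y hy
        rcases Finset.mem_insert.1 hy with rfl | hy
        · rwa [Function.update_self]
        · rw [hupd y hy]; exact hτ.mem y hy
      · intro y hy
        rcases Finset.mem_insert.1 hy with rfl | hy
        · rw [Function.update_self, hpim _ hparx]; exact hc1
        · have : par y ≠ x := fun heq => hxD (heq ▸ hτ.par_mem y hy (heq ▸ hxΛ))
          rw [hupd y hy, hpim _ this]
          exact hτ.adj_par y hy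
      · intro y hy
        rcases Finset.mem_insert.1 hy with rfl | hy
        · rw [Function.update_self]; exact hc2
        · rw [hupd y hy]; exact hτ.adj_nbr y hy
  obtain ⟨μ, hμ, hsp, -⟩ := exists_spread_process m hm Λ
    (fun D τ => IsSwitching T par G B Λ g σ τ D) (fun _ _ => 0) step ∅
    (Finset.empty_subset _) id ⟨by simp, by simp, by simp, by simp, by simp⟩
  exact ⟨μ, fun τ hτ => (hμ τ hτ).1, by simpa using hsp⟩

theorem SpreadOn.bind_of_indicator {Λ : Finset V} {q : ℝ≥0∞} {μ : PMF (V → W)}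
    (hμ : SpreadOn q (Finset.univ \ Λ) μ) (κ : (V → W) → PMF (V → W))
    (hκ : ∀ g ∈ μ.support, ∀ (S : Finset V) (y : V → W), ∃ C ⊆ S \ Λ,
      (κ g).toOuterMeasure (agreeSet S y) ≤ (agreeSet C y).indicator (fun _ => q ^ #(S \ C)) g) :
    SpreadOn (2 * q) Finset.univ (μ.bind κ) := by
  intro S _ y
  rw [PMF.toOuterMeasure_bind_apply]
  calc ∑' g, μ g * (κ g).toOuterMeasure (agreeSet S y)
      ≤ ∑' g, ∑ C ∈ (S \ Λ).powerset, μ g * (agreeSet C y).indicator (fun _ => q ^ #(S \ C)) g := by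
        refine ENNReal.tsum_le_tsum fun g => ?_
        by_cases hg : g ∈ μ.support
        · obtain ⟨C, hC, hle⟩ := hκ g hg S y
          refine (mul_le_mul_right hle _).trans ?_
          exact Finset.single_le_sum (f := fun C => μ g * (agreeSet C y).indicator
            (fun _ => q ^ #(S \ C)) g) (fun _ _ => zero_le) (Finset.mem_powerset.2 hC)
        · rw [PMF.mem_support_iff, not_not] at hg
          rw [hg, zero_mul]
          exact zero_le
    _ = ∑ C ∈ (S \ Λ).powerset, ∑' g, μ g * (agreeSet C y).indicator (fun _ => q ^ #(S \ C)) g :=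
        Summable.tsum_finsetSum fun _ _ => ENNReal.summable
    _ ≤ ∑ C ∈ (S \ Λ).powerset, q ^ #S := by
        refine Finset.sum_le_sum fun C hC => ?_
        have hCS := Finset.mem_powerset.1 hC
        rw [pmf_tsum_mul_indicator]
        have h1 := hμ C (hCS.trans (Finset.sdiff_subset_sdiff (Finset.subset_univ _)
          Finset.Subset.rfl)) y
        refine (mul_le_mul_left h1 _).trans (le_of_eq ?_)
        rw [← pow_add, Finset.card_sdiff_of_subset (hCS.trans Finset.sdiff_subset)]
        congr 1
        have := Finset.card_le_card (hCS.trans Finset.sdiff_subset)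
        omega
    _ ≤ (2 * q) ^ #S := by
        rw [Finset.sum_const, Finset.card_powerset, nsmul_eq_mul, mul_pow]
        refine mul_le_mul_left ?_ _
        push_cast
        exact pow_le_pow_right₀ one_le_two (Finset.card_le_card Finset.sdiff_subset)

variable [Fintype W]

/-- The vertices of the host not used by `g` outside `Λ`. -/
def leftover (Λ : Finset V) (g : V → W) : Finset W := Finset.univ \ (Finset.univ \ Λ).image g

theorem mem_leftover {Λ : Finset V} {g : V → W} {w : W} :
    w ∈ leftover Λ g ↔ ∀ v, v ∉ Λ → g v ≠ w := by
  simp [leftover]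

theorem card_leftover {Λ : Finset V} {g : V → W} (hg : Set.InjOn g {v | v ∉ Λ})
    (hVW : Fintype.card V = Fintype.card W) : #Λ = #(leftover Λ g) := by
  unfold leftover
  rw [Finset.card_univ_sdiff, Finset.card_image_of_injOn, Finset.card_univ_sdiff, hVW]
  · have := Finset.card_le_univ Λ
    omega
  · intro a ha b hb hab
    have ha' : a ∉ Λ := by simpa using ha
    have hb' : b ∉ Λ := by simpa using hb
    exact hg ha' hb' hab

theorem absorb_injective {G : SimpleGraph W} {B Λ : Finset V} {g σ : V → W} {τ : V → V}
    (hg : Set.InjOn g {v | v ∉ Λ}) (hBΛ : ∀ b ∈ B, b ∉ Λ) (hσ : Set.InjOn σ Λ)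
    (hσL : ∀ ℓ ∈ Λ, σ ℓ ∈ leftover Λ g) (hτ : IsSwitching T par G B Λ g σ τ Λ) :
    Function.Injective (absorb Λ g σ τ) := by
  have hτΛ : ∀ ℓ ∈ Λ, τ ℓ ∉ Λ := fun ℓ hℓ => hBΛ _ (hτ.mem ℓ hℓ)
  have hcase : ∀ v, (v ∈ Λ) ∨ (∃ ℓ ∈ Λ, τ ℓ = v) ∨ (v ∉ Λ ∧ ∀ ℓ ∈ Λ, τ ℓ ≠ v) := by
    intro v
    by_cases h1 : v ∈ Λ
    · exact Or.inl h1
    by_cases h2 : ∃ ℓ ∈ Λ, τ ℓ = v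
    · exact Or.inr (Or.inl h2)
    · push Not at h2
      exact Or.inr (Or.inr ⟨h1, h2⟩)
  have key : ∀ a b, absorb Λ g σ τ a = absorb Λ g σ τ b → ((a ∈ Λ ∧ b ∉ Λ) → False) ∧
      (((∃ ℓ ∈ Λ, τ ℓ = a) ∧ (b ∉ Λ ∧ ∀ ℓ ∈ Λ, τ ℓ ≠ b)) → False) := by
    intro a b hab
    constructor
    · rintro ⟨ha, hb⟩
      rw [absorb_of_mem ha] at hab
      rcases hcase b with hb' | ⟨ℓ, hℓ, rfl⟩ | ⟨-, hb'⟩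
      · exact hb hb'
      · rw [absorb_apply_switch hτ.injOn hℓ hb] at hab
        exact mem_leftover.1 (hσL ℓ hℓ) _ (hτΛ a ha) hab
      · rw [absorb_of_not_mem hb hb'] at hab
        exact hb' a ha (hg (hτΛ a ha) hb hab)
    · rintro ⟨⟨ℓ, hℓ, rfl⟩, hb, hb'⟩
      rw [absorb_apply_switch hτ.injOn hℓ (hτΛ ℓ hℓ), absorb_of_not_mem hb hb'] at hab
      exact mem_leftover.1 (hσL ℓ hℓ) _ hb hab.symm
  intro a b hab
  rcases hcase a with ha | ha | ha <;> rcases hcase b with hb | hb | hb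
  · rw [absorb_of_mem ha, absorb_of_mem hb] at hab
    exact hτ.injOn ha hb (hg (hτΛ a ha) (hτΛ b hb) hab)
  · obtain ⟨ℓ, hℓ, rfl⟩ := hb
    exact ((key _ _ hab).1 ⟨ha, hτΛ ℓ hℓ⟩).elim
  · exact ((key _ _ hab).1 ⟨ha, hb.1⟩).elim
  · obtain ⟨ℓ, hℓ, rfl⟩ := ha
    exact ((key _ _ hab.symm).1 ⟨hb, hτΛ ℓ hℓ⟩).elim
  · obtain ⟨ℓ, hℓ, rfl⟩ := ha
    obtain ⟨ℓ', hℓ', rfl⟩ := hb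
    rw [absorb_apply_switch hτ.injOn hℓ (hτΛ ℓ hℓ),
      absorb_apply_switch hτ.injOn hℓ' (hτΛ ℓ' hℓ')] at hab
    rw [hσ hℓ hℓ' hab]
  · exact ((key _ _ hab).2 ⟨ha, hb⟩).elim
  · exact ((key _ _ hab.symm).1 ⟨hb, ha.1⟩).elim
  · exact ((key _ _ hab.symm).2 ⟨hb, ha⟩).elim
  · rw [absorb_of_not_mem ha.1 ha.2, absorb_of_not_mem hb.1 hb.2] at hab
    exact hg ha.1 hb.1 hab

theorem switching_event_le {G : SimpleGraph W} {B Λ : Finset V} {g σ : V → W}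
    (hg : Set.InjOn g {v | v ∉ Λ}) (hBΛ : ∀ b ∈ B, b ∉ Λ) (hσ : Set.InjOn σ Λ)
    (hσL : ∀ ℓ ∈ Λ, σ ℓ ∈ leftover Λ g) {μ : PMF (V → V)} {q : ℝ≥0∞}
    (hμ : ∀ τ ∈ μ.support, IsSwitching T par G B Λ g σ τ Λ) (hsp : SpreadOn q Λ μ)
    (S : Finset V) (y : V → W) {Sa Sb Sc N : Finset V} {y' : V → W}
    (hSa : Sa = S.filter fun x => x ∈ Λ)
    (hSb : Sb = S.filter fun x => x ∉ Λ ∧ y x ∈ leftover Λ g)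
    (hSc : Sc = S.filter fun x => x ∉ Λ ∧ y x ∉ leftover Λ g)
    (hN : N = Sa.filter fun ℓ => ∃ x ∈ Sb, g x = y ℓ)
    (hy' : ∀ ℓ ∈ N, ∃ x ∈ Sb, g x = y ℓ ∧ y' ℓ = y x)
    (hne : μ.toOuterMeasure {τ | absorb Λ g σ τ ∈ agreeSet S y} ≠ 0) :
    g ∈ agreeSet Sc y ∧ σ ∈ agreeSet N y' ∧
      μ.toOuterMeasure {τ | absorb Λ g σ τ ∈ agreeSet S y} ≤ q ^ (#Sa + #Sb - #N) := by
  have hτΛ : ∀ τ ∈ μ.support, ∀ ℓ ∈ Λ, τ ℓ ∉ Λ := fun τ hτ ℓ hℓ => hBΛ _ ((hμ τ hτ).mem ℓ hℓ)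
  have hsw : ∀ τ ∈ μ.support, ∀ ℓ ∈ Λ, absorb Λ g σ τ (τ ℓ) = σ ℓ := fun τ hτ ℓ hℓ =>
    absorb_apply_switch (hμ τ hτ).injOn hℓ (hτΛ τ hτ ℓ hℓ)
  have hev_b : ∀ τ ∈ μ.support, absorb Λ g σ τ ∈ agreeSet S y → ∀ x ∈ Sb, ∃ ℓ ∈ Λ, τ ℓ = x ∧
      σ ℓ = y x := by
    intro τ hτ hev x hx
    rw [hSb] at hx
    obtain ⟨hxS, hxΛ, hxL⟩ := Finset.mem_filter.1 hx
    have h1 : absorb Λ g σ τ x = y x := hev x hxS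
    by_cases hex : ∃ ℓ ∈ Λ, τ ℓ = x
    · obtain ⟨ℓ, hℓ, rfl⟩ := hex
      exact ⟨ℓ, hℓ, rfl, by rw [← h1, hsw τ hτ ℓ hℓ]⟩
    · push Not at hex
      rw [absorb_of_not_mem hxΛ hex] at h1
      exact absurd h1 (mem_leftover.1 hxL x hxΛ)
  have hSaΛ : ∀ ℓ ∈ Sa, ℓ ∈ S ∧ ℓ ∈ Λ := fun ℓ hℓ => by
    rw [hSa] at hℓ
    exact Finset.mem_filter.1 hℓ
  have hSbΛ : ∀ x ∈ Sb, x ∈ S ∧ x ∉ Λ := fun x hx => by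
    rw [hSb] at hx
    exact ⟨(Finset.mem_filter.1 hx).1, (Finset.mem_filter.1 hx).2.1⟩
  have hev_a : ∀ τ ∈ μ.support, absorb Λ g σ τ ∈ agreeSet S y → ∀ ℓ ∈ Sa, g (τ ℓ) = y ℓ := by
    intro τ hτ hev ℓ hℓ
    rw [← absorb_of_mem (hSaΛ ℓ hℓ).2 (g := g) (σ := σ) (τ := τ)]
    exact hev ℓ (hSaΛ ℓ hℓ).1
  rw [Ne, PMF.toOuterMeasure_apply_eq_zero_iff, Set.not_disjoint_iff] at hne
  obtain ⟨τ₀, hτ₀, hev₀⟩ := hne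
  have hev₀ : absorb Λ g σ τ₀ ∈ agreeSet S y := hev₀
  set K := Λ.filter fun ℓ => τ₀ ℓ ∈ Sb with hK
  have hKcard : #K = #Sb := by
    rw [← Finset.card_image_of_injOn (f := τ₀) (s := K)]
    · congr 1
      ext x
      rw [Finset.mem_image]
      constructor
      · rintro ⟨ℓ, hℓ, rfl⟩
        exact (Finset.mem_filter.1 hℓ).2
      · intro hx
        obtain ⟨ℓ, hℓ, rfl, -⟩ := hev_b τ₀ hτ₀ hev₀ x hx
        exact ⟨ℓ, Finset.mem_filter.2 ⟨hℓ, hx⟩, rfl⟩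
    · intro a ha b hb hab
      exact (hμ τ₀ hτ₀).injOn (Finset.mem_filter.1 ha).1 (Finset.mem_filter.1 hb).1 hab
  have hKσ : ∀ ℓ ∈ K, σ ℓ = y (τ₀ ℓ) := by
    intro ℓ hℓ
    obtain ⟨h1, h2⟩ := Finset.mem_filter.1 hℓ
    rw [← hsw τ₀ hτ₀ ℓ h1]
    exact hev₀ _ (hSbΛ _ h2).1
  have hNK : N = Sa ∩ K := by
    ext ℓ
    rw [hN, Finset.mem_filter, Finset.mem_inter, hK, Finset.mem_filter]
    constructor
    · rintro ⟨h1, x, hx, hxy⟩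
      have hΛ := (hSaΛ ℓ h1).2
      refine ⟨h1, hΛ, ?_⟩
      have : τ₀ ℓ = x := by
        refine hg (hτΛ τ₀ hτ₀ ℓ hΛ) (hSbΛ x hx).2 ?_
        rw [hxy, hev_a τ₀ hτ₀ hev₀ ℓ h1]
      rwa [this]
    · rintro ⟨h1, h2, h3⟩
      exact ⟨h1, τ₀ ℓ, h3, hev_a τ₀ hτ₀ hev₀ ℓ h1⟩
  refine ⟨fun x hx => ?_, fun ℓ hℓ => ?_, ?_⟩
  · rw [hSc] at hx
    obtain ⟨hxS, hxΛ, hxL⟩ := Finset.mem_filter.1 hx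
    have h1 : absorb Λ g σ τ₀ x = y x := hev₀ x hxS
    rw [← h1, absorb_of_not_mem hxΛ]
    rintro ℓ hℓ rfl
    rw [hsw τ₀ hτ₀ ℓ hℓ] at h1
    exact hxL (h1 ▸ hσL ℓ hℓ)
  · obtain ⟨x, hx, hgx, hyx⟩ := hy' ℓ hℓ
    rw [hNK] at hℓ
    obtain ⟨h1, h2⟩ := Finset.mem_inter.1 hℓ
    rw [hyx, hKσ ℓ h2]
    congr 1
    refine hg (hτΛ τ₀ hτ₀ ℓ (hSaΛ ℓ h1).2) (hSbΛ x hx).2 ?_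
    rw [hgx, hev_a τ₀ hτ₀ hev₀ ℓ h1]
  · have hJ : #(Sa ∪ K) = #Sa + #Sb - #N := by
      have := Finset.card_union_add_card_inter Sa K
      rw [← hNK, hKcard] at this
      omega
    rw [← hJ]
    refine le_trans ?_ (hsp (Sa ∪ K) (Finset.union_subset (fun ℓ hℓ => (hSaΛ ℓ hℓ).2)
      (Finset.filter_subset _ _)) τ₀)
    refine pmf_toOuterMeasure_mono_support _ fun τ hτ hev ℓ hℓ => ?_
    have hev : absorb Λ g σ τ ∈ agreeSet S y := hev
    rcases Finset.mem_union.1 hℓ with hℓ | hℓ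
    · refine hg (hτΛ τ hτ ℓ (hSaΛ ℓ hℓ).2) (hτΛ τ₀ hτ₀ ℓ (hSaΛ ℓ hℓ).2) ?_
      rw [hev_a τ hτ hev ℓ hℓ, hev_a τ₀ hτ₀ hev₀ ℓ hℓ]
    · obtain ⟨h1, h2⟩ := Finset.mem_filter.1 hℓ
      obtain ⟨ℓ', hℓ', h3, h4⟩ := hev_b τ hτ hev _ h2
      have : ℓ' = ℓ := hσ hℓ' h1 (by rw [h4, hKσ ℓ hℓ])
      rw [← h3, this]

theorem exists_spread_absorb (hr : IsRooting T ρ par dep) {G : SimpleGraph W} {B Λ : Finset V}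
    {g : V → W} (hVW : Fintype.card V = Fintype.card W) (hg : Set.InjOn g {v | v ∉ Λ})
    (hadj : ∀ x, x ∉ Λ → x ≠ ρ → G.Adj (g (par x)) (g x))
    (hpar : ∀ x, x ∉ Λ → par x ∉ Λ) (hBΛ : ∀ b ∈ B, ∀ x ∈ insert b (nbr T b), x ∉ Λ)
    (hdisj : ∀ b ∈ B, ∀ c ∈ B, ∀ x ∈ insert b (nbr T b), x ∈ insert c (nbr T c) → b = c)
    (hρ : ρ ∉ Λ) {m t : ℕ} (hm : 0 < m) (hmt : m + #Λ ≤ t)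
    (hstar : ∀ u v, t ≤ #(B.filter fun b => G.Adj u (g b) ∧ ∀ s ∈ nbr T b, G.Adj v (g s)))
    {q : ℝ≥0∞} (hq₁ : (m : ℝ≥0∞)⁻¹ ≤ q) (hq₂ : 9 * (#Λ : ℝ≥0∞)⁻¹ ≤ q) :
    ∃ κ : PMF (V → W), (∀ f ∈ κ.support, Function.Injective f ∧
        ∀ a b, T.Adj a b → G.Adj (f a) (f b)) ∧
      ∀ (S : Finset V) (y : V → W), ∃ C ⊆ S \ Λ,
        κ.toOuterMeasure (agreeSet S y) ≤ (agreeSet C y).indicator (fun _ => q ^ #(S \ C)) g := by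
  have hBΛ' : ∀ b ∈ B, b ∉ Λ := fun b hb => hBΛ b hb b (Finset.mem_insert_self _ _)
  obtain ⟨μ, hμ, hμsp⟩ := exists_spread_bijection g Λ (leftover Λ g) (card_leftover hg hVW)
  choose ν hν hνsp using fun σ : V → W => exists_spread_switching (T := T) (G := G) hr σ hρ hm hmt hstar
  have hνsp' : ∀ σ, SpreadOn q Λ (ν σ) := fun σ => (hνsp σ).mono hq₁
  have hμsp' : SpreadOn q Λ μ := hμsp.mono hq₂
  refine ⟨μ.bind fun σ => (ν σ).map (absorb Λ g σ), fun f hf => ?_, fun S y => ?_⟩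
  · rw [PMF.mem_support_bind_iff] at hf
    obtain ⟨σ, hσ, hf⟩ := hf
    rw [PMF.mem_support_map_iff] at hf
    obtain ⟨τ, hτ, rfl⟩ := hf
    obtain ⟨-, h1, h2⟩ := hμ σ hσ
    exact ⟨absorb_injective hg hBΛ' h1 h2 (hν σ τ hτ),
      fun a b hab => absorb_adj hr hadj hpar hBΛ hdisj (hν σ τ hτ) hab⟩
  set Sa := S.filter fun x => x ∈ Λ with hSa
  set Sb := S.filter fun x => x ∉ Λ ∧ y x ∈ leftover Λ g with hSb
  set Sc := S.filter fun x => x ∉ Λ ∧ y x ∉ leftover Λ g with hSc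
  set N := Sa.filter fun ℓ => ∃ x ∈ Sb, g x = y ℓ with hN
  set y' : V → W := fun ℓ => if hex : ∃ x ∈ Sb, g x = y ℓ then y hex.choose else y ℓ with hy'def
  have hy' : ∀ ℓ ∈ N, ∃ x ∈ Sb, g x = y ℓ ∧ y' ℓ = y x := by
    intro ℓ hℓ
    have hex := (Finset.mem_filter.1 hℓ).2
    refine ⟨hex.choose, hex.choose_spec.1, hex.choose_spec.2, ?_⟩
    rw [hy'def]
    exact dif_pos hex
  refine ⟨Sc, fun x hx => ?_, ?_⟩
  · obtain ⟨h1, h2, -⟩ := Finset.mem_filter.1 hx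
    exact Finset.mem_sdiff.2 ⟨h1, h2⟩
  have hev : ∀ σ, ((ν σ).map (absorb Λ g σ)).toOuterMeasure (agreeSet S y) =
      (ν σ).toOuterMeasure {τ | absorb Λ g σ τ ∈ agreeSet S y} := fun σ => by
    rw [PMF.toOuterMeasure_map_apply]
    rfl
  have hmain := fun σ (hσ : σ ∈ μ.support) => switching_event_le hg hBΛ' (hμ σ hσ).2.1
    (hμ σ hσ).2.2 (hν σ) (hνsp' σ) S y hSa hSb hSc hN hy'
  rw [PMF.toOuterMeasure_bind_apply]
  by_cases hgc : g ∈ agreeSet Sc y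
  · rw [Set.indicator_of_mem hgc]
    have hcardS : #(S \ Sc) = #N + (#Sa + #Sb - #N) := by
      have h1 : S \ Sc = Sa ∪ Sb := by
        ext x
        simp only [hSa, hSb, hSc, Finset.mem_sdiff, Finset.mem_union, Finset.mem_filter]
        tauto
      have h2 : Disjoint Sa Sb := by
        rw [hSa, hSb, Finset.disjoint_filter]
        tauto
      have h3 : #N ≤ #Sa := Finset.card_filter_le _ _
      rw [h1, Finset.card_union_of_disjoint h2]
      omega
    calc ∑' σ, μ σ * ((ν σ).map (absorb Λ g σ)).toOuterMeasure (agreeSet S y)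
        ≤ ∑' σ, μ σ * (agreeSet N y').indicator (fun _ => q ^ (#Sa + #Sb - #N)) σ := by
          refine ENNReal.tsum_le_tsum fun σ => ?_
          by_cases hσ : σ ∈ μ.support
          · refine mul_le_mul_right ?_ _
            rw [hev]
            by_cases h0 : (ν σ).toOuterMeasure {τ | absorb Λ g σ τ ∈ agreeSet S y} = 0
            · rw [h0]; exact zero_le
            · obtain ⟨-, h1, h2⟩ := hmain σ hσ h0
              rwa [Set.indicator_of_mem h1]
          · rw [PMF.mem_support_iff, not_not] at hσ
            rw [hσ, zero_mul, zero_mul]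
      _ = μ.toOuterMeasure (agreeSet N y') * q ^ (#Sa + #Sb - #N) := pmf_tsum_mul_indicator _ _ _
      _ ≤ q ^ #N * q ^ (#Sa + #Sb - #N) := by
          refine mul_le_mul_left (hμsp' N (fun ℓ hℓ => ?_) y') _
          exact (Finset.mem_filter.1 (Finset.mem_filter.1 hℓ).1).2
      _ = q ^ #(S \ Sc) := by rw [hcardS, pow_add]
  · rw [Set.indicator_of_notMem hgc]
    refine le_of_eq (ENNReal.tsum_eq_zero.2 fun σ => ?_)
    by_cases hσ : σ ∈ μ.support
    · rw [hev]
      by_cases h0 : (ν σ).toOuterMeasure {τ | absorb Λ g σ τ ∈ agreeSet S y} = 0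
      · rw [h0, mul_zero]
      · exact absurd (hmain σ hσ h0).1 hgc
    · rw [PMF.mem_support_iff, not_not] at hσ
      rw [hσ, zero_mul]

end Absorb

section Assembly

/-- A bounded-degree tree has a small rooted part `P` with many disjoint closed neighbourhoods, and
the rest of the tree is attached to `P` in bounded pieces. -/
theorem SimpleGraph.IsTree.exists_decomposition {V : Type*} [Fintype V] {T : SimpleGraph V}
    (hT : T.IsTree) {Δ k K : ℕ} (hΔ1 : 1 ≤ Δ) (hΔ : ∀ v, #(nbr T v) ≤ Δ) (hK : 0 < K)
    (hcard : 1 + Δ * k < Fintype.card V) (hkn : k ≤ Fintype.card V) :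
    ∃ (r : V) (par : V → V) (dep : V → ℕ) (P B : Finset V) (J : ℕ), IsRooting T r par dep ∧
      r ∈ P ∧ (∀ v ∈ P, par v ∈ P) ∧ #P ≤ 1 + Δ * k ∧ (∀ b ∈ B, insert b (nbr T b) ⊆ P) ∧
      (∀ b ∈ B, ∀ c ∈ B, ∀ x ∈ insert b (nbr T b), x ∈ insert c (nbr T c) → b = c) ∧
      k ≤ #B * (Δ + 1) ^ 2 + 1 ∧ PieceChain par P (1 + Δ * K) J Finset.univ ∧
      J * K ≤ Fintype.card V + K := by
  obtain ⟨P, r, q, hrP, hqP, hrq, hkP, hPk, hP⟩ := hT.exists_pendant_subtree hΔ hcard hkn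
  obtain ⟨par, dep, hr⟩ := hT.exists_isRooting r
  obtain ⟨B, hBP, hB, hdisj⟩ := exists_disjoint_closed_nbr T hΔ (P.erase r)
  have hqr : par q = r := by
    rcases (hr.adj_iff _ _).1 hrq with h | h
    · exact absurd rfl h.1
    · exact h.2
  have hpar : ∀ v ∈ P, par v ∈ P := by
    intro v hv
    by_cases hvr : v = r
    · rw [hvr, hr.par_root]
      exact hrP
    · by_contra hcon
      exact hvr (hP v hv _ hcon ((hr.adj_iff _ _).2 (Or.inl ⟨hvr, rfl⟩))).1
  obtain ⟨J, hJ, hJK⟩ := hr.exists_pieceChain hK hΔ1 hΔ hrP hpar (hqr ▸ hrP)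
    fun v hv hvq hpv => hvq (hP _ hpv v hv ((hr.adj_iff _ _).2
      (Or.inr ⟨(ne_of_mem_of_not_mem hrP hv).symm, rfl⟩))).2
  refine ⟨r, par, dep, P, B, J, hr, hrP, hpar, hPk, fun b hb => ?_, hdisj, ?_, hJ, hJK⟩
  · obtain ⟨hbr, hbP⟩ := Finset.mem_erase.1 (hBP hb)
    refine Finset.insert_subset hbP fun x hx => ?_
    by_contra hxP
    exact hbr (hP b hbP x hxP (mem_nbr.1 hx)).1
  · have := Finset.card_erase_of_mem hrP
    omega

/-- Random embeddings of `P`, extended to `D` and completed by switching along `B`. -/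
theorem exists_spread_embedding_of_extension {V W : Type*} [Fintype V] [Fintype W]
    {T : SimpleGraph V} {ρ : V} {par : V → V} {dep : V → ℕ} (hr : IsRooting T ρ par dep)
    {G : SimpleGraph W} {P B D : Finset V} (hVW : Fintype.card V = Fintype.card W) (hPD : P ⊆ D)
    (hpar : ∀ v ∈ D, par v ∈ D) (hρ : ρ ∈ P) (hB : ∀ b ∈ B, insert b (nbr T b) ⊆ P)
    (hdisj : ∀ b ∈ B, ∀ c ∈ B, ∀ x ∈ insert b (nbr T b), x ∈ insert c (nbr T c) → b = c)
    {m t : ℕ} (hm : 0 < m) (hmt : m + #(Finset.univ \ D) ≤ t) {q : ℝ≥0∞}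
    (hq₁ : (m : ℝ≥0∞)⁻¹ ≤ q) (hq₂ : 9 * (#(Finset.univ \ D) : ℝ≥0∞)⁻¹ ≤ q) {μ : PMF (V → W)}
    (hμ : ∀ f ∈ μ.support, ∀ u v,
      t ≤ #(B.filter fun b => G.Adj u (f b) ∧ ∀ s ∈ nbr T b, G.Adj v (f s)))
    (hμsp : SpreadOn q P μ)
    (hext : ∀ f ∈ μ.support, ∃ κ : PMF (V → W), (∀ g ∈ κ.support, Set.InjOn g D ∧
      (∀ x ∈ D, x ≠ ρ → G.Adj (g (par x)) (g x)) ∧ ∀ x ∈ P, g x = f x) ∧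
      SpreadOn q (D \ P) κ) :
    ∃ ν : PMF (V → W), (∀ f ∈ ν.support, Function.Injective f ∧
      ∀ a b, T.Adj a b → G.Adj (f a) (f b)) ∧ SpreadOn (2 * q) Finset.univ ν := by
  have hext' : ∀ f, ∃ κ : PMF (V → W), f ∈ μ.support → (∀ g ∈ κ.support, Set.InjOn g D ∧
      (∀ x ∈ D, x ≠ ρ → G.Adj (g (par x)) (g x)) ∧ ∀ x ∈ P, g x = f x) ∧
      SpreadOn q (D \ P) κ := fun f => by
    by_cases hf : f ∈ μ.support
    · obtain ⟨κ, hκ⟩ := hext f hf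
      exact ⟨κ, fun _ => hκ⟩
    · exact ⟨PMF.pure f, fun h => absurd h hf⟩
  choose κ hκ using hext'
  have hsp : SpreadOn q D (μ.bind κ) :=
    hμsp.bind κ fun f hf => ⟨fun g hg => ((hκ f hf).1 g hg).2.2, (hκ f hf).2⟩
  have hD : Finset.univ \ (Finset.univ \ D) = D := by simp
  have hmem : ∀ v, v ∉ Finset.univ \ D ↔ v ∈ D := fun v => by simp
  have habs : ∀ g, ∃ η : PMF (V → W), g ∈ (μ.bind κ).support →
      (∀ f ∈ η.support, Function.Injective f ∧ ∀ a b, T.Adj a b → G.Adj (f a) (f b)) ∧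
      ∀ (S : Finset V) (y : V → W), ∃ C ⊆ S \ (Finset.univ \ D), η.toOuterMeasure (agreeSet S y) ≤
        (agreeSet C y).indicator (fun _ => q ^ #(S \ C)) g := fun g => by
    by_cases hg : g ∈ (μ.bind κ).support
    swap
    · exact ⟨PMF.pure g, fun h => absurd h hg⟩
    obtain ⟨f, hf, hgf⟩ := (PMF.mem_support_bind_iff _ _ _).1 hg
    obtain ⟨hinj, hadj, heq⟩ := (hκ f hf).1 g hgf
    have hstar : ∀ u v,
        t ≤ #(B.filter fun b => G.Adj u (g b) ∧ ∀ s ∈ nbr T b, G.Adj v (g s)) := fun u v => by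
      refine (hμ f hf u v).trans (Finset.card_le_card fun b hb => ?_)
      obtain ⟨hbB, h1, h2⟩ := Finset.mem_filter.1 hb
      refine Finset.mem_filter.2 ⟨hbB, ?_, fun s hs => ?_⟩
      · rw [heq b (hB b hbB (Finset.mem_insert_self _ _))]
        exact h1
      · rw [heq s (hB b hbB (Finset.mem_insert_of_mem hs))]
        exact h2 s hs
    obtain ⟨η, hη⟩ := exists_spread_absorb (Λ := Finset.univ \ D) hr hVW
      (fun a ha b hb hab => hinj ((hmem a).1 ha) ((hmem b).1 hb) hab)
      (fun x hx => hadj x ((hmem x).1 hx)) (fun x hx => (hmem _).2 (hpar x ((hmem x).1 hx)))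
      (fun b hb x hx => (hmem x).2 (hPD (hB b hb hx))) hdisj ((hmem ρ).2 (hPD hρ)) hm hmt
      hstar hq₁ hq₂
    exact ⟨η, fun _ => hη⟩
  choose η hη using habs
  refine ⟨(μ.bind κ).bind η, fun f hf => ?_, ?_⟩
  · obtain ⟨g, hg, hfg⟩ := (PMF.mem_support_bind_iff _ _ _).1 hf
    exact (hη g hg).1 f hfg
  · rw [← hD] at hsp
    exact hsp.bind_of_indicator η fun g hg => (hη g hg).2


theorem IsRegularPairing.mul_le_card {W : Type*} [Fintype W] {G : SimpleGraph W} {ε d : ℝ}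
    {k h : ℕ} {A B : Fin k → Finset W} (hAB : IsRegularPairing G ε d h A B) :
    k * h ≤ Fintype.card W := by
  have h1 : #(Finset.univ.biUnion A) = k * h := by
    rw [Finset.card_biUnion fun i _ j _ hij => hAB.disjoint_left i j hij]
    simp [hAB.card_left]
  rw [← h1]
  exact Finset.card_le_univ _

/-- An embedding of the part `P` avoiding the reserve `Z` extends to an almost spanning part `D` in a
spread way. -/
theorem exists_spread_extension (α η c : ℝ) (M : ℕ) (hα : 0 < α) (hα1 : α ≤ 1 / 10)
    (hη : 0 < η) (hη1 : η ≤ 1) (hc : 0 < c) :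
    ∃ δ : ℝ, 0 < δ ∧ ∃ N : ℕ, ∀ (V W : Type) [Fintype W], N ≤ Fintype.card W →
      ∀ (T : SimpleGraph V) (ρ : V) (par : V → V) (dep : V → ℕ) (G : SimpleGraph W)
        (P D : Finset V) (j m : ℕ) (Z : Finset W) (f : V → W), IsRooting T ρ par dep →
      PieceChain par P M j D → ρ ∈ P → (∀ v ∈ P, par v ∈ P) →
      (#P : ℝ) ≤ α / 8 * Fintype.card W →
      (#D : ℝ) + η * Fintype.card W ≤ Fintype.card W + 1 + M →
      (j : ℝ) ≤ c / 4 * Fintype.card W →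
      (#Z : ℝ) ≤ α / 8 * Fintype.card W → (#Z : ℝ) ≤ η / 8 * Fintype.card W →
      (∀ u v, c * Fintype.card W ≤ #(Z ∩ (nbr G u ∩ nbr G v))) →
      (∀ v, (1 + α) * Fintype.card W / 2 ≤ #(nbr G v)) →
      Set.InjOn f P → (∀ x ∈ P, f x ∉ Z) → (∀ x ∈ P, x ≠ ρ → G.Adj (f (par x)) (f x)) →
      0 < m → (m : ℝ) ≤ δ * Fintype.card W →
      ∃ κ : PMF (V → W), (∀ g ∈ κ.support, Set.InjOn g D ∧
        (∀ x ∈ D, x ≠ ρ → G.Adj (g (par x)) (g x)) ∧ ∀ x ∈ P, g x = f x) ∧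
        SpreadOn ((m : ℝ≥0∞)⁻¹) (D \ P) κ := by
  set d : ℝ := α / 4 / 8 with hd
  set θ : ℝ := η / 8 with hθ
  set ε : ℝ := d * θ / 2 with hε
  have hd0 : 0 < d := by positivity
  have hd1 : d ≤ 1 := by linarith
  have hθ0 : 0 < θ := by positivity
  have hεθ : ε ≤ θ / 2 := by nlinarith
  have hε0 : 0 < ε := by positivity
  obtain ⟨k₀, N₀, hreg⟩ := exists_isRegularPairing (α / 4) ε (by positivity) (by linarith) hε0
    (by linarith)
  have hk₁ : (0 : ℝ) < k₀ + 1 := by positivity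
  set δ : ℝ := min (d * θ / (16 * (k₀ + 1))) (min (c / 4) (c * θ / (64 * (k₀ + 1)))) with hδ
  have hδ0 : 0 < δ := by positivity
  have hδ1 : δ ≤ d * θ / (16 * (k₀ + 1)) := min_le_left _ _
  have hδ2 : δ ≤ c / 4 := (min_le_right _ _).trans (min_le_left _ _)
  have hδ3 : δ ≤ c * θ / (64 * (k₀ + 1)) := (min_le_right _ _).trans (min_le_right _ _)
  obtain ⟨N₁, hN₁⟩ := exists_nat_ge (M / δ)
  obtain ⟨N₂, hN₂⟩ := exists_nat_ge ((k₀ * M + 1 + M) / (η / 8))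
  refine ⟨δ, hδ0, max (2 * N₀ + 1) (max N₁ N₂), ?_⟩
  intro V W _ hN T ρ par dep G P D j m Z f hr hch hρ hpar hP hD hj hZ1 hZ2 hcZ hdeg hinj hfZ hadj
    hm0 hm
  set n : ℝ := (Fintype.card W : ℝ) with hn
  have hn1 : 2 * (N₀ : ℝ) + 1 ≤ n := by
    rw [hn]; exact_mod_cast (le_max_left _ _).trans hN
  have hnM : (M : ℝ) ≤ δ * n := by
    have : (N₁ : ℝ) ≤ n := by
      rw [hn]; exact_mod_cast ((le_max_left _ _).trans (le_max_right _ _)).trans hN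
    rw [← div_le_iff₀' hδ0]
    linarith
  have hnk : k₀ * M + 1 + M ≤ η / 8 * n := by
    have : (N₂ : ℝ) ≤ n := by
      rw [hn]; exact_mod_cast ((le_max_right _ _).trans (le_max_right _ _)).trans hN
    rw [← div_le_iff₀' (by positivity)]
    linarith
  have hN₀0 : (0 : ℝ) ≤ N₀ := Nat.cast_nonneg _
  have hn0 : 0 < n := by linarith
  set U : Finset W := (Finset.univ \ Z) \ P.image f with hU
  have hsub : ∀ X : Finset W, (#X : ℝ) ≤ #(X ∩ U) + #Z + #P := by
    intro X
    have h1 : X ⊆ (X ∩ U) ∪ (Z ∪ P.image f) := by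
      intro x hx
      simp only [hU, Finset.mem_union, Finset.mem_inter, Finset.mem_sdiff, Finset.mem_univ, hx,
        true_and]
      tauto
    have h2 := Finset.card_le_card h1
    have h3 := Finset.card_union_le (X ∩ U) (Z ∪ P.image f)
    have h4 := Finset.card_union_le Z (P.image f)
    have h5 : #(P.image f) ≤ #P := Finset.card_image_le
    exact_mod_cast (by omega : #X ≤ #(X ∩ U) + #Z + #P)
  have hUn : n ≤ #U + #Z + #P := by
    have := hsub Finset.univ
    rwa [Finset.univ_inter, Finset.card_univ] at this
  have hUle : (#U : ℝ) ≤ n := by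
    rw [hn]; exact_mod_cast Finset.card_le_univ U
  have hUbig : 3 / 4 * n ≤ #U := by
    have := mul_le_mul_of_nonneg_right hα1 hn0.le
    linarith
  obtain ⟨k, h, A, B, hkk, hAB, hABU, hcov⟩ := hreg W G U
    (by
      have : (N₀ : ℝ) ≤ #U := by linarith
      exact_mod_cast this)
    (fun v _ => by
      have h1 := hsub (nbr G v)
      have h2 := hdeg v
      have h3 := mul_le_mul_of_nonneg_left hUle hα.le
      linarith)
  have hε8 : ε ≤ 1 / 16 := by linarith
  have hkk' : (k : ℝ) ≤ k₀ := by exact_mod_cast hkk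
  have hkh : (k : ℝ) * h ≤ n := by
    rw [hn]; exact_mod_cast hAB.mul_le_card
  have hεU : ε * #U ≤ 1 / 16 * n :=
    mul_le_mul hε8 hUle (Nat.cast_nonneg _) (by norm_num)
  have h2kh : n / 2 ≤ 2 * k * h := by linarith
  have hk0 : 0 < k := by
    rcases Nat.eq_zero_or_pos k with h0 | h0
    · rw [h0] at h2kh
      norm_num at h2kh
      linarith
    · exact h0
  have hh0 : (0 : ℝ) ≤ h := Nat.cast_nonneg _
  have hh : n ≤ 4 * (k₀ + 1) * h := by
    have : (k : ℝ) * h ≤ k₀ * h := mul_le_mul_of_nonneg_right hkk' hh0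
    linarith
  have hhpos : (0 : ℝ) < h := by
    refine hh0.lt_of_ne fun h0 => ?_
    rw [← h0, mul_zero] at hh
    linarith
  have hM0 : (0 : ℝ) ≤ M := Nat.cast_nonneg _
  have hmM : (m + M : ℝ) ≤ 2 * δ * n := by linarith
  have hUmem : ∀ w ∈ U, w ∉ Z ∧ w ∉ P.image f := fun w hw => by
    simpa [hU] using hw
  obtain ⟨κ, hκ, hκsp⟩ := hch.exists_spread_balanced (m := m) (c := c * n) (x₀ := θ * h) (f₀ := f)
    (Z := Z) hr hAB
    (fun i => ⟨Finset.disjoint_right.2 fun w hw => (hUmem w ((hABU i).1 hw)).1,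
      Finset.disjoint_right.2 fun w hw => (hUmem w ((hABU i).2 hw)).1⟩)
    (fun x hx i => ⟨fun hw => (hUmem _ ((hABU i).1 hw)).2 (Finset.mem_image_of_mem f hx),
      fun hw => (hUmem _ ((hABU i).2 hw)).2 (Finset.mem_image_of_mem f hx)⟩)
    hfZ hρ hinj hadj hpar hm0 hk0
    (by
      have h1 : (k : ℝ) * M ≤ k₀ * M := mul_le_mul_of_nonneg_right hkk' hM0
      have h2 : θ * (k * h) ≤ θ * n := mul_le_mul_of_nonneg_left hkh hθ0.le
      have h3 : ε * #U ≤ ε * n := mul_le_mul_of_nonneg_left hUle hε0.le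
      have h4 : ε * n ≤ θ / 2 * n := mul_le_mul_of_nonneg_right hεθ hn0.le
      rw [hθ] at h2 h4 hZ2
      rw [hθ]
      linarith)
    hd0.le hcZ (by linarith)
    (by
      have h1 : δ * n ≤ d * θ / (16 * (k₀ + 1)) * (4 * (k₀ + 1) * h) :=
        mul_le_mul hδ1 hh hn0.le (by positivity)
      have h2 : d * θ / (16 * (k₀ + 1)) * (4 * (k₀ + 1) * h) = d * θ * h / 4 := by
        field_simp
        ring
      rw [hε, ← hd]
      linarith)
    (by
      have := mul_le_mul_of_nonneg_right hδ2 hn0.le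
      linarith)
    (mul_lt_mul_of_pos_right (by linarith) hhpos)
    (by
      have h1 : δ * n ≤ c * θ / (64 * (k₀ + 1)) * (4 * (k₀ + 1) * h) :=
        mul_le_mul hδ3 hh hn0.le (by positivity)
      have h2 : c * θ / (64 * (k₀ + 1)) * (4 * (k₀ + 1) * h) = c * (θ * h) / 16 := by
        field_simp
        ring
      have h3 : ε * h ≤ θ / 2 * h := mul_le_mul_of_nonneg_right hεθ hh0
      have h4 : 4 * (m + M : ℝ) ≤ c * (θ * h - ε * h) := by
        have : c * (θ / 2 * h) ≤ c * (θ * h - ε * h) :=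
          mul_le_mul_of_nonneg_left (by linarith) hc.le
        linarith
      have := mul_le_mul_of_nonneg_right h4 hn0.le
      linarith)
  exact ⟨κ, fun g hg => ⟨(hκ g hg).injOn, (hκ g hg).adj, (hκ g hg).eq_on⟩, hκsp⟩


theorem codegree_ge {W : Type*} [Fintype W] {G : SimpleGraph W} {α : ℝ}
    (hG : ∀ v, (1 + α) * Fintype.card W / 2 ≤ #(nbr G v)) (u v : W) :
    α * Fintype.card W ≤ #(nbr G u ∩ nbr G v) := by
  have h1 : (#(nbr G u ∪ nbr G v) : ℝ) + #(nbr G u ∩ nbr G v) = #(nbr G u) + #(nbr G v) := by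
    exact_mod_cast Finset.card_union_add_card_inter (nbr G u) (nbr G v)
  have h2 : (#(nbr G u ∪ nbr G v) : ℝ) ≤ Fintype.card W := by
    exact_mod_cast Finset.card_le_univ _
  have := hG u
  have := hG v
  linarith

theorem two_mul_eighteen_mul_inv_le_ofReal_div {m n C : ℕ} {δ : ℝ} (hδ : 0 < δ) (hn : 0 < n)
    (hm : δ * n ≤ 2 * m) (hC : 72 / δ ≤ C) :
    2 * (18 * (m : ℝ≥0∞)⁻¹) ≤ ENNReal.ofReal ((C : ℝ) / n) := by
  have hn' : (0 : ℝ) < n := by exact_mod_cast hn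
  have hm' : (0 : ℝ) < m := by
    have := mul_pos hδ hn'
    linarith
  have h1 : 2 * (18 * (m : ℝ≥0∞)⁻¹) = ENNReal.ofReal (36 / m) := by
    rw [ENNReal.ofReal_div_of_pos hm', ENNReal.ofReal_natCast, ENNReal.div_eq_inv_mul, ← mul_assoc,
      mul_comm]
    norm_num
  rw [h1]
  refine ENNReal.ofReal_le_ofReal ?_
  rw [div_le_div_iff₀ hm' hn']
  rw [div_le_iff₀ hδ] at hC
  have h2 : (C : ℝ) * (δ * n) ≤ C * (2 * m) := mul_le_mul_of_nonneg_left hm (Nat.cast_nonneg _)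
  have h3 : 72 * (n : ℝ) ≤ C * δ * n := mul_le_mul_of_nonneg_right hC hn'.le
  linarith

theorem inv_le_eighteen_mul_inv (x : ℝ≥0∞) : x⁻¹ ≤ 18 * x⁻¹ ∧ 2 * x⁻¹ ≤ 18 * x⁻¹ := by
  constructor
  · nth_rewrite 1 [← one_mul x⁻¹]
    exact mul_le_mul_left (by norm_num) _
  · exact mul_le_mul_left (by norm_num) _

theorem nine_mul_inv_le_eighteen_mul_inv {m l : ℕ} (h : m ≤ 2 * l) :
    9 * (l : ℝ≥0∞)⁻¹ ≤ 18 * (m : ℝ≥0∞)⁻¹ := by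
  have h1 : (m : ℝ≥0∞) ≤ 2 * l := by exact_mod_cast h
  have h2 : (2 : ℝ≥0∞)⁻¹ * (l : ℝ≥0∞)⁻¹ ≤ (m : ℝ≥0∞)⁻¹ := by
    rw [← ENNReal.mul_inv (Or.inl two_ne_zero) (Or.inl ENNReal.ofNat_ne_top)]
    exact ENNReal.inv_le_inv.2 h1
  refine le_trans (le_of_eq ?_) (mul_le_mul_right h2 18)
  rw [← mul_assoc, show (18 : ℝ≥0∞) = 9 * 2 by norm_num, mul_assoc 9,
    ENNReal.mul_inv_cancel two_ne_zero ENNReal.ofNat_ne_top, mul_one]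

set_option maxHeartbeats 1000000 in
theorem exists_spread_embedding (Δ : ℕ) (hΔ1 : 1 ≤ Δ) (α : ℝ) (hα : 0 < α) (hα1 : α ≤ 1 / 10) :
    ∃ N C : ℕ, ∀ (V W : Type) [Fintype V] [Fintype W], Fintype.card V = Fintype.card W →
      N ≤ Fintype.card W → ∀ (T : SimpleGraph V) (G : SimpleGraph W), T.IsTree →
      (∀ v, #(nbr T v) ≤ Δ) → (∀ v, (1 + α) * Fintype.card W / 2 ≤ #(nbr G v)) →
      ∃ ν : PMF (V → W), (∀ f ∈ ν.support, Function.Injective f ∧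
        ∀ a b, T.Adj a b → G.Adj (f a) (f b)) ∧
        SpreadOn (ENNReal.ofReal ((C : ℝ) / Fintype.card W)) Finset.univ ν := by
  have hΔ0 : (1 : ℝ) ≤ Δ := by exact_mod_cast hΔ1
  have hγ : (α / 4) ^ (Δ + 1) ≤ 1 := pow_le_one₀ (by linarith) (by linarith)
  have hγ0 : 0 < (α / 4) ^ (Δ + 1) := pow_pos (by linarith) _
  set β : ℝ := α / (32 * Δ) / (Δ + 1) ^ 2 with hβ
  obtain ⟨c₁, hc₁, N₁, hN₁⟩ := exists_sq_mul_pow_lt 2 (1 - (α / 4) ^ (Δ + 1) / 2) β (by norm_num)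
    (by linarith) (by linarith) (by positivity)
  set η : ℝ := min (c₁ / 4) (1 / 2) with hη
  have hη0 : 0 < η := lt_min (by linarith) (by norm_num)
  have hηc : η ≤ c₁ / 4 := min_le_left _ _
  have hη1 : η ≤ 1 / 2 := min_le_right _ _
  obtain ⟨c, hc, N₂, hN₂⟩ := exists_reserve (min (α / 8) (η / 8)) α
    (lt_min (by linarith) (by linarith)) hα
  obtain ⟨K, hK⟩ := exists_nat_ge (8 / c)
  have hK0 : (0 : ℝ) < K := lt_of_lt_of_le (by positivity) hK
  obtain ⟨δ₁, hδ₁, N₃, hN₃⟩ := exists_spread_extension α η c (1 + Δ * K) hα hα1 hη0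
    (by linarith) hc
  set δ : ℝ := min δ₁ (min η (α / 4)) with hδ
  have hδ0 : 0 < δ := lt_min hδ₁ (lt_min hη0 (by linarith))
  have hδδ₁ : δ ≤ δ₁ := min_le_left _ _
  have hδη : δ ≤ η := (min_le_right _ _).trans (min_le_left _ _)
  have hδα : δ ≤ α / 4 := (min_le_right _ _).trans (min_le_right _ _)
  obtain ⟨C, hC⟩ := exists_nat_ge (72 / δ)
  obtain ⟨N₄, hN₄⟩ := exists_nat_ge (64 * Δ / α + 2 / δ + 2 / c₁ + 2 * (2 + Δ * K) / η + 8 / c)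
  refine ⟨N₁ + N₂ + N₃ + N₄, C, ?_⟩
  intro V W _ _ hVW hN T G hT hTΔ hG
  have hn4 : (N₄ : ℝ) ≤ Fintype.card W := by exact_mod_cast (by omega : N₄ ≤ Fintype.card W)
  set n : ℝ := (Fintype.card W : ℝ) with hn
  have hp1 : 0 < 64 * Δ / α := by positivity
  have hp2 : 0 < 2 / δ := by positivity
  have hp3 : 0 < 2 / c₁ := by positivity
  have hp4 : 0 < 2 * (2 + Δ * K) / η := by positivity
  have hp5 : 0 < 8 / c := by positivity
  have hn0 : 0 < n := by linarith
  have hnα : 64 * Δ ≤ α * n := by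
    rw [← div_le_iff₀' hα]; linarith
  have hnδ : 2 ≤ δ * n := by
    rw [← div_le_iff₀' hδ0]; linarith
  have hnc₁ : 2 ≤ c₁ * n := by
    rw [← div_le_iff₀' hc₁]; linarith
  have hnη : 2 * (2 + Δ * K) ≤ η * n := by
    rw [← div_le_iff₀' hη0]; linarith
  have hnc : 8 ≤ c * n := by
    rw [← div_le_iff₀' hc]; linarith
  have hαn : α * n ≤ 1 / 10 * n := mul_le_mul_of_nonneg_right hα1 hn0.le
  obtain ⟨Z, hZ, hcZ⟩ := hN₂ W (by omega) (fun u v => nbr G u ∩ nbr G v) (codegree_ge hG)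
  have hZα : (#Z : ℝ) ≤ α / 8 * n :=
    hZ.trans (mul_le_mul_of_nonneg_right (min_le_left _ _) hn0.le)
  have hZη : (#Z : ℝ) ≤ η / 8 * n :=
    hZ.trans (mul_le_mul_of_nonneg_right (min_le_right _ _) hn0.le)
  set k := ⌊α * n / (16 * Δ)⌋₊ with hk
  have hk1 : Δ * (k : ℝ) ≤ α * n / 16 := by
    have h1 : (k : ℝ) ≤ α * n / (16 * Δ) := Nat.floor_le (by positivity)
    rw [le_div_iff₀ (by positivity)] at h1
    linarith
  have hk2 : α * n / (16 * Δ) < k + 1 := Nat.lt_floor_add_one _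
  have hΔk : 1 + Δ * (k : ℝ) ≤ α / 8 * n := by linarith
  have hcard : 1 + Δ * k < Fintype.card V := by
    have h1 : 1 + Δ * (k : ℝ) < n := by linarith
    rw [hn] at h1
    rw [hVW]
    exact_mod_cast h1
  obtain ⟨r, par, dep, P, B, J, hr, hrP, hpar, hPk, hB, hdisj, hkB, hJ, hJK⟩ :=
    hT.exists_decomposition (K := K) hΔ1 hTΔ (by exact_mod_cast hK0) hcard (by nlinarith)
  have hP : (#P : ℝ) ≤ α / 8 * n := by
    have h1 : (#P : ℝ) ≤ 1 + Δ * k := by exact_mod_cast hPk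
    linarith
  have hBβ : β * n ≤ #B := by
    have h1 : (k : ℝ) ≤ #B * (Δ + 1) ^ 2 + 1 := by exact_mod_cast hkB
    have h2 : 2 ≤ α * n / (32 * Δ) := by
      rw [le_div_iff₀ (by positivity)]
      linarith
    have h3 : α * n / (16 * Δ) = 2 * (α * n / (32 * Δ)) := by
      field_simp
      norm_num
    have h4 : β * n = α * n / (32 * Δ) / (Δ + 1) ^ 2 := by
      rw [hβ]
      ring
    rw [h4, div_le_iff₀ (by positivity)]
    linarith
  set t := ⌊c₁ * n⌋₊ with ht
  have ht1 : (t : ℝ) ≤ c₁ * n := Nat.floor_le (by positivity)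
  have ht2 : c₁ * n < t + 1 := Nat.lt_floor_add_one _
  set m := ⌊δ * n⌋₊ with hm
  have hm1 : (m : ℝ) ≤ δ * n := Nat.floor_le (by positivity)
  have hm2 : δ * n < m + 1 := Nat.lt_floor_add_one _
  have hm0 : 0 < m := by
    have : (0 : ℝ) < m := by linarith
    exact_mod_cast this
  set s := ⌊η * n⌋₊ with hs
  have hs1 : (s : ℝ) ≤ η * n := Nat.floor_le (by positivity)
  have hs2 : η * n < s + 1 := Nat.lt_floor_add_one _
  have hsP : s + #P ≤ Fintype.card V := by
    have h1 : η * n ≤ 1 / 2 * n := mul_le_mul_of_nonneg_right hη1 hn0.le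
    have h2 : (s : ℝ) + #P ≤ n := by linarith
    rw [hn] at h2
    rw [hVW]
    exact_mod_cast h2
  obtain ⟨j, hjJ, D, hD, hDs, hDM⟩ := hJ.exists_card_between (t := Fintype.card V - s) (by omega)
    (by rw [Finset.card_univ]; omega)
  have hΛ : #(Finset.univ \ D) = Fintype.card V - #D := by
    rw [Finset.card_sdiff_of_subset (Finset.subset_univ _), Finset.card_univ]
  have hΛ1 : #(Finset.univ \ D) ≤ s := by omega
  have hΛ2 : (s : ℝ) ≤ #(Finset.univ \ D) + (1 + Δ * K) := by
    exact_mod_cast (by omega : s ≤ #(Finset.univ \ D) + (1 + Δ * K))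
  have hDn : (#D : ℝ) + η * n ≤ n + 1 + ((1 + Δ * K : ℕ) : ℝ) := by
    have h1 : (#D : ℝ) + s ≤ n + ((1 + Δ * K : ℕ) : ℝ) := by
      rw [hn]
      exact_mod_cast (by omega : #D + s ≤ Fintype.card W + (1 + Δ * K))
    linarith
  have hj : (j : ℝ) ≤ c / 4 * n := by
    have h1 : (j : ℝ) * K ≤ n + K := by
      rw [hn, ← hVW]
      exact_mod_cast (Nat.mul_le_mul_right K hjJ).trans hJK
    rw [div_le_iff₀ hc] at hK
    by_contra! hcon
    have h2 : ((j : ℝ) - 1) * 8 ≤ (j - 1) * (K * c) :=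
      mul_le_mul_of_nonneg_left hK (by linarith)
    have h3 : ((j : ℝ) - 1) * K * c ≤ n * c := mul_le_mul_of_nonneg_right (by linarith) hc.le
    linarith
  have hcod : ∀ u v, α / 4 * Fintype.card W + #P ≤ #((nbr G u ∩ nbr G v) \ Z) := fun u v => by
    have h1 := codegree_ge hG u v
    have h2 : (#(nbr G u ∩ nbr G v) : ℝ) ≤ #((nbr G u ∩ nbr G v) \ Z) + #Z := by
      exact_mod_cast Finset.card_le_card_sdiff_add_card
    linarith
  obtain ⟨μ, hμ, hμsp⟩ := exists_spread_robust_embedding hr hTΔ G hpar hB hdisj Z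
    (by linarith : 0 < α / 4) (by linarith) hm0
    (hm1.trans (mul_le_mul_of_nonneg_right hδα hn0.le)) hcod
    (hN₁ (Fintype.card W) (by omega) #B t hBβ ht1)
  have hmt : m + #(Finset.univ \ D) ≤ t := by
    have h1 : (#(Finset.univ \ D) : ℝ) ≤ s := by exact_mod_cast hΛ1
    have h2 : δ * n ≤ c₁ / 4 * n := mul_le_mul_of_nonneg_right (hδη.trans hηc) hn0.le
    have h3 : η * n ≤ c₁ / 4 * n := mul_le_mul_of_nonneg_right hηc hn0.le
    have h4 : (m : ℝ) + #(Finset.univ \ D) ≤ t := by linarith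
    exact_mod_cast h4
  have hmΛ : m ≤ 2 * #(Finset.univ \ D) := by
    have h1 : δ * n ≤ η * n := mul_le_mul_of_nonneg_right hδη hn0.le
    have h2 : (m : ℝ) ≤ 2 * #(Finset.univ \ D) := by linarith
    exact_mod_cast h2
  have hq := inv_le_eighteen_mul_inv (m : ℝ≥0∞)
  have hext : ∀ f ∈ μ.support, ∃ κ : PMF (V → W), (∀ g ∈ κ.support, Set.InjOn g D ∧
      (∀ x ∈ D, x ≠ r → G.Adj (g (par x)) (g x)) ∧ ∀ x ∈ P, g x = f x) ∧
      SpreadOn (18 * (m : ℝ≥0∞)⁻¹) (D \ P) κ := fun f hf => by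
    obtain ⟨h1, h2, h3, -⟩ := hμ f hf
    obtain ⟨κ, hκ, hκsp⟩ := hN₃ V W (by omega) T r par dep G P D j m Z f hr hD hrP hpar hP hDn hj
      hZα hZη hcZ hG h1 h2 h3 hm0 (hm1.trans (mul_le_mul_of_nonneg_right hδδ₁ hn0.le))
    exact ⟨κ, hκ, hκsp.mono hq.1⟩
  obtain ⟨ν, hν, hνsp⟩ := exists_spread_embedding_of_extension hr hVW hD.subset
    (hD.par_mem hpar) hrP hB hdisj hm0 hmt hq.1 (nine_mul_inv_le_eighteen_mul_inv hmΛ)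
    (fun f hf => (hμ f hf).2.2.2) (hμsp.mono hq.2) hext
  refine ⟨ν, hν, hνsp.mono (two_mul_eighteen_mul_inv_le_ofReal_div hδ0 ?_ (by linarith) hC)⟩
  rw [hn] at hn0
  exact_mod_cast hn0

end Assembly

end

end

/-- Pham–Sah–Sawhney–Simkin.
For every `Δ ∈ ℕ` and `α > 0` there exist `n₀, C ∈ ℕ` such that for all `n ≥ n₀`:
if `G` is an `n`-vertex graph with minimum degree at least `(1+α)·n/2` and `T` is an
`n`-vertex tree with maximum degree at most `Δ`, then there is a `(C/n)`-spread
probability distribution on embeddings (injective graph homomorphisms) of `T` into `G`. -/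
theorem stmt_0 (Δ : ℕ) (α : ℝ) (hα : 0 < α) :
    ∃ n₀ C : ℕ, ∀ n : ℕ, n₀ ≤ n →
      ∀ (G T : SimpleGraph (Fin n)) [DecidableRel G.Adj] [DecidableRel T.Adj],
        (1 + α) * n / 2 ≤ (G.minDegree : ℝ) →
        T.IsTree → T.maxDegree ≤ Δ →
        ∃ μ : PMF {f : Fin n → Fin n //
            Function.Injective f ∧ ∀ a b, T.Adj a b → G.Adj (f a) (f b)},
          ∀ (s : ℕ) (x y : Fin s → Fin n),
            Function.Injective x → Function.Injective y →
            μ.toOuterMeasure {f | ∀ i, f.1 (x i) = y i} ≤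
              ENNReal.ofReal (((C : ℝ) / n) ^ s) := by
  classical
  obtain ⟨N, C, hNC⟩ := exists_spread_embedding (max Δ 1) (le_max_right _ _) (min α (1 / 10))
    (lt_min hα (by norm_num)) (min_le_right _ _)
  refine ⟨N, C, fun n hn G T _ _ hG hT hΔ => ?_⟩
  have hdeg : ∀ (H : SimpleGraph (Fin n)) [DecidableRel H.Adj] (v : Fin n),
      (nbr H v).card = H.degree v := fun H _ v => by
    rw [← SimpleGraph.card_neighborFinset_eq_degree]
    congr 1
    ext w
    simp
  obtain ⟨ν, hν, hsp⟩ := hNC (Fin n) (Fin n) rfl (by simpa using hn) T G hT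
    (fun v => by
      rw [hdeg T]
      exact (T.degree_le_maxDegree v).trans (hΔ.trans (le_max_left _ _)))
    (fun v => by
      rw [hdeg G, Fintype.card_fin]
      have h1 : (G.minDegree : ℝ) ≤ G.degree v := by exact_mod_cast G.minDegree_le_degree v
      have h2 : (1 + min α (1 / 10)) * (n : ℝ) ≤ (1 + α) * n :=
        mul_le_mul_of_nonneg_right (by linarith [min_le_left α (1 / 10)]) (Nat.cast_nonneg _)
      linarith)
  refine ⟨ν.bindOnSupport fun f hf => PMF.pure ⟨f, hν f hf⟩, fun s x y hx _ => ?_⟩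
  have h1 := hsp (Finset.univ.image x) (Finset.subset_univ _)
    (fun v => if h : ∃ i, x i = v then y h.choose else v)
  rw [Finset.card_image_of_injective _ hx, Finset.card_univ, Fintype.card_fin, Fintype.card_fin,
    ← ENNReal.ofReal_pow (by positivity)] at h1
  refine le_trans ?_ h1
  rw [PMF.toOuterMeasure_bindOnSupport_apply, PMF.toOuterMeasure_apply]
  refine ENNReal.tsum_le_tsum fun f => ?_
  split_ifs with hf
  · simp
  · rw [PMF.toOuterMeasure_pure_apply]
    split_ifs with hfx
    · rw [mul_one, Set.indicator_of_mem]
      intro v hv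
      obtain ⟨i, -, rfl⟩ := Finset.mem_image.1 hv
      have hex : ∃ j, x j = x i := ⟨i, rfl⟩
      have hfx' : ∀ i, f (x i) = y i := hfx
      change f (x i) = if h : ∃ j, x j = x i then y h.choose else x i
      rw [dif_pos hex, hfx', hx hex.choose_spec]
    · simp
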